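/- Let Q = Σ_{i=0}^d a_i X^i be a nonzero degree-d polynomial with coefficients a_i Siegel modular forms of weight k₀ + (d−i)k for Sp_{2g}(Z), g ≥ 2, and let f ∈ FM^{(g)}_k be a symmetric formal Fourier-Jacobi series of cogenus 1 with Q(f) = 0 as formal series. Then the series f converges absolutely on all of H_g and defines a holomorphic Siegel modular form of weight k. -/

import Mathlib

/-!
STATEMENT 15: Let Q = Σ_{i=0}^d aᵢ Xⁱ be a nonzero degree-d polynomial with
coefficients aᵢ Siegel modular forms of weight k₀ + (d−i)k for Sp_{2g}(ℤ), g ≥ 2,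
and let f ∈ FM^{(g)}_k be a symmetric formal Fourier-Jacobi series of cogenus 1
with Q(f) = 0 as formal series.  Then the series f converges absolutely on all of
ℍ_g and defines a holomorphic Siegel modular form of weight k.

A symmetric formal Fourier-Jacobi series is encoded by its family of formal
Fourier coefficients `c : MatQ g → ℂ` (see `IsSymFM` below); products of formal
series correspond to convolutions (`convC`, `powC`) of coefficient families, and
the conclusion — convergence on all of ℍ_g to a Siegel modular form of weight k —
is expressed by exhibiting a Siegel modular form `F` (which by definition is
holomorphic, transforms correctly, and has a convergent Fourier expansion on all
of ℍ_g) whose Fourier coefficients are exactly `c`.  Here `g = h + 1` with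
`h ≥ 1`.
-/

noncomputable section
open Complex Matrix

attribute [local instance] Matrix.normedAddCommGroup Matrix.normedSpace

/-- Square complex matrices of size `g`. -/
abbrev MatC (g : ℕ) := Matrix (Fin g) (Fin g) ℂ
/-- Square rational matrices of size `g`. -/
abbrev MatQ (g : ℕ) := Matrix (Fin g) (Fin g) ℚ

/-- The Siegel upper half space of genus `g`: symmetric complex matrices with
positive definite imaginary part. -/
def Sieg (g : ℕ) : Set (MatC g) :=
  {τ | τ.IsSymm ∧ (τ.map Complex.im).PosDef}

/-- The standard symplectic form. -/
def sympJ (g : ℕ) : Matrix (Fin g ⊕ Fin g) (Fin g ⊕ Fin g) ℤ :=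
  Matrix.fromBlocks 0 1 (-1) 0

/-- The integral symplectic group `Sp_{2g}(ℤ)` (as a set of integral matrices). -/
def SpZ (g : ℕ) : Set (Matrix (Fin g ⊕ Fin g) (Fin g ⊕ Fin g) ℤ) :=
  {γ | γᵀ * sympJ g * γ = sympJ g}

variable {g : ℕ}

/-- Block `a` of a symplectic matrix, as a complex matrix. -/
def blkA (γ : Matrix (Fin g ⊕ Fin g) (Fin g ⊕ Fin g) ℤ) : MatC g :=
  Matrix.of fun i j => ((γ (Sum.inl i) (Sum.inl j) : ℤ) : ℂ)
/-- Block `b`. -/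
def blkB (γ : Matrix (Fin g ⊕ Fin g) (Fin g ⊕ Fin g) ℤ) : MatC g :=
  Matrix.of fun i j => ((γ (Sum.inl i) (Sum.inr j) : ℤ) : ℂ)
/-- Block `c`. -/
def blkC (γ : Matrix (Fin g ⊕ Fin g) (Fin g ⊕ Fin g) ℤ) : MatC g :=
  Matrix.of fun i j => ((γ (Sum.inr i) (Sum.inl j) : ℤ) : ℂ)
/-- Block `d`. -/
def blkD (γ : Matrix (Fin g ⊕ Fin g) (Fin g ⊕ Fin g) ℤ) : MatC g :=
  Matrix.of fun i j => ((γ (Sum.inr i) (Sum.inr j) : ℤ) : ℂ)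

/-- The matrix `c τ + d`. -/
def jmat (γ : Matrix (Fin g ⊕ Fin g) (Fin g ⊕ Fin g) ℤ) (τ : MatC g) : MatC g :=
  blkC γ * τ + blkD γ

/-- The factor of automorphy `det (c τ + d)`. -/
def jden (γ : Matrix (Fin g ⊕ Fin g) (Fin g ⊕ Fin g) ℤ) (τ : MatC g) : ℂ :=
  (jmat γ τ).det

/-- The action `τ ↦ (a τ + b)(c τ + d)⁻¹` of `Sp_{2g}` on the Siegel upper half
space. -/
def actSp (γ : Matrix (Fin g ⊕ Fin g) (Fin g ⊕ Fin g) ℤ) (τ : MatC g) : MatC g :=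
  (blkA γ * τ + blkB γ) * (jmat γ τ)⁻¹

/-- A rational symmetric matrix is half-integral if its off-diagonal entries lie in
`½ℤ` and its diagonal entries are integers. -/
def HalfIntegral (t : MatQ g) : Prop :=
  t.IsSymm ∧ (∀ i j, ∃ z : ℤ, 2 * t i j = z) ∧ (∀ i, ∃ z : ℤ, t i i = z)

/-- Positive semi-definiteness for rational symmetric matrices. -/
def PosSemidefQ (t : MatQ g) : Prop :=
  ∀ v : Fin g → ℚ, 0 ≤ v ⬝ᵥ t.mulVec v

/-- `t` represents the rational number `q` if `q = ᵀv t v` for some `v ∈ ℤ^g`. -/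
def RepresentsQ (t : MatQ g) (q : ℚ) : Prop :=
  ∃ v : Fin g → ℤ, (fun i => (v i : ℚ)) ⬝ᵥ t.mulVec (fun i => (v i : ℚ)) = q

/-- `e(tτ) = exp(2πi · tr(tτ))`. -/
def eMat (t : MatQ g) (τ : MatC g) : ℂ :=
  Complex.exp (2 * (Real.pi : ℂ) * Complex.I * ((t.map fun q => (q : ℂ)) * τ).trace)

/-- A (scalar-valued, classical) Siegel modular form of genus `g` and weight `k`
for the full symplectic group `Sp_{2g}(ℤ)`, bundled with its Fourier expansion:
a holomorphic function on the Siegel upper half space transforming with the factor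
of automorphy `det(cτ+d)^k`, whose Fourier expansion is supported on half-integral
positive semi-definite matrices. -/
structure SiegelMF (g : ℕ) (k : ℤ) where
  toFun : MatC g → ℂ
  coeff : MatQ g → ℂ
  holo : DifferentiableOn ℂ toFun (Sieg g)
  transf : ∀ γ ∈ SpZ g, ∀ τ ∈ Sieg g, toFun (actSp γ τ) = jden γ τ ^ k * toFun τ
  supp : ∀ t, coeff t ≠ 0 → HalfIntegral t ∧ PosSemidefQ t
  expansion : ∀ τ ∈ Sieg g, HasSum (fun t => coeff t * eMat t τ) (toFun τ)

/-- A Siegel modular form is nonzero if it is nonzero somewhere on the Siegel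
upper half space. -/
def SiegelMF.Nonzero {k : ℤ} (f : SiegelMF g k) : Prop :=
  ∃ τ ∈ Sieg g, f.toFun τ ≠ 0

/-- The vanishing order of a Siegel modular form: the infimum of all rationals
represented by some index matrix `t` with nonvanishing Fourier coefficient. -/
def SiegelMF.ord {k : ℤ} (f : SiegelMF g k) : ℝ :=
  sInf {r : ℝ | ∃ t q, f.coeff t ≠ 0 ∧ RepresentsQ t q ∧ (q : ℝ) = r}


/-- `Mat_{h,l}(ℂ)`. -/
abbrev MatRC (h l : ℕ) := Matrix (Fin h) (Fin l) ℂ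
/-- `Mat_{h,l}(ℚ)`. -/
abbrev MatRQ (h l : ℕ) := Matrix (Fin h) (Fin l) ℚ

/-- The block matrix `(n, r/2; ᵀr/2, m)` of size `h + l`. -/
def blkQ (h l : ℕ) (n : MatQ h) (r : MatRQ h l) (m : MatQ l) : MatQ (h + l) :=
  Matrix.reindex finSumFinEquiv finSumFinEquiv
    (Matrix.fromBlocks n ((1 / 2 : ℚ) • r) ((1 / 2 : ℚ) • rᵀ) m)

/-- A (Siegel-) Jacobi form of genus `h`, cogenus `l`, weight `k` and (matrix)
index `m`, bundled with its Fourier expansion: a holomorphic function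
`φ(τ, z)` on `ℍ_h × Mat_{h,l}(ℂ)` satisfying the transformation laws of Jacobi
forms under `Sp_{2h}(ℤ)` and under the lattice translations
`z ↦ z + τλ + μ`, whose Fourier coefficients `c(φ; n, r)` are supported on pairs
for which the block matrix `(n, r/2; ᵀr/2, m)` is half-integral positive
semi-definite. -/
structure JacobiF (h l : ℕ) (k : ℤ) (m : MatQ l) where
  toFun : MatC h × MatRC h l → ℂ
  coeff : MatQ h × MatRQ h l → ℂ
  holo : DifferentiableOn ℂ toFun (Sieg h ×ˢ (Set.univ : Set (MatRC h l)))
  transfSp : ∀ γ ∈ SpZ h, ∀ p : MatC h × MatRC h l, p.1 ∈ Sieg h →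
    toFun (actSp γ p.1, ((jmat γ p.1)⁻¹)ᵀ * p.2)
      = jden γ p.1 ^ k *
        Complex.exp (2 * (Real.pi : ℂ) * Complex.I *
          ((m.map fun q => (q : ℂ)) *
            (p.2ᵀ * ((jmat γ p.1)⁻¹ * (blkC γ * p.2)))).trace) *
        toFun p
  transfEll : ∀ lam mu : Matrix (Fin h) (Fin l) ℤ, ∀ p : MatC h × MatRC h l,
    p.1 ∈ Sieg h →
    toFun (p.1, p.2 + p.1 * (lam.map fun z => (z : ℂ)) + (mu.map fun z => (z : ℂ)))
      = Complex.exp (-(2 * (Real.pi : ℂ) * Complex.I) *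
          ((m.map fun q => (q : ℂ)) *
            ((lam.map fun z => (z : ℂ))ᵀ * p.1 * (lam.map fun z => (z : ℂ))
              + (2 : ℂ) • ((lam.map fun z => (z : ℂ))ᵀ * p.2))).trace) *
        toFun p
  supp : ∀ nr : MatQ h × MatRQ h l, coeff nr ≠ 0 →
    HalfIntegral (blkQ h l nr.1 nr.2 m) ∧ PosSemidefQ (blkQ h l nr.1 nr.2 m)
  expansion : ∀ p : MatC h × MatRC h l, p.1 ∈ Sieg h →
    HasSum (fun nr : MatQ h × MatRQ h l => coeff nr *
      Complex.exp (2 * (Real.pi : ℂ) * Complex.I *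
        (((nr.1.map fun q => (q : ℂ)) * p.1).trace
          + ((nr.2.map fun q => (q : ℂ))ᵀ * p.2).trace)))
      (toFun p)

/-- The index-`m` Fourier-Jacobi slice of a genus-`(h+l)` family of Fourier
coefficients: `(n, r) ↦ c (n, r/2; ᵀr/2, m)`. -/
def sliceCoeff (h l : ℕ) (c : MatQ (h + l) → ℂ) (m : MatQ l) :
    MatQ h × MatRQ h l → ℂ :=
  fun nr => c (blkQ h l nr.1 nr.2 m)

/-- `c` is (the family of formal Fourier coefficients of) a symmetric formal
Fourier-Jacobi series of genus `h + l`, cogenus `l` and weight `k`: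
the coefficients are supported on half-integral positive semi-definite matrices,
they satisfy the `GL_{h+l}(ℤ)`-symmetry `c(t) = det(u)^k·c(ᵀu t u)`, and for every
half-integral positive semi-definite index `m` the `m`-th Fourier-Jacobi slice of
`c` is the system of Fourier coefficients of a (convergent, holomorphic) Jacobi
form of genus `h`, weight `k` and index `m`. -/
def IsSymFM (h l : ℕ) (k : ℤ) (c : MatQ (h + l) → ℂ) : Prop :=
  (∀ t, c t ≠ 0 → HalfIntegral t ∧ PosSemidefQ t) ∧
  (∀ u : Matrix (Fin (h + l)) (Fin (h + l)) ℤ, IsUnit u.det → ∀ t,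
    c t = ((u.det : ℚ) : ℂ) ^ k *
      c ((u.map fun z => (z : ℚ))ᵀ * t * (u.map fun z => (z : ℚ)))) ∧
  (∀ m : MatQ l, HalfIntegral m → PosSemidefQ m →
    ∃ φ : JacobiF h l k m, φ.coeff = sliceCoeff h l c m)

/-- The convolution (Cauchy) product of two families of Fourier coefficients,
corresponding to the product of the associated (formal) series. -/
noncomputable def convC {g : ℕ} (c c' : MatQ g → ℂ) : MatQ g → ℂ :=
  fun t => ∑ᶠ s : MatQ g, c s * c' (t - s)

/-- Convolution powers `c^i`; `c^0` is the coefficient family of the constant `1`. -/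
noncomputable def powC {g : ℕ} (c : MatQ g → ℂ) : ℕ → (MatQ g → ℂ)
  | 0 => fun t => if t = 0 then 1 else 0
  | i + 1 => convC c (powC c i)

section

variable {g : ℕ}

section QuadraticForms

set_option linter.unusedSectionVars false

variable {K : Type*} [Field K] [LinearOrder K] [IsStrictOrderedRing K]

/-- The value `ᵀv t v`. -/
def qf {ι : Type*} [Fintype ι] {R : Type*} [CommRing R] (t : Matrix ι ι R) (v : ι → R) : R :=
  v ⬝ᵥ t.mulVec v

/-- Remove the first row and column. -/
def low {n : ℕ} {R : Type*} (t : Matrix (Fin (n + 1)) (Fin (n + 1)) R) :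
    Matrix (Fin n) (Fin n) R := t.submatrix Fin.succ Fin.succ

/-- The Schur complement of the top left entry. -/
def schur {n : ℕ} (t : Matrix (Fin (n + 1)) (Fin (n + 1)) K) : Matrix (Fin n) (Fin n) K :=
  Matrix.of fun i j => t i.succ j.succ - t i.succ 0 * t 0 j.succ / t 0 0

theorem qf_eq_sum {ι : Type*} [Fintype ι] {R : Type*} [CommRing R] (t : Matrix ι ι R)
    (v : ι → R) : qf t v = ∑ i, ∑ j, v i * t i j * v j := by
  simp only [qf, dotProduct, Matrix.mulVec, Finset.mul_sum, mul_assoc]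

theorem qf_add {ι : Type*} [Fintype ι] {R : Type*} [CommRing R] {t : Matrix ι ι R}
    (ht : t.IsSymm) (v w : ι → R) :
    qf t (v + w) = qf t v + 2 * (w ⬝ᵥ t.mulVec v) + qf t w := by
  have h : v ⬝ᵥ t.mulVec w = w ⬝ᵥ t.mulVec v := by
    rw [dotProduct_comm, dotProduct_mulVec w, ← mulVec_transpose, ht.eq]
  simp only [qf, mulVec_add, dotProduct_add, add_dotProduct, h]
  ring

theorem qf_smul {ι : Type*} [Fintype ι] {R : Type*} [CommRing R] (t : Matrix ι ι R)
    (a : R) (v : ι → R) : qf t (a • v) = a ^ 2 * qf t v := by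
  simp only [qf, mulVec_smul, dotProduct_smul, smul_dotProduct, smul_eq_mul]
  ring

theorem qf_single {ι : Type*} [Fintype ι] [DecidableEq ι] {R : Type*} [CommRing R]
    (t : Matrix ι ι R) (i : ι) : qf t (Pi.single i 1) = t i i := by
  simp [qf]

theorem qf_cons {n : ℕ} {R : Type*} [CommRing R] {t : Matrix (Fin (n + 1)) (Fin (n + 1)) R}
    (ht : t.IsSymm) (a : R) (x : Fin n → R) :
    qf t (Fin.cons a x) = a ^ 2 * t 0 0 + 2 * a * (∑ i, t 0 i.succ * x i) + qf (low t) x := by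
  simp only [qf_eq_sum, Fin.sum_univ_succ, Fin.cons_zero, Fin.cons_succ, low,
    Matrix.submatrix_apply, Finset.sum_add_distrib]
  have h : ∀ i : Fin n, t i.succ 0 = t 0 i.succ := fun i => ht.apply _ _
  simp only [h, Finset.mul_sum]
  have h1 : ∑ i, x i * t 0 i.succ * a = ∑ i, a * t 0 i.succ * x i :=
    Finset.sum_congr rfl fun i _ => by ring
  have h2 : ∑ i, 2 * a * (t 0 i.succ * x i) = ∑ i, a * t 0 i.succ * x i
      + ∑ i, a * t 0 i.succ * x i := by
    rw [← Finset.sum_add_distrib]; exact Finset.sum_congr rfl fun i _ => by ring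
  rw [h1, h2]; ring

theorem low_isSymm {n : ℕ} {R : Type*} {t : Matrix (Fin (n + 1)) (Fin (n + 1)) R}
    (ht : t.IsSymm) : (low t).IsSymm := ht.submatrix _

theorem schur_isSymm {n : ℕ} {t : Matrix (Fin (n + 1)) (Fin (n + 1)) K}
    (ht : t.IsSymm) : (schur t).IsSymm := by
  ext i j
  simp only [schur, transpose_apply, of_apply, ht.apply j.succ i.succ, ht.apply j.succ 0,
    ht.apply 0 i.succ]
  ring

theorem qf_schur {n : ℕ} {t : Matrix (Fin (n + 1)) (Fin (n + 1)) K}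
    (ht : t.IsSymm) (h0 : t 0 0 ≠ 0) (a : K) (x : Fin n → K) :
    qf t (Fin.cons a x) =
      t 0 0 * (a + (∑ i, t 0 i.succ * x i) / t 0 0) ^ 2 + qf (schur t) x := by
  have h : qf (schur t) x = qf (low t) x - (∑ i, t 0 i.succ * x i) ^ 2 / t 0 0 := by
    simp only [qf_eq_sum, schur, low, of_apply, submatrix_apply]
    rw [pow_two, Finset.sum_mul_sum, Finset.sum_div, ← Finset.sum_sub_distrib]
    refine Finset.sum_congr rfl fun i _ => ?_
    rw [Finset.sum_div, ← Finset.sum_sub_distrib]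
    refine Finset.sum_congr rfl fun j _ => ?_
    rw [ht.apply 0 i.succ]; ring
  rw [h, qf_cons ht]
  field_simp
  ring

theorem qf_schur_nonneg {n : ℕ} {t : Matrix (Fin (n + 1)) (Fin (n + 1)) K}
    (ht : t.IsSymm) (h0 : t 0 0 ≠ 0) (hp : ∀ v, 0 ≤ qf t v) (x : Fin n → K) :
    0 ≤ qf (schur t) x := by
  have := hp (Fin.cons (-((∑ i, t 0 i.succ * x i) / t 0 0)) x)
  rw [qf_schur ht h0] at this
  simpa using this

theorem qf_low_nonneg {n : ℕ} {t : Matrix (Fin (n + 1)) (Fin (n + 1)) K}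
    (ht : t.IsSymm) (hp : ∀ v, 0 ≤ qf t v) (x : Fin n → K) : 0 ≤ qf (low t) x := by
  have := hp (Fin.cons 0 x)
  rw [qf_cons ht] at this
  simpa using this

theorem diag_nonneg {ι : Type*} [Fintype ι] [DecidableEq ι] {t : Matrix ι ι K}
    (hp : ∀ v, 0 ≤ qf t v) (i : ι) : 0 ≤ t i i := by
  exact (hp (Pi.single i 1)).trans_eq (qf_single t i)

theorem eq_zero_of_diag_eq_zero {ι : Type*} [Fintype ι] [DecidableEq ι] {t : Matrix ι ι K}
    (ht : t.IsSymm) (hp : ∀ v, 0 ≤ qf t v) {i : ι} (hi : t i i = 0) (j : ι) : t i j = 0 := by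
  by_contra hne
  have h := hp (Pi.single j 1 + (-(t j j + 1) / (2 * t i j)) • Pi.single i 1)
  rw [qf_add ht, qf_smul, qf_single, qf_single, hi] at h
  simp only [smul_dotProduct, mulVec_single_one, single_dotProduct, one_mul, smul_eq_mul,
    col_apply] at h
  have : 2 * (-(t j j + 1) / (2 * t i j) * t i j) = -(t j j + 1) := by
    field_simp
  rw [this] at h
  linarith

theorem det_schur {n : ℕ} {t : Matrix (Fin (n + 1)) (Fin (n + 1)) K} (h0 : t 0 0 ≠ 0) :
    t.det = t 0 0 * (schur t).det := by
  rw [det_eq_of_forall_row_eq_smul_add_const (B := Matrix.of fun i j =>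
      t i j - (if i = 0 then 0 else t i 0 / t 0 0) * t 0 j)
      (fun i => if i = 0 then 0 else t i 0 / t 0 0) 0 (by simp)
      (by intro i j; simp)]
  rw [det_succ_column_zero, Fin.sum_univ_succ]
  have : ∀ i : Fin n, t i.succ 0 - t i.succ 0 / t 0 0 * t 0 0 = 0 := by
    intro i; field_simp; ring
  simp only [Fin.val_zero, pow_zero, of_apply, if_true, zero_mul, sub_zero, one_mul,
    Fin.succ_ne_zero, if_false, this, mul_zero, Finset.sum_const_zero, add_zero]
  congr 2
  ext i j
  simp [schur]
  ring

theorem det_eq_zero_of_diag {n : ℕ} {t : Matrix (Fin n) (Fin n) K}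
    (ht : t.IsSymm) (hp : ∀ v, 0 ≤ qf t v) {i : Fin n} (h0 : t i i = 0) : t.det = 0 :=
  det_eq_zero_of_row_eq_zero i (eq_zero_of_diag_eq_zero ht hp h0)

theorem det_nonneg_of_qf {n : ℕ} {t : Matrix (Fin n) (Fin n) K}
    (ht : t.IsSymm) (hp : ∀ v, 0 ≤ qf t v) : 0 ≤ t.det := by
  induction n with
  | zero => simp
  | succ n ih =>
    by_cases h0 : t 0 0 = 0
    · rw [det_eq_zero_of_diag ht hp h0]
    · rw [det_schur h0]
      exact mul_nonneg (diag_nonneg hp 0) (ih (schur_isSymm ht) (qf_schur_nonneg ht h0 hp))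

theorem schur_diag_le {n : ℕ} {t : Matrix (Fin (n + 1)) (Fin (n + 1)) K}
    (ht : t.IsSymm) (hp : ∀ v, 0 ≤ qf t v) (i : Fin n) : schur t i i ≤ t i.succ i.succ := by
  simp only [schur, of_apply, ht.apply 0 i.succ]
  have := diag_nonneg hp 0
  have h2 : 0 ≤ t 0 i.succ * t 0 i.succ / t 0 0 := div_nonneg (mul_self_nonneg _) this
  linarith

/-- Hadamard's inequality. -/
theorem det_le_prod_diag {n : ℕ} {t : Matrix (Fin n) (Fin n) K}
    (ht : t.IsSymm) (hp : ∀ v, 0 ≤ qf t v) : t.det ≤ ∏ i, t i i := by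
  induction n with
  | zero => simp
  | succ n ih =>
    by_cases h0 : t 0 0 = 0
    · rw [det_eq_zero_of_diag ht hp h0]
      exact Finset.prod_nonneg fun i _ => diag_nonneg hp i
    · rw [det_schur h0, Fin.prod_univ_succ]
      refine mul_le_mul_of_nonneg_left ?_ (diag_nonneg hp 0)
      refine (ih (schur_isSymm ht) (qf_schur_nonneg ht h0 hp)).trans ?_
      exact Finset.prod_le_prod (fun i _ => diag_nonneg (qf_schur_nonneg ht h0 hp) i)
        fun i _ => schur_diag_le ht hp i

theorem det_eq_of_bordered {n : ℕ} {R : Type*} [CommRing R]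
    {t : Matrix (Fin (n + 1)) (Fin (n + 1)) R} (y : Fin n → R)
    (hy : ∀ i : Fin n, t.mulVec (Fin.cons 1 y) i.succ = 0) :
    t.det = qf t (Fin.cons 1 y) * (low t).det := by
  have hP : ((Matrix.of fun i j : Fin (n + 1) => (if j = 0 then
      (Fin.cons 1 y : Fin (n + 1) → R) i else (1 : Matrix _ _ R) i j)) :
        Matrix (Fin (n + 1)) (Fin (n + 1)) R).det = 1 := by
    rw [det_succ_row_zero, Fin.sum_univ_succ]
    have : ∀ i : Fin n, (1 : Matrix (Fin (n + 1)) (Fin (n + 1)) R) 0 i.succ = 0 :=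
      fun i => one_apply_ne (Fin.succ_ne_zero i).symm
    simp only [of_apply, Fin.succ_ne_zero, if_false, this, if_true, Fin.cons_zero]
    simp only [Fin.val_zero, pow_zero, mul_one, mul_zero, zero_mul, Finset.sum_const_zero,
      add_zero, one_mul]
    rw [show (submatrix _ Fin.succ (Fin.succAbove 0)) = (1 : Matrix (Fin n) (Fin n) R) from ?_]
    · simp
    · ext i j
      simp [Matrix.one_apply]
  have h1 : t.det = (t * (Matrix.of fun i j : Fin (n + 1) => (if j = 0 then
      (Fin.cons 1 y : Fin (n + 1) → R) i else (1 : Matrix _ _ R) i j))).det := by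
    rw [det_mul, hP, mul_one]
  have hcol : ∀ i, (t * (Matrix.of fun i j : Fin (n + 1) => (if j = 0 then
      (Fin.cons 1 y : Fin (n + 1) → R) i else (1 : Matrix _ _ R) i j))) i 0
        = t.mulVec (Fin.cons 1 y) i := by
    intro i; simp [Matrix.mul_apply, mulVec, dotProduct]
  rw [h1, det_succ_column_zero, Fin.sum_univ_succ]
  simp only [hcol, hy, mul_zero, zero_mul, Finset.sum_const_zero, add_zero, Fin.val_zero,
    pow_zero, one_mul]
  congr 1
  · rw [qf, dotProduct, Fin.sum_univ_succ]; simp [hy]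
  · congr 1
    ext i j
    simp [Matrix.mul_apply, low, Fin.succ_ne_zero, Matrix.one_apply]

end QuadraticForms

section Reduction

section

variable {K : Type*} [Field K] [LinearOrder K] [IsStrictOrderedRing K]

theorem qf_schur' {n : ℕ} {t : Matrix (Fin (n + 1)) (Fin (n + 1)) K}
    (ht : t.IsSymm) (hp : ∀ v, 0 ≤ qf t v) (a : K) (x : Fin n → K) :
    qf t (Fin.cons a x) =
      t 0 0 * (a + (∑ i, t 0 i.succ * x i) / t 0 0) ^ 2 + qf (schur t) x := by
  by_cases h0 : t 0 0 = 0
  · have h := eq_zero_of_diag_eq_zero ht hp h0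
    have h2 : schur t = low t := by
      ext i j; simp [schur, low, h]
    rw [qf_cons ht, h2]; simp [h]
  · exact qf_schur ht h0 a x

theorem det_schur' {n : ℕ} {t : Matrix (Fin (n + 1)) (Fin (n + 1)) K}
    (ht : t.IsSymm) (hp : ∀ v, 0 ≤ qf t v) : t.det = t 0 0 * (schur t).det := by
  by_cases h0 : t 0 0 = 0
  · rw [det_eq_zero_of_diag ht hp h0, h0, zero_mul]
  · exact det_schur h0

theorem qf_schur_nonneg' {n : ℕ} {t : Matrix (Fin (n + 1)) (Fin (n + 1)) K}
    (ht : t.IsSymm) (hp : ∀ v, 0 ≤ qf t v) (x : Fin n → K) : 0 ≤ qf (schur t) x := by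
  have := hp (Fin.cons (-((∑ i, t 0 i.succ * x i) / t 0 0)) x)
  rw [qf_schur' ht hp] at this
  simpa using this

end

/-- The action `t ↦ ᵀu t u` of integral matrices. -/
def conjZ {ι κ : Type*} [Fintype ι] (u : Matrix ι κ ℤ) (t : Matrix ι ι ℚ) : Matrix κ κ ℚ :=
  (u.map fun z => (z : ℚ))ᵀ * t * (u.map fun z => (z : ℚ))

theorem qf_conjZ {ι κ : Type*} [Fintype ι] [Fintype κ] (u : Matrix ι κ ℤ) (t : Matrix ι ι ℚ)
    (v : κ → ℚ) : qf (conjZ u t) v = qf t ((u.map fun z => (z : ℚ)).mulVec v) := by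
  simp only [qf, conjZ, ← mulVec_mulVec]
  rw [dotProduct_mulVec, vecMul_transpose]

theorem conjZ_diag {ι κ : Type*} [Fintype ι] [Fintype κ] [DecidableEq κ] (u : Matrix ι κ ℤ)
    (t : Matrix ι ι ℚ) (i : κ) : conjZ u t i i = qf t (fun k => (u k i : ℚ)) := by
  rw [← qf_single (conjZ u t) i, qf_conjZ]
  congr 1
  ext k; simp

theorem map_intCast_mul {ι κ μ : Type*} [Fintype κ] (u : Matrix ι κ ℤ)
    (v : Matrix κ μ ℤ) : (u * v).map (fun z => (z : ℚ)) =
      u.map (fun z => (z : ℚ)) * v.map (fun z => (z : ℚ)) := by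
  ext i j; simp [Matrix.mul_apply]

theorem conjZ_conjZ {ι κ μ : Type*} [Fintype ι] [Fintype κ] (u : Matrix ι κ ℤ)
    (v : Matrix κ μ ℤ) (t : Matrix ι ι ℚ) : conjZ v (conjZ u t) = conjZ (u * v) t := by
  simp only [conjZ, map_intCast_mul, transpose_mul, Matrix.mul_assoc]

theorem conjZ_one {ι : Type*} [Fintype ι] [DecidableEq ι] (t : Matrix ι ι ℚ) :
    conjZ 1 t = t := by
  have : (1 : Matrix ι ι ℤ).map (fun z => (z : ℚ)) = 1 := by
    ext i j; simp [Matrix.one_apply]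
  simp [conjZ, this]

theorem conjZ_isSymm {ι κ : Type*} [Fintype ι] (u : Matrix ι κ ℤ)
    {t : Matrix ι ι ℚ} (ht : t.IsSymm) : (conjZ u t).IsSymm := by
  simp only [Matrix.IsSymm, conjZ, transpose_mul, transpose_transpose, ht.eq, Matrix.mul_assoc]

theorem conjZ_psd {ι κ : Type*} [Fintype ι] [Fintype κ] (u : Matrix ι κ ℤ)
    {t : Matrix ι ι ℚ} (ht : ∀ v, 0 ≤ qf t v) (v : κ → ℚ) : 0 ≤ qf (conjZ u t) v := by
  rw [qf_conjZ]; exact ht _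

theorem det_map_intCast {n : ℕ} (u : Matrix (Fin n) (Fin n) ℤ) :
    (u.map fun z => (z : ℚ)).det = (u.det : ℚ) :=
  ((Int.castRingHom ℚ).map_det u).symm

theorem det_conjZ {n : ℕ} (u : Matrix (Fin n) (Fin n) ℤ) (t : MatQ n) :
    (conjZ u t).det = (u.det : ℚ) ^ 2 * t.det := by
  simp only [conjZ, det_mul, det_transpose, det_map_intCast]; ring

theorem det_conjZ_of_isUnit {n : ℕ} {u : Matrix (Fin n) (Fin n) ℤ} (hu : IsUnit u.det)
    (t : MatQ n) : (conjZ u t).det = t.det := by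
  rw [det_conjZ]
  rcases Int.isUnit_iff.1 hu with h | h <;> simp [h]

theorem exists_common_den {ι : Type*} [Fintype ι] (t : Matrix ι ι ℚ) :
    ∃ N : ℕ, 0 < N ∧ ∀ i j, ∃ z : ℤ, (N : ℚ) * t i j = z := by
  refine ⟨∏ p : ι × ι, (t p.1 p.2).den, Finset.prod_pos fun p _ => (t p.1 p.2).den_pos, ?_⟩
  intro i j
  obtain ⟨k, hk⟩ := Finset.dvd_prod_of_mem (fun p : ι × ι => (t p.1 p.2).den)
    (Finset.mem_univ (i, j))
  refine ⟨k * (t i j).num, ?_⟩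
  rw [hk]
  push_cast
  have := Rat.den_mul_eq_num (t i j)
  linear_combination (k : ℚ) * this

/-- There is a unimodular basis whose first vector has minimal norm. -/
theorem exists_min_basis {n : ℕ} (t : MatQ (n + 1)) (hp : ∀ v, 0 ≤ qf t v) :
    ∃ u : Matrix (Fin (n + 1)) (Fin (n + 1)) ℤ, IsUnit u.det ∧
      ∀ v : Matrix (Fin (n + 1)) (Fin (n + 1)) ℤ, IsUnit v.det →
        conjZ u t 0 0 ≤ conjZ v t 0 0 := by
  obtain ⟨N, hN, hz⟩ := exists_common_den t
  have key : ∀ v : Matrix (Fin (n + 1)) (Fin (n + 1)) ℤ,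
      ∃ m : ℕ, (N : ℚ) * conjZ v t 0 0 = m := by
    intro v
    choose z hz using hz
    have h1 : (N : ℚ) * conjZ v t 0 0 = ((∑ i, ∑ j, v i 0 * z i j * v j 0 : ℤ) : ℚ) := by
      rw [conjZ_diag, qf_eq_sum, Finset.mul_sum]
      push_cast
      refine Finset.sum_congr rfl fun i _ => ?_
      rw [Finset.mul_sum]
      refine Finset.sum_congr rfl fun j _ => ?_
      rw [← hz]; ring
    have h2 : (0 : ℚ) ≤ N * conjZ v t 0 0 :=
      mul_nonneg (by positivity) (diag_nonneg (conjZ_psd v hp) 0)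
    rw [h1] at h2 ⊢
    lift (∑ i, ∑ j, v i 0 * z i j * v j 0) to ℕ using (by exact_mod_cast h2) with m
    exact ⟨m, by simp⟩
  choose f hf using key
  obtain ⟨u, hu, hmin⟩ := WellFounded.has_min (measure f).wf
    {v : Matrix (Fin (n + 1)) (Fin (n + 1)) ℤ | IsUnit v.det} ⟨1, by simp⟩
  refine ⟨u, hu, fun v hv => ?_⟩
  have h : f u ≤ f v := not_lt.1 (hmin v hv)
  have h' : (f u : ℚ) ≤ f v := by exact_mod_cast h
  rw [← hf, ← hf] at h'
  exact le_of_mul_le_mul_left h' (by exact_mod_cast hN)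

theorem isUnit_det_submatrix {n : ℕ} {u : Matrix (Fin n) (Fin n) ℤ} (hu : IsUnit u.det)
    (σ : Equiv.Perm (Fin n)) : IsUnit (u.submatrix id σ).det := by
  rw [det_permute']
  exact ((Equiv.Perm.sign σ).isUnit).mul hu

/-- Column selection compatible with projecting away the first coordinate. -/
theorem exists_minor {n : ℕ} {t : MatQ (n + 1)} {s : MatQ n}
    (hs : ∀ x, 0 ≤ qf s x) (hst : ∀ a x, qf s x ≤ qf t (Fin.cons a x))
    (W : Matrix (Fin (n + 1)) (Fin (n + 1)) ℤ) (hW : W.det ≠ 0) :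
    ∃ V : Matrix (Fin n) (Fin n) ℤ, V.det ≠ 0 ∧
      ∑ j, conjZ V s j j ≤ ∑ j, conjZ W t j j := by
  rw [det_succ_row_zero] at hW
  obtain ⟨j, -, hj⟩ := Finset.exists_ne_zero_of_sum_ne_zero hW
  refine ⟨W.submatrix Fin.succ j.succAbove, fun h => hj (by rw [h, mul_zero]), ?_⟩
  have hle : ∀ i, qf s (fun k => (W k.succ i : ℚ)) ≤ conjZ W t i i := by
    intro i
    rw [conjZ_diag]
    refine (hst (W 0 i : ℚ) _).trans_eq ?_
    congr 1
    ext k; cases k using Fin.cases <;> simp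
  rw [Fin.sum_univ_succAbove _ j]
  have h1 : 0 ≤ conjZ W t j j := (hs _).trans (hle j)
  have h2 : ∑ i, conjZ (W.submatrix Fin.succ j.succAbove) s i i ≤
      ∑ i, conjZ W t (j.succAbove i) (j.succAbove i) :=
    Finset.sum_le_sum fun i _ => by
      rw [conjZ_diag]; exact hle _
  linarith

theorem sum_conjZ_fin_one (w : Matrix (Fin 1) (Fin 1) ℤ) (t : MatQ 1) :
    ∑ j, conjZ w t j j = (w 0 0 : ℚ) ^ 2 * t 0 0 := by
  rw [Fin.sum_univ_one, conjZ_diag, qf_eq_sum, Fin.sum_univ_one, Fin.sum_univ_one]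
  ring

/-- Reduction theory of positive semidefinite quadratic forms. -/
theorem exists_reduced (n : ℕ) : ∃ C : ℚ, 0 < C ∧ ∀ t : MatQ n, t.IsSymm →
    (∀ v, 0 ≤ qf t v) → ∃ u : Matrix (Fin n) (Fin n) ℤ, IsUnit u.det ∧
      ∏ i, conjZ u t i i ≤ C * t.det ∧
      ∀ W : Matrix (Fin n) (Fin n) ℤ, W.det ≠ 0 →
        ∀ i, conjZ u t i i ≤ C * ∑ j, conjZ W t j j := by
  induction n with
  | zero =>
    exact ⟨1, one_pos, fun t _ _ => ⟨1, by simp, by simp, fun _ _ i => i.elim0⟩⟩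
  | succ n ih =>
    obtain ⟨C, hC, ih⟩ := ih
    refine ⟨(4 / 3) ^ n * C + (4 / 3) * C + 1, by positivity, fun t0 ht0 hp0 => ?_⟩
    obtain ⟨u0, hu0, hmin⟩ := exists_min_basis t0 hp0
    set t := conjZ u0 t0 with ht_def
    have ht : t.IsSymm := conjZ_isSymm _ ht0
    have hp : ∀ v, 0 ≤ qf t v := conjZ_psd _ hp0
    clear_value t
    obtain ⟨u', hu', hprod, hW⟩ := ih (schur t) (schur_isSymm ht) (qf_schur_nonneg' ht hp)
    set r : Fin n → ℚ := fun i => (∑ k : Fin n, t 0 k.succ * (u' k i : ℚ)) / t 0 0 with hr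
    let U : Matrix (Fin (n + 1)) (Fin (n + 1)) ℤ := Matrix.of
      (Fin.cons (Fin.cons 1 fun i => -round (r i)) fun k => Fin.cons 0 (u' k))
    have hU00 : U 0 0 = 1 := rfl
    have hU0s : ∀ i : Fin n, U 0 i.succ = -round (r i) := fun i => rfl
    have hUs0 : ∀ i : Fin n, U i.succ 0 = 0 := fun i => rfl
    have hUss : ∀ i j : Fin n, U i.succ j.succ = u' i j := fun i j => rfl
    clear_value U
    have hUdet : U.det = u'.det := by
      rw [det_succ_column_zero, Fin.sum_univ_succ]
      simp only [hU00, hUs0]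
      have : U.submatrix (Fin.succAbove 0) Fin.succ = u' := by
        ext i j; simp [hUss]
      rw [this]; simp
    have hUu : IsUnit (u0 * U).det := by
      rw [det_mul, hUdet]; exact hu0.mul hu'
    have hcj : conjZ (u0 * U) t0 = conjZ U t := by rw [ht_def, conjZ_conjZ]
    have hd0 : conjZ U t 0 0 = t 0 0 := by
      rw [conjZ_diag, ← qf_single t 0]
      congr 1
      ext k
      cases k using Fin.cases with
      | zero => simp [hU00]
      | succ k => simp [hUs0]
    have hds : ∀ i : Fin n, conjZ U t i.succ i.succ =
        t 0 0 * (-(round (r i) : ℚ) + r i) ^ 2 + conjZ u' (schur t) i i := by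
      intro i
      rw [conjZ_diag, conjZ_diag, hr, ← qf_schur' ht hp]
      congr 1
      ext k
      cases k using Fin.cases with
      | zero => simp [hU0s, hr]
      | succ k => simp [hUss]
    have hm0 : 0 ≤ t 0 0 := diag_nonneg hp 0
    have hmle : ∀ i : Fin n, t 0 0 ≤ conjZ U t i.succ i.succ := by
      intro i
      have := hmin _ (isUnit_det_submatrix hUu (Equiv.swap 0 i.succ))
      refine this.trans_eq ?_
      rw [← hcj, conjZ_diag, conjZ_diag]
      congr 1
    have hbd : ∀ i : Fin n, conjZ U t i.succ i.succ ≤ 4 / 3 * conjZ u' (schur t) i i := by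
      intro i
      have h1 := hmle i
      have h2 : (-(round (r i) : ℚ) + r i) ^ 2 ≤ 1 / 4 := by
        have := abs_sub_round (r i)
        rw [abs_le] at this
        nlinarith [this.1, this.2]
      have h3 := mul_le_mul_of_nonneg_left h2 hm0
      have h4 := hds i
      linarith
    have hdet : t0.det = t 0 0 * (schur t).det := by
      rw [← det_conjZ_of_isUnit hu0 t0, ← ht_def, det_schur' ht hp]
    have hdet0 : 0 ≤ t0.det := det_nonneg_of_qf ht0 hp0
    refine ⟨u0 * U, hUu, ?_, ?_⟩
    · rw [hcj, Fin.prod_univ_succ, hd0]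
      have h1 : ∏ i : Fin n, conjZ U t i.succ i.succ ≤ (4 / 3) ^ n * (C * (schur t).det) := by
        calc ∏ i : Fin n, conjZ U t i.succ i.succ
            ≤ ∏ i : Fin n, (4 / 3 * conjZ u' (schur t) i i) :=
              Finset.prod_le_prod (fun i _ => hm0.trans (hmle i)) fun i _ => hbd i
          _ = (4 / 3) ^ n * ∏ i : Fin n, conjZ u' (schur t) i i := by
              rw [Finset.prod_mul_distrib, Finset.prod_const, Finset.card_univ, Fintype.card_fin]
          _ ≤ _ := mul_le_mul_of_nonneg_left hprod (by positivity)
      have h2 := mul_le_mul_of_nonneg_left h1 hm0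
      have h3 : t 0 0 * ((4 / 3) ^ n * (C * (schur t).det)) = (4 / 3) ^ n * C * t0.det := by
        rw [hdet]; ring
      have h4 : 0 ≤ (4 / 3 * C + 1) * t0.det := mul_nonneg (by positivity) hdet0
      linarith
    · intro W hWdet
      obtain ⟨u0i, hu0i⟩ : ∃ v, u0 * v = 1 :=
        ⟨u0⁻¹, Matrix.mul_nonsing_inv _ hu0⟩
      have hWc : conjZ W t0 = conjZ (u0i * W) t := by
        rw [ht_def, conjZ_conjZ, ← Matrix.mul_assoc, hu0i, Matrix.one_mul]
      have hWd : (u0i * W).det ≠ 0 := by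
        have h := congrArg Matrix.det hu0i
        rw [det_mul, det_one] at h
        rw [det_mul]
        exact mul_ne_zero (right_ne_zero_of_mul_eq_one h) hWdet
      obtain ⟨V, hV, hVle⟩ := exists_minor (qf_schur_nonneg' ht hp)
        (fun a x => by
          rw [qf_schur' ht hp]
          have := mul_nonneg hm0 (sq_nonneg (a + (∑ i, t 0 i.succ * x i) / t 0 0))
          linarith) _ hWd
      rw [hcj, hWc]
      set S := ∑ j, conjZ (u0i * W) t j j with hS
      have hS0 : 0 ≤ S := Finset.sum_nonneg fun i _ => diag_nonneg (conjZ_psd _ hp) i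
      have hsucc : ∀ i : Fin n, conjZ U t i.succ i.succ ≤ 4 / 3 * C * S := by
        intro i
        have h1 := hbd i
        have h2 := hW V hV i
        have h3 := mul_le_mul_of_nonneg_left hVle hC.le
        linarith
      have hfin : ∀ x : ℚ, x ≤ 4 / 3 * C * S → x ≤ ((4 / 3) ^ n * C + 4 / 3 * C + 1) * S := by
        intro x hx
        have : 0 ≤ ((4 / 3) ^ n * C + 1) * S := mul_nonneg (by positivity) hS0
        linarith
      intro i
      cases i using Fin.cases with
      | succ i => exact hfin _ (hsucc i)
      | zero =>
        rw [hd0]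
        rcases n with _ | n
        · have h1 : S = ((u0i * W) 0 0 : ℚ) ^ 2 * t 0 0 := sum_conjZ_fin_one _ _
          have h2 : (1 : ℚ) ≤ ((u0i * W) 0 0 : ℚ) ^ 2 := by
            rw [det_fin_one] at hWd
            have : 1 ≤ ((u0i * W) 0 0) ^ 2 := by
              have := sq_nonneg ((u0i * W) 0 0)
              have h3 : ((u0i * W) 0 0) ^ 2 ≠ 0 := pow_ne_zero _ hWd
              omega
            exact_mod_cast this
          have h3 : t 0 0 ≤ S := by rw [h1]; nlinarith
          have h4 : 0 ≤ ((4 / 3) ^ 0 * C + 4 / 3 * C) * S := mul_nonneg (by positivity) hS0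
          linarith
        · exact hfin _ ((hmle 0).trans (hsucc 0))

end Reduction

section DetBounds

set_option linter.unusedSectionVars false

variable {K : Type*} [Field K] [LinearOrder K] [IsStrictOrderedRing K]

theorem mulVec_eq_zero_of_qf {ι : Type*} [Fintype ι] [DecidableEq ι] {t : Matrix ι ι K}
    (ht : t.IsSymm) (hp : ∀ v, 0 ≤ qf t v) {v : ι → K} (hv : qf t v = 0) :
    t.mulVec v = 0 := by
  ext j
  by_contra hne
  have hne' : t.mulVec v j ≠ 0 := hne
  have h := hp (Pi.single j 1 + (-(t j j + 1) / (2 * t.mulVec v j)) • v)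
  rw [qf_add ht, qf_smul, qf_single, hv] at h
  have h1 : v ⬝ᵥ t.mulVec (Pi.single j 1) = t.mulVec v j := by
    rw [dotProduct_mulVec, ← mulVec_transpose, ht.eq, dotProduct_single, mul_one]
  rw [smul_dotProduct, h1, smul_eq_mul] at h
  have : 2 * (-(t j j + 1) / (2 * t.mulVec v j) * t.mulVec v j) = -(t j j + 1) := by
    field_simp
  rw [this] at h
  linarith

theorem det_low_pos {n : ℕ} {t : Matrix (Fin (n + 1)) (Fin (n + 1)) K}
    (ht : t.IsSymm) (hp : ∀ v, 0 ≤ qf t v) (hd : t.det ≠ 0) : 0 < (low t).det := by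
  refine lt_of_le_of_ne (det_nonneg_of_qf (low_isSymm ht) (qf_low_nonneg ht hp)) fun h => hd ?_
  obtain ⟨x, hx0, hx⟩ := exists_mulVec_eq_zero_iff.2 h.symm
  refine exists_mulVec_eq_zero_iff.1 ⟨Fin.cons 0 x, fun h0 => hx0 ?_, ?_⟩
  · ext i; simpa using congrFun h0 i.succ
  · refine mulVec_eq_zero_of_qf ht hp ?_
    rw [qf_cons ht, qf, hx]; simp

theorem submatrix_isSymm_qf {ι κ : Type*} [Fintype ι] [Fintype κ] {t : Matrix ι ι K}
    (σ : κ ≃ ι) (v : κ → K) : qf (t.submatrix σ σ) v = qf t (v ∘ σ.symm) := by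
  simp only [qf_eq_sum, submatrix_apply, Function.comp_apply]
  refine (Fintype.sum_equiv σ _ _ fun i => ?_)
  refine (Fintype.sum_equiv σ _ _ fun j => ?_)
  simp

/-- Determinant decrease under exchanging the first two vectors. -/
theorem det_low_swap_le {n : ℕ} {t : Matrix (Fin (n + 2)) (Fin (n + 2)) K}
    (ht : t.IsSymm) (hp : ∀ v, 0 ≤ qf t v) (hd : t.det ≠ 0) (a : K) (x : Fin n → K) :
    (low (t.submatrix (Equiv.swap 0 1) (Equiv.swap 0 1))).det ≤
      2 * qf t (Fin.cons 1 (Fin.cons a x)) * (low (low t)).det + 2 * a ^ 2 * (low t).det := by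
  set s := t.submatrix (Equiv.swap (0 : Fin (n + 2)) 1) (Equiv.swap 0 1) with hs
  have hss : s.IsSymm := ht.submatrix _
  have hsp : ∀ v, 0 ≤ qf s v := fun v => by rw [hs, submatrix_isSymm_qf]; exact hp _
  have hsw : ∀ i : Fin n, Equiv.swap (0 : Fin (n + 2)) 1 i.succ.succ = i.succ.succ := fun i =>
    Equiv.swap_apply_of_ne_of_ne (Fin.succ_ne_zero _) (by
      rw [← Fin.succ_zero_eq_one]; exact fun h => Fin.succ_ne_zero _ (Fin.succ_injective _ h))
  have hll : low (low s) = low (low t) := by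
    ext i j; simp [low, hs, hsw]
  have hO : 0 < (low (low t)).det :=
    det_low_pos (low_isSymm ht) (qf_low_nonneg ht hp) (det_low_pos ht hp hd).ne'
  have hinv : ∀ b : Fin n → K, ∃ y : Fin n → K, (low (low t)).mulVec y = -b := fun b =>
    ⟨(low (low t))⁻¹.mulVec (-b), by
      rw [mulVec_mulVec, Matrix.mul_nonsing_inv _ hO.ne'.isUnit, one_mulVec]⟩
  have hbord : ∀ M : Matrix (Fin (n + 1)) (Fin (n + 1)) K, low M = low (low t) →
      ∃ y : Fin n → K, (∀ i : Fin n, M.mulVec (Fin.cons 1 y) i.succ = 0) ∧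
        M.det = qf M (Fin.cons 1 y) * (low (low t)).det := by
    intro M hM
    obtain ⟨y, hy⟩ := hinv fun i => M i.succ 0
    have hy' : ∀ i : Fin n, M.mulVec (Fin.cons 1 y) i.succ = 0 := by
      intro i
      have h1 := congrFun hy i
      rw [← hM] at h1
      simp only [mulVec, dotProduct, low, submatrix_apply, Pi.neg_apply] at h1
      simp only [mulVec, dotProduct, Fin.sum_univ_succ, Fin.cons_zero, Fin.cons_succ, h1]
      ring
    exact ⟨y, hy', by rw [det_eq_of_bordered y hy', hM]⟩
  obtain ⟨y, hy, hyd⟩ := hbord (low t) rfl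
  obtain ⟨z, hz, hzd⟩ := hbord (low s) hll
  have hq0 : ∀ (M : Matrix (Fin (n + 2)) (Fin (n + 2)) K), M.IsSymm → ∀ v,
      qf (low M) v = qf M (Fin.cons 0 v) := by
    intro M hM v; rw [qf_cons hM]; simp
  -- the Schur complement value is minimal
  have hmin : ∀ w : Fin n → K, qf (low s) (Fin.cons 1 z) ≤ qf (low s) (Fin.cons 1 w) := by
    intro w
    have h1 : (Fin.cons 1 w : Fin (n + 1) → K) = Fin.cons 1 z + Fin.cons 0 (w - z) := by
      ext i; cases i using Fin.cases <;> simp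
    have h2 : (Fin.cons 0 (w - z) : Fin (n + 1) → K) ⬝ᵥ (low s).mulVec (Fin.cons 1 z) = 0 := by
      rw [dotProduct, Fin.sum_univ_succ]; simp [hz]
    rw [h1, qf_add (low_isSymm hss), h2]
    have := qf_low_nonneg hss hsp (Fin.cons 0 (w - z))
    linarith
  have hpar : ∀ v w, qf t (v - w) ≤ 2 * qf t v + 2 * qf t w := by
    intro v w
    have h1 := hp (v + w)
    have h2 : qf t (v - w) = qf t v + 2 * ((-w) ⬝ᵥ t.mulVec v) + qf t w := by
      rw [sub_eq_add_neg, qf_add ht, ← neg_one_smul K w, qf_smul]; ring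
    rw [qf_add ht] at h1
    rw [h2, neg_dotProduct]
    linarith
  have hkey := hpar (Fin.cons 1 (Fin.cons a x)) (a • Fin.cons 0 (Fin.cons 1 y))
  rw [qf_smul, ← hq0 t ht] at hkey
  have hsq : qf t (Fin.cons 1 (Fin.cons a x) - a • Fin.cons 0 (Fin.cons 1 y)) =
      qf (low s) (Fin.cons 1 (x - a • y)) := by
    rw [hq0 s hss, hs, submatrix_isSymm_qf]
    congr 1
    ext i
    cases i using Fin.cases with
    | zero => simp
    | succ i =>
      cases i using Fin.cases with
      | zero => simp
      | succ i => simp [hsw, Equiv.symm_swap]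
  rw [hsq] at hkey
  have h3 := (hmin (x - a • y)).trans hkey
  rw [hzd, hyd]
  have h4 := mul_le_mul_of_nonneg_right h3 hO.le
  linarith

theorem abs_entry_le {ι : Type*} [Fintype ι] [DecidableEq ι] {t : Matrix ι ι K}
    (ht : t.IsSymm) (hp : ∀ v, 0 ≤ qf t v) (i j : ι) : |t i j| ≤ (t i i + t j j) / 2 := by
  have h1 := hp (Pi.single i 1 + Pi.single j 1)
  have h2 := hp (Pi.single i 1 + (-1 : K) • Pi.single j 1)
  rw [qf_add ht, qf_single, qf_single] at h1
  rw [qf_add ht, qf_smul, qf_single, qf_single] at h2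
  simp only [smul_dotProduct, mulVec_single_one, single_dotProduct, one_mul, smul_eq_mul,
    col_apply, ht.apply i j] at h1 h2
  rw [abs_le]; constructor <;> linarith

end DetBounds

section RealForms

/-- Cast to real matrices. -/
def toR {ι κ : Type*} (t : Matrix ι κ ℚ) : Matrix ι κ ℝ := t.map fun q => (q : ℝ)

theorem toR_isSymm {ι : Type*} {t : Matrix ι ι ℚ} (ht : t.IsSymm) : (toR t).IsSymm := by
  ext i j; simp [toR, ht.apply i j]

theorem qf_toR {ι : Type*} [Fintype ι] (t : Matrix ι ι ℚ) (v : ι → ℚ) :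
    qf (toR t) (fun i => (v i : ℝ)) = ((qf t v : ℚ) : ℝ) := by
  simp [qf_eq_sum, toR]

theorem det_toR {n : ℕ} (t : MatQ n) : (toR t).det = ((t.det : ℚ) : ℝ) :=
  ((Rat.castHom ℝ).map_det t).symm

theorem continuous_qf {ι : Type*} [Fintype ι] (t : Matrix ι ι ℝ) : Continuous (qf t) := by
  have : qf t = fun v => ∑ i, ∑ j, v i * t i j * v j := funext fun v => qf_eq_sum t v
  rw [this]
  fun_prop

theorem qf_toR_nonneg {ι : Type*} [Fintype ι] {t : Matrix ι ι ℚ}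
    (hp : ∀ v, 0 ≤ qf t v) (v : ι → ℝ) : 0 ≤ qf (toR t) v := by
  have hd : DenseRange (fun (w : ι → ℚ) i => (w i : ℝ)) :=
    DenseRange.piMap fun _ => Rat.denseRange_cast
  refine hd.induction_on (p := fun v => 0 ≤ qf (toR t) v) v
    (isClosed_le continuous_const (continuous_qf _)) fun w => ?_
  rw [qf_toR]; exact_mod_cast hp w

theorem HalfIntegral.entry_finite {n : ℕ} (X : ℚ) :
    {t : MatQ n | HalfIntegral t ∧ PosSemidefQ t ∧ t.trace ≤ X}.Finite := by
  obtain ⟨N, hN⟩ := exists_nat_ge X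
  let S : Set ℚ := (fun z : ℤ => (z : ℚ) / 2) '' Set.Icc (-(2 * N : ℤ)) (2 * N)
  have hS : S.Finite := (Set.finite_Icc _ _).image _
  have hfin : {t : MatQ n | ∀ i j, t i j ∈ S}.Finite :=
    Set.Finite.pi' (t := fun _ : Fin n => {f : Fin n → ℚ | ∀ j, f j ∈ S})
      fun _ => Set.Finite.pi' fun _ => hS
  refine hfin.subset fun t ht i j => ?_
  obtain ⟨hh, hp, htr⟩ := ht
  obtain ⟨z, hz⟩ := hh.2.1 i j
  have hpq : ∀ v, 0 ≤ qf t v := hp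
  have hd : ∀ i, 0 ≤ t i i := fun i => diag_nonneg hpq i
  have hle : ∀ i, t i i ≤ N := fun i =>
    (Finset.single_le_sum (f := fun i => t i i) (fun i _ => hd i) (Finset.mem_univ i)).trans
      (htr.trans hN)
  have habs : |t i j| ≤ N := by
    have h0 := abs_entry_le hh.1 hpq i j
    have := hle i; have := hle j
    linarith
  rw [abs_le] at habs
  refine ⟨z, ⟨?_, ?_⟩, by simp only; linarith⟩
  · have : (-(2 * N) : ℚ) ≤ z := by rw [← hz]; linarith
    exact_mod_cast this
  · have : (z : ℚ) ≤ 2 * N := by rw [← hz]; linarith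
    exact_mod_cast this

end RealForms

section Families

variable {n : ℕ}

/-- The family is supported on half-integral positive semidefinite matrices. -/
def SuppQ (c : MatQ n → ℂ) : Prop := ∀ t, c t ≠ 0 → HalfIntegral t ∧ PosSemidefQ t

/-- The absolute values of the family are invariant under `GL_n(ℤ)`. -/
def SymQ (c : MatQ n → ℂ) : Prop :=
  ∀ u : Matrix (Fin n) (Fin n) ℤ, IsUnit u.det → ∀ t, ‖c (conjZ u t)‖ = ‖c t‖

/-- The family has subexponential growth. -/
def GrowthQ (c : MatQ n → ℂ) : Prop :=
  ∃ A : ℝ, 0 ≤ A ∧ ∀ t, c t ≠ 0 → ‖c t‖ ≤ Real.exp (A * Real.log (3 + (t.trace : ℝ)) ^ 2)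

/-- The first vector is close to the span of the others. -/
def NearQ (B : ℝ) (t : MatQ (n + 1)) : Prop :=
  ∃ α : Fin n → ℝ, (∀ i, |α i| ≤ 1 / 2) ∧ qf (toR t) (Fin.cons 1 α) ≤ B

/-- Coefficients with given lower block are controlled by those with near first vector. -/
def ShrinkQ (c : MatQ (n + 1) → ℂ) : Prop :=
  ∃ (K B : ℝ) (κ : ℕ), 1 ≤ K ∧ 0 ≤ B ∧ ∀ (T : MatQ n) (V : ℝ), 0 ≤ V →
    (∀ t, low t = T → c t ≠ 0 → NearQ B t → ‖c t‖ ≤ V) →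
    ∀ t, low t = T → c t ≠ 0 → ‖c t‖ ≤ K * (1 + (t.trace : ℝ)) ^ κ * V

theorem conjZ_apply {ι κ : Type*} [Fintype ι] (u : Matrix ι κ ℤ) (t : Matrix ι ι ℚ) (i j : κ) :
    conjZ u t i j = ∑ k, ∑ l, (u k i : ℚ) * t k l * (u l j : ℚ) := by
  simp only [conjZ, Matrix.mul_apply, transpose_apply, map_apply, Finset.sum_mul]
  exact Finset.sum_comm

/-- Border an integral matrix by the identity. -/
def bdZ (u : Matrix (Fin n) (Fin n) ℤ) : Matrix (Fin (n + 1)) (Fin (n + 1)) ℤ :=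
  Matrix.of (Fin.cons (Fin.cons 1 0) fun k => Fin.cons 0 (u k))

/-- Border a rational matrix by zero. -/
def extQ (t : MatQ n) : MatQ (n + 1) :=
  Matrix.of (Fin.cons 0 fun k => Fin.cons 0 (t k))

@[simp] theorem bdZ_zero_zero (u : Matrix (Fin n) (Fin n) ℤ) : bdZ u 0 0 = 1 := rfl
@[simp] theorem bdZ_zero_succ (u : Matrix (Fin n) (Fin n) ℤ) (i) : bdZ u 0 (Fin.succ i) = 0 := rfl
@[simp] theorem bdZ_succ_zero (u : Matrix (Fin n) (Fin n) ℤ) (i) : bdZ u (Fin.succ i) 0 = 0 := rfl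
@[simp] theorem bdZ_succ_succ (u : Matrix (Fin n) (Fin n) ℤ) (i j) :
    bdZ u (Fin.succ i) (Fin.succ j) = u i j := rfl
@[simp] theorem extQ_zero (t : MatQ n) (j) : extQ t 0 j = 0 := rfl
@[simp] theorem extQ_succ_zero (t : MatQ n) (i) : extQ t (Fin.succ i) 0 = 0 := rfl
@[simp] theorem extQ_succ_succ (t : MatQ n) (i j) :
    extQ t (Fin.succ i) (Fin.succ j) = t i j := rfl

theorem det_bdZ (u : Matrix (Fin n) (Fin n) ℤ) : (bdZ u).det = u.det := by
  rw [det_succ_column_zero, Fin.sum_univ_succ]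
  have : (bdZ u).submatrix (Fin.succAbove 0) Fin.succ = u := by
    ext i j; simp
  rw [this]; simp

theorem low_conjZ_bdZ (u : Matrix (Fin n) (Fin n) ℤ) (t : MatQ (n + 1)) :
    low (conjZ (bdZ u) t) = conjZ u (low t) := by
  ext i j
  simp only [low, submatrix_apply, conjZ_apply, Fin.sum_univ_succ]
  simp

theorem conjZ_bdZ_zero_zero (u : Matrix (Fin n) (Fin n) ℤ) (t : MatQ (n + 1)) :
    conjZ (bdZ u) t 0 0 = t 0 0 := by
  simp only [conjZ_apply, Fin.sum_univ_succ]
  simp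

@[simp] theorem low_extQ (t : MatQ n) : low (extQ t) = t := by
  ext i j; simp [low]

theorem extQ_low {t : MatQ (n + 1)} (ht : t.IsSymm) (h0 : ∀ j, t 0 j = 0) : extQ (low t) = t := by
  ext i j
  cases i using Fin.cases with
  | zero => simp [h0]
  | succ i =>
    cases j using Fin.cases with
    | zero => simp [← ht.apply i.succ 0, h0]
    | succ j => simp [low]

theorem conjZ_bdZ_extQ (u : Matrix (Fin n) (Fin n) ℤ) (t : MatQ n) :
    conjZ (bdZ u) (extQ t) = extQ (conjZ u t) := by
  ext i j
  cases i using Fin.cases <;> cases j using Fin.cases <;>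
    simp [conjZ_apply, Fin.sum_univ_succ]

theorem trace_eq_low (t : MatQ (n + 1)) : t.trace = t 0 0 + (low t).trace := by
  simp [Matrix.trace, Fin.sum_univ_succ, low]

theorem trace_submatrix_equiv {R ι κ : Type*} [Fintype ι] [Fintype κ] [AddCommMonoid R]
    (t : Matrix ι ι R) (σ : κ ≃ ι) : (t.submatrix σ σ).trace = t.trace :=
  Fintype.sum_equiv σ _ _ fun _ => rfl

theorem HalfIntegral.low {t : MatQ (n + 1)} (h : HalfIntegral t) : HalfIntegral (low t) :=
  ⟨low_isSymm h.1, fun i j => h.2.1 i.succ j.succ, fun i => h.2.2 i.succ⟩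

theorem PosSemidefQ.low {t : MatQ (n + 1)} (hs : t.IsSymm) (h : PosSemidefQ t) :
    PosSemidefQ (low t) := qf_low_nonneg hs h

theorem SymQ.perm {c : MatQ n → ℂ} (hc : SymQ c) (σ : Equiv.Perm (Fin n)) (t : MatQ n) :
    ‖c (t.submatrix σ σ)‖ = ‖c t‖ := by
  rw [← hc ((1 : Matrix (Fin n) (Fin n) ℤ).submatrix id σ) (isUnit_det_submatrix (by simp) σ) t]
  congr 2
  ext i j
  simp [conjZ_apply, Matrix.one_apply]

theorem ne_zero_of_norm_eq {a b : ℂ} (h : ‖a‖ = ‖b‖) (hb : b ≠ 0) : a ≠ 0 := by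
  rw [← norm_ne_zero_iff, h, norm_ne_zero_iff]; exact hb

/-- The coefficients of the image under the Siegel operator. -/
def siegelPhi (c : MatQ (n + 1) → ℂ) : MatQ n → ℂ := fun t => c (extQ t)

theorem SuppQ.siegelPhi {c : MatQ (n + 1) → ℂ} (hc : SuppQ c) : SuppQ (siegelPhi c) := by
  intro t ht
  obtain ⟨h1, h2⟩ := hc _ ht
  have h3 := h1.low
  have h4 := h2.low h1.1
  rw [low_extQ] at h3 h4
  exact ⟨h3, h4⟩

theorem SymQ.siegelPhi {c : MatQ (n + 1) → ℂ} (hc : SymQ c) : SymQ (siegelPhi c) := by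
  intro u hu t
  simp only [_root_.siegelPhi, ← conjZ_bdZ_extQ]
  exact hc _ (by rwa [det_bdZ]) _

theorem swap01_succ_succ (i : Fin n) :
    Equiv.swap (0 : Fin (n + 2)) 1 i.succ.succ = i.succ.succ :=
  Equiv.swap_apply_of_ne_of_ne (Fin.succ_ne_zero _) (by
    rw [← Fin.succ_zero_eq_one]; exact fun h => Fin.succ_ne_zero _ (Fin.succ_injective _ h))

theorem ShrinkQ.siegelPhi {c : MatQ (n + 2) → ℂ} (hsupp : SuppQ c) (hsym : SymQ c)
    (hc : ShrinkQ c) : ShrinkQ (siegelPhi c) := by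
  obtain ⟨K, B, κ, hK, hB, h⟩ := hc
  refine ⟨K, B, κ, hK, hB, fun T V hV hnear t hT ht => ?_⟩
  have hperm := hsym.perm (Equiv.swap 0 1) (extQ t)
  have hlow : low ((extQ t).submatrix (Equiv.swap 0 1) (Equiv.swap 0 1)) = extQ T := by
    subst hT
    ext i j
    cases i using Fin.cases <;> cases j using Fin.cases <;>
      simp [low, swap01_succ_succ]
  have := h (extQ T) V hV ?_ _ hlow (ne_zero_of_norm_eq hperm ht)
  · rw [hperm, trace_submatrix_equiv, trace_eq_low (extQ t), low_extQ, extQ_zero, zero_add] at this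
    exact this
  intro s hs hs0 ⟨α, hα, hq⟩
  obtain ⟨hh, hp⟩ := hsupp s hs0
  have hrow : ∀ j, s 1 j = 0 := by
    refine eq_zero_of_diag_eq_zero hh.1 hp ?_
    have := congrFun (congrFun hs 0) 0
    simpa [low] using this
  have hsub : s.submatrix (Equiv.swap 0 1) (Equiv.swap 0 1) =
      extQ (low (s.submatrix (Equiv.swap 0 1) (Equiv.swap 0 1))) :=
    (extQ_low (hh.1.submatrix _) fun j => by simp [hrow]).symm
  have hperm' := hsym.perm (Equiv.swap 0 1) s
  rw [← hperm', hsub]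
  rw [hsub] at hperm'
  refine hnear _ ?_ (ne_zero_of_norm_eq hperm' hs0) ⟨Fin.tail α, fun i => hα _, ?_⟩
  · have hs' : low (low s) = T := by rw [hs, low_extQ]
    rw [← hs']
    ext i j; simp [low, swap01_succ_succ]
  · refine le_trans (le_of_eq ?_) hq
    have hrow' : ∀ j, s j 1 = 0 := fun j => by rw [← hh.1.apply, hrow]
    simp only [qf_eq_sum, Fin.sum_univ_succ, toR, low, map_apply, submatrix_apply,
      swap01_succ_succ, Fin.succ_zero_eq_one, Equiv.swap_apply_right, hrow, hrow']
    simp [Fin.tail]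

end Families

section Growth

variable {n : ℕ}

theorem one_le_log_three_add {y : ℝ} (hy : 0 ≤ y) : 1 ≤ Real.log (3 + y) := by
  rw [Real.le_log_iff_exp_le (by linarith)]
  linarith [Real.exp_one_lt_three]

theorem exists_log_bound (a b : ℝ) (ha : 0 ≤ a) (hb : 0 ≤ b) (m : ℕ) :
    ∃ M : ℝ, 0 ≤ M ∧ ∀ x y : ℝ, 0 ≤ x → 0 ≤ y → x ≤ a + b * y ^ m →
      Real.log (3 + x) ≤ M * Real.log (3 + y) := by
  have h0 : 0 ≤ Real.log (3 + a + b) := Real.log_nonneg (by linarith)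
  refine ⟨Real.log (3 + a + b) + m, by positivity, fun x y hx hy hxy => ?_⟩
  have h1 : 3 + x ≤ (3 + a + b) * (3 + y) ^ m := by
    have h2 : (1 : ℝ) ≤ (3 + y) ^ m := one_le_pow₀ (by linarith)
    have h3 : y ^ m ≤ (3 + y) ^ m := pow_le_pow_left₀ hy (by linarith) m
    nlinarith [mul_le_mul_of_nonneg_left h3 hb, mul_le_mul_of_nonneg_left h2 ha]
  have h2 := Real.log_le_log (by linarith) h1
  rw [Real.log_mul (by positivity) (by positivity), Real.log_pow] at h2
  have h3 := one_le_log_three_add hy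
  nlinarith

theorem exp_log_sq_le {A M x y : ℝ} (hA : 0 ≤ A) (hx : 0 ≤ x)
    (h : Real.log (3 + x) ≤ M * Real.log (3 + y)) :
    Real.exp (A * Real.log (3 + x) ^ 2) ≤ Real.exp (A * M ^ 2 * Real.log (3 + y) ^ 2) := by
  rw [Real.exp_le_exp, mul_assoc, ← mul_pow]
  refine mul_le_mul_of_nonneg_left ?_ hA
  exact pow_le_pow_left₀ (by linarith [one_le_log_three_add hx]) h 2

theorem trace_nonneg_of_psd {t : MatQ n} (h : PosSemidefQ t) : (0 : ℝ) ≤ (t.trace : ℝ) := by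
  have : 0 ≤ t.trace := Finset.sum_nonneg fun i _ => diag_nonneg (t := t) h i
  exact_mod_cast this

theorem trace_one_conj (C : ℚ) (t : MatQ n) (u : Matrix (Fin n) (Fin n) ℤ)
    (h : ∀ W : Matrix (Fin n) (Fin n) ℤ, W.det ≠ 0 →
        ∀ i, conjZ u t i i ≤ C * ∑ j, conjZ W t j j) :
    (conjZ u t).trace ≤ n * (C * t.trace) := by
  have h1 : ∀ i, conjZ u t i i ≤ C * t.trace := fun i => by
    have := h 1 (by simp) i
    rwa [conjZ_one] at this
  calc (conjZ u t).trace ≤ ∑ _i : Fin n, C * t.trace := Finset.sum_le_sum fun i _ => h1 i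
    _ = _ := by simp

theorem growth_of_det_eq_zero {c : MatQ (n + 1) → ℂ} (hsupp : SuppQ c) (hsym : SymQ c)
    (hphi : GrowthQ (siegelPhi c)) : ∃ A : ℝ, 0 ≤ A ∧ ∀ t, c t ≠ 0 → t.det = 0 →
      ‖c t‖ ≤ Real.exp (A * Real.log (3 + (t.trace : ℝ)) ^ 2) := by
  obtain ⟨A, hA, hb⟩ := hphi
  obtain ⟨C, hC, hred⟩ := exists_reduced (n + 1)
  obtain ⟨M, hM, hlog⟩ := exists_log_bound 0 ((n + 1) * C) le_rfl (by positivity) 1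
  refine ⟨A * M ^ 2, by positivity, fun t ht hdet => ?_⟩
  obtain ⟨hh, hp⟩ := hsupp t ht
  obtain ⟨u, hu, hprod, hW⟩ := hred t hh.1 hp
  have hpu : ∀ v, 0 ≤ qf (conjZ u t) v := conjZ_psd u hp
  obtain ⟨i, hi⟩ : ∃ i, conjZ u t i i = 0 := by
    by_contra! hne
    have : 0 < ∏ i, conjZ u t i i :=
      Finset.prod_pos fun i _ => lt_of_le_of_ne (diag_nonneg hpu i) (hne i).symm
    rw [hdet, mul_zero] at hprod
    linarith
  set s := (conjZ u t).submatrix (Equiv.swap 0 i) (Equiv.swap 0 i) with hs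
  have hnorm : ‖c s‖ = ‖c t‖ := by rw [hs, hsym.perm, hsym u hu]
  have hs0 : c s ≠ 0 := ne_zero_of_norm_eq hnorm ht
  obtain ⟨hsh, hsp⟩ := hsupp s hs0
  have hrow : ∀ j, s 0 j = 0 := eq_zero_of_diag_eq_zero hsh.1 hsp (by simp [hs, hi])
  have hext := extQ_low hsh.1 hrow
  have h1 := hb (low s) (by rw [siegelPhi, hext]; exact hs0)
  rw [siegelPhi, hext, hnorm] at h1
  have htr : (low s).trace = (conjZ u t).trace := by
    rw [← trace_submatrix_equiv (conjZ u t) (Equiv.swap 0 i), ← hs, trace_eq_low s, hrow, zero_add]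
  refine h1.trans (exp_log_sq_le hA (trace_nonneg_of_psd (hsp.low hsh.1)) ?_)
  refine hlog _ _ (trace_nonneg_of_psd (hsp.low hsh.1)) (trace_nonneg_of_psd hp) ?_
  rw [htr]
  have := trace_one_conj C t u hW
  have h2 : ((conjZ u t).trace : ℝ) ≤ ((((n + 1 : ℕ) : ℚ) * (C * t.trace) : ℚ) : ℝ) := by
    exact_mod_cast this
  push_cast at h2
  linarith

theorem trace_le_of_near {B : ℝ} {t : MatQ (n + 1)} (hs : t.IsSymm) (hp : PosSemidefQ t)
    (h : NearQ B t) : (t.trace : ℝ) ≤ 2 * B + (n + 1) * ((low t).trace : ℝ) := by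
  obtain ⟨α, hα, hq⟩ := h
  have hR := toR_isSymm hs
  have hpR : ∀ v, 0 ≤ qf (toR t) v := qf_toR_nonneg hp
  have hlR : low (toR t) = toR (low t) := rfl
  have h1 := hpR (Fin.cons 1 ((2 : ℝ) • α))
  have h2 : (Fin.cons 1 ((2 : ℝ) • α) : Fin (n + 1) → ℝ) =
    Fin.cons 1 α + Fin.cons 0 α := by
    ext i; cases i using Fin.cases <;> simp; ring
  have e1 := qf_cons hR 1 α
  have e2 := qf_cons hR 1 ((2 : ℝ) • α)
  rw [qf_smul] at e2
  have e3 : ∑ i, toR t 0 i.succ * ((2 : ℝ) • α) i = 2 * ∑ i, toR t 0 i.succ * α i := by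
    rw [Finset.mul_sum]; exact Finset.sum_congr rfl fun i _ => by simp; ring
  rw [e3] at e2
  have h3 : qf (low (toR t)) α ≤ n / 4 * ((low t).trace : ℝ) := by
    rw [hlR, qf_eq_sum]
    have hlp : ∀ v, 0 ≤ qf (low t) v := hp.low hs
    have key : ∀ i j, α i * toR (low t) i j * α j ≤
        ((toR (low t) i i + toR (low t) j j) / 2) / 4 := by
      intro i j
      have a1 := abs_entry_le (toR_isSymm (low_isSymm hs)) (qf_toR_nonneg hlp) i j
      have a2 := hα i
      have a3 := hα j
      calc α i * toR (low t) i j * α j ≤ |α i * toR (low t) i j * α j| := le_abs_self _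
        _ = |α i| * |toR (low t) i j| * |α j| := by rw [abs_mul, abs_mul]
        _ ≤ (1 / 2) * ((toR (low t) i i + toR (low t) j j) / 2) * (1 / 2) := by
            gcongr
            exact mul_nonneg (by norm_num) ((abs_nonneg _).trans a1)
        _ = _ := by ring
    calc ∑ i, ∑ j, α i * toR (low t) i j * α j ≤
        ∑ i : Fin n, ∑ j : Fin n, ((toR (low t) i i + toR (low t) j j) / 2) / 4 :=
          Finset.sum_le_sum fun i _ => Finset.sum_le_sum fun j _ => key i j
      _ = n / 4 * ((low t).trace : ℝ) := by
          simp only [← Finset.sum_div, Finset.sum_add_distrib, Finset.sum_const, Finset.card_univ,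
            Fintype.card_fin, nsmul_eq_mul, ← Finset.mul_sum]
          simp only [Matrix.trace, toR, map_apply, diag_apply, Rat.cast_sum]
          ring
  have h4 : (t.trace : ℝ) = toR t 0 0 + ((low t).trace : ℝ) := by
    rw [trace_eq_low]; simp [toR]
  have h5 : 0 ≤ ((low t).trace : ℝ) := trace_nonneg_of_psd (hp.low hs)
  rw [h4]
  nlinarith

theorem le_prod_of_one_le {T : MatQ n} (h1 : ∀ i, 1 ≤ T i i) (j : Fin n) :
    T j j ≤ ∏ i, T i i := by
  rw [← Finset.mul_prod_erase _ _ (Finset.mem_univ j)]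
  refine le_mul_of_one_le_right (zero_le_one.trans (h1 j)) ?_
  exact Finset.prod_induction _ (fun x => 1 ≤ x)
    (fun a b => one_le_mul_of_one_le_of_one_le) le_rfl fun i _ => h1 i

end Growth

section GrowthInduction

variable {n : ℕ}

theorem conjZ_perm (σ : Equiv.Perm (Fin n)) (t : MatQ n) :
    conjZ ((1 : Matrix (Fin n) (Fin n) ℤ).submatrix id σ) t = t.submatrix σ σ := by
  ext i j
  simp [conjZ_apply, Matrix.one_apply]

theorem HalfIntegral.one_le_diag {t : MatQ n} (h : HalfIntegral t) (hp : PosSemidefQ t)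
    (hd : 0 < t.det) (i : Fin n) : 1 ≤ t i i := by
  have h0 : 0 ≤ t i i := diag_nonneg (t := t) hp i
  have h1 : t i i ≠ 0 := fun h0 => hd.ne' (det_eq_zero_of_diag h.1 hp h0)
  obtain ⟨z, hz⟩ := h.2.2 i
  rw [hz] at h0 h1 ⊢
  have h2 : 0 ≤ z := by exact_mod_cast h0
  have h3 : z ≠ 0 := by exact_mod_cast h1
  have : 1 ≤ z := by omega
  exact_mod_cast this

theorem trace_le_of_reduced {C : ℚ} {T : MatQ n} (h1 : ∀ i, 1 ≤ T i i)
    (hr : ∏ i, T i i ≤ C * T.det) : T.trace ≤ n * (C * T.det) := by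
  calc T.trace ≤ ∑ _i : Fin n, C * T.det :=
        Finset.sum_le_sum fun i _ => (le_prod_of_one_le h1 i).trans hr
    _ = _ := by simp

/-- The determinant of the lower block drops after exchanging a near first vector with a long
vector of a reduced basis. -/
theorem det_low_exchange {m : ℕ} {C : ℚ} (hC : 0 < C) {B : ℝ}
    {t : MatQ (m + 2)} (hs : t.IsSymm) (hp : PosSemidefQ t) (hd : t.det ≠ 0)
    (hnear : NearQ B t) (hr : ∏ i, low t i i ≤ C * (low t).det)
    (hJ : 8 * B * C ≤ ((low t 0 0 : ℚ) : ℝ)) :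
    (((low (t.submatrix (Equiv.swap 0 1) (Equiv.swap 0 1))).det : ℚ) : ℝ) ≤
      3 / 4 * (((low t).det : ℚ) : ℝ) := by
  obtain ⟨α, hα, hq⟩ := hnear
  have hsl := low_isSymm hs
  have hpl : ∀ v, 0 ≤ qf (low t) v := hp.low hs
  have hO0 : 0 ≤ (low (low t)).det :=
    det_nonneg_of_qf (low_isSymm hsl) (qf_low_nonneg hsl hpl)
  have hOle : low t 0 0 * (low (low t)).det ≤ C * (low t).det := by
    refine le_trans ?_ hr
    rw [Fin.prod_univ_succ]
    exact mul_le_mul_of_nonneg_left (det_le_prod_diag (low_isSymm hsl) (qf_low_nonneg hsl hpl))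
      (diag_nonneg hpl 0)
  have hOle' : ((low t 0 0 : ℚ) : ℝ) * (((low (low t)).det : ℚ) : ℝ) ≤ C * (((low t).det : ℚ) : ℝ) := by
    exact_mod_cast hOle
  have hO0' : (0 : ℝ) ≤ (((low (low t)).det : ℚ) : ℝ) := by exact_mod_cast hO0
  have hdR : (toR t).det ≠ 0 := by rw [det_toR]; exact_mod_cast hd
  have h := det_low_swap_le (toR_isSymm hs) (qf_toR_nonneg hp) hdR (α 0) (Fin.tail α)
  rw [Fin.cons_self_tail] at h
  have e1 : (low ((toR t).submatrix (Equiv.swap 0 1) (Equiv.swap 0 1))).det =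
      (((low (t.submatrix (Equiv.swap 0 1) (Equiv.swap 0 1))).det : ℚ) : ℝ) := by
    rw [← det_toR]; rfl
  have e2 : (low (low (toR t))).det = (((low (low t)).det : ℚ) : ℝ) := by rw [← det_toR]; rfl
  have e3 : (low (toR t)).det = (((low t).det : ℚ) : ℝ) := by rw [← det_toR]; rfl
  rw [e1, e2, e3] at h
  have hd0 : (0 : ℝ) ≤ (((low t).det : ℚ) : ℝ) := by exact_mod_cast det_nonneg_of_qf hsl hpl
  have hα0 : α 0 ^ 2 ≤ 1 / 4 := by
    have := abs_le.1 (hα 0)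
    nlinarith [this.1, this.2]
  have h1 : 2 * qf (toR t) (Fin.cons 1 α) * (((low (low t)).det : ℚ) : ℝ) ≤
      2 * B * (((low (low t)).det : ℚ) : ℝ) := by gcongr
  have hCR : (0 : ℝ) < C := by exact_mod_cast hC
  have h2 : 8 * B * (((low (low t)).det : ℚ) : ℝ) ≤ (((low t).det : ℚ) : ℝ) := by
    have := (mul_le_mul_of_nonneg_right hJ hO0').trans hOle'
    refine le_of_mul_le_mul_left ?_ hCR
    linarith
  have h3 : 2 * α 0 ^ 2 * (((low t).det : ℚ) : ℝ) ≤ 2 * (1 / 4) * (((low t).det : ℚ) : ℝ) := by gcongr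
  linarith

theorem NearQ.perm {B : ℝ} {t : MatQ (n + 1)} (h : NearQ B t) (σ : Equiv.Perm (Fin n)) :
    NearQ B (conjZ (bdZ ((1 : Matrix (Fin n) (Fin n) ℤ).submatrix id σ)) t) := by
  obtain ⟨α, hα, hq⟩ := h
  refine ⟨α ∘ σ, fun i => hα _, le_trans (le_of_eq ?_) hq⟩
  have e : toR (conjZ (bdZ ((1 : Matrix (Fin n) (Fin n) ℤ).submatrix id σ)) t) =
      (toR t).submatrix (Equiv.Perm.decomposeFin.symm (0, σ))
        (Equiv.Perm.decomposeFin.symm (0, σ)) := by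
    ext i j
    simp only [toR, map_apply, submatrix_apply]
    cases i using Fin.cases <;> cases j using Fin.cases <;>
      simp [conjZ_apply, Fin.sum_univ_succ, Matrix.one_apply]
  rw [e, submatrix_isSymm_qf]
  congr 1
  ext i
  obtain ⟨i, rfl⟩ := (Equiv.Perm.decomposeFin.symm (0, σ)).surjective i
  rw [Function.comp_apply, Equiv.symm_apply_apply]
  cases i using Fin.cases <;> simp

theorem exp_absorb {A M K D D' x : ℝ} {κ : ℕ} (hK : 1 ≤ K)
    (hA : (Real.log K + κ * M) / Real.log (8 / 7) ≤ A) (hA0 : 0 ≤ A)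
    (hD : 3 ≤ D) (hD' : 0 ≤ D') (hDD : D' ≤ 3 / 4 * D) (hx : 0 ≤ x)
    (hlog : Real.log (3 + x) ≤ M * Real.log (3 + D)) :
    K * (1 + x) ^ κ * Real.exp (A * Real.log (3 + D') ^ 2) ≤
      Real.exp (A * Real.log (3 + D) ^ 2) := by
  set δ := Real.log (8 / 7) with hδ
  set l := Real.log (3 + D) with hl
  have hδ0 : 0 < δ := Real.log_pos (by norm_num)
  have hl1 : 1 ≤ l := one_le_log_three_add (by linarith)
  have hδ1 : δ ≤ 1 := by
    rw [hδ, Real.log_le_iff_le_exp (by norm_num)]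
    linarith [Real.add_one_le_exp (1 : ℝ)]
  have h1 : Real.log (3 + D') ≤ l - δ := by
    rw [hl, hδ, ← Real.log_div (by linarith) (by norm_num)]
    exact Real.log_le_log (by linarith) (by linarith)
  have h2 : Real.log (3 + D') ^ 2 ≤ l ^ 2 - δ * l := by
    have h3 := pow_le_pow_left₀ (by linarith [one_le_log_three_add hD']) h1 2
    nlinarith
  have hlK : 0 ≤ Real.log K := Real.log_nonneg hK
  have h4 : K * (1 + x) ^ κ ≤ Real.exp ((Real.log K + κ * M) * l) := by
    have h5 : K * (1 + x) ^ κ ≤ K * (3 + x) ^ κ := by gcongr; linarith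
    refine h5.trans ?_
    rw [← Real.exp_log (by positivity : 0 < K * (3 + x) ^ κ), Real.exp_le_exp,
      Real.log_mul (by positivity) (by positivity), Real.log_pow]
    have h6 := mul_le_mul_of_nonneg_left hlog (Nat.cast_nonneg κ : (0 : ℝ) ≤ κ)
    nlinarith
  rw [div_le_iff₀ hδ0] at hA
  calc K * (1 + x) ^ κ * Real.exp (A * Real.log (3 + D') ^ 2)
      ≤ Real.exp ((Real.log K + κ * M) * l) * Real.exp (A * Real.log (3 + D') ^ 2) := by gcongr
    _ = Real.exp ((Real.log K + κ * M) * l + A * Real.log (3 + D') ^ 2) := (Real.exp_add _ _).symm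
    _ ≤ _ := by
      rw [Real.exp_le_exp]
      have h7 := mul_le_mul_of_nonneg_left h2 hA0
      have h8 := mul_le_mul_of_nonneg_right hA (zero_le_one.trans hl1)
      nlinarith

end GrowthInduction

section GrowthMain

variable {n : ℕ}

theorem conjZ_bdZ_isUnit {u : Matrix (Fin n) (Fin n) ℤ} (hu : IsUnit u.det) :
    IsUnit (bdZ u).det := by rwa [det_bdZ]

/-- Induction over the determinant of the reduced lower block. -/
theorem near_bound {c : MatQ (n + 1) → ℂ} (hsupp : SuppQ c) (hsym : SymQ c)
    {K B : ℝ} {κ : ℕ} (hK : 1 ≤ K) (hB : 0 ≤ B)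
    (hshrink : ∀ (T : MatQ n) (V : ℝ), 0 ≤ V →
      (∀ t, low t = T → c t ≠ 0 → NearQ B t → ‖c t‖ ≤ V) →
      ∀ t, low t = T → c t ≠ 0 → ‖c t‖ ≤ K * (1 + (t.trace : ℝ)) ^ κ * V)
    {A₀ : ℝ} (hA₀ : 0 ≤ A₀) (hsing : ∀ t, c t ≠ 0 → t.det = 0 →
      ‖c t‖ ≤ Real.exp (A₀ * Real.log (3 + (t.trace : ℝ)) ^ 2))
    {C : ℚ} (hC : 0 < C) (hred : ∀ t : MatQ n, t.IsSymm →
      (∀ v, 0 ≤ qf t v) → ∃ u : Matrix (Fin n) (Fin n) ℤ, IsUnit u.det ∧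
      ∏ i, conjZ u t i i ≤ C * t.det) :
    ∃ A : ℝ, 0 ≤ A ∧ ∀ T : MatQ n, ∏ i, T i i ≤ C * T.det → 0 < T.det → (∀ i, 1 ≤ T i i) →
      ∀ t, low t = T → c t ≠ 0 → NearQ B t →
        ‖c t‖ ≤ Real.exp (A * Real.log (3 + (T.det : ℝ)) ^ 2) := by
  have hCR : (0 : ℝ) < C := by exact_mod_cast hC
  set J : ℝ := 8 * B * C + 3 * C with hJ
  have hJ0 : 0 ≤ J := by positivity
  -- bounded diagonal
  obtain ⟨X, hX⟩ := exists_rat_gt (2 * B + (n + 1) * (n * J))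
  obtain ⟨A₁, hA₁⟩ := ((HalfIntegral.entry_finite (n := n + 1) X).image (fun t => ‖c t‖)).bddAbove
  have hdirect : ∀ t, c t ≠ 0 → NearQ B t → (∀ j, ((low t j j : ℚ) : ℝ) ≤ J) → ‖c t‖ ≤ A₁ := by
    intro t ht hnear hj
    obtain ⟨hh, hp⟩ := hsupp t ht
    refine hA₁ ⟨t, ⟨hh, hp, ?_⟩, rfl⟩
    have h1 := trace_le_of_near hh.1 hp hnear
    have h2 : ((low t).trace : ℝ) ≤ n * J := by
      rw [Matrix.trace, Rat.cast_sum]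
      calc _ ≤ ∑ _i : Fin n, J := Finset.sum_le_sum fun i _ => hj i
        _ = _ := by simp
    have h3 : (t.trace : ℝ) ≤ X := by
      have := mul_le_mul_of_nonneg_left h2 (by positivity : (0 : ℝ) ≤ n + 1)
      linarith
    exact_mod_cast h3
  obtain ⟨M, hM, hlog⟩ := exists_log_bound (2 * B) ((n + 1) * (n * C)) (by positivity)
    (by positivity) 1
  obtain ⟨M₁, hM₁, hlog₁⟩ := exists_log_bound 0 (C + n * C) le_rfl (by positivity) 1
  have hδ0 : 0 < Real.log (8 / 7) := Real.log_pos (by norm_num)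
  have hKl : 0 ≤ Real.log K := Real.log_nonneg hK
  set A : ℝ := max A₁ 0 + A₀ * M ^ 2 + (Real.log K + κ * M₁) / Real.log (8 / 7) with hAdef
  have p1 : 0 ≤ max A₁ 0 := le_max_right _ _
  have p2 : 0 ≤ A₀ * M ^ 2 := by positivity
  have p3 : 0 ≤ (Real.log K + κ * M₁) / Real.log (8 / 7) := by positivity
  have hA : 0 ≤ A := by positivity
  refine ⟨A, hA, ?_⟩
  suffices key : ∀ (k : ℕ) (T : MatQ n), (T.det : ℝ) < (4 / 3) ^ k → ∏ i, T i i ≤ C * T.det →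
      0 < T.det → (∀ i, 1 ≤ T i i) → ∀ t, low t = T → c t ≠ 0 → NearQ B t →
        ‖c t‖ ≤ Real.exp (A * Real.log (3 + (T.det : ℝ)) ^ 2) by
    intro T
    obtain ⟨k, hk⟩ := pow_unbounded_of_one_lt (T.det : ℝ) (by norm_num : (1 : ℝ) < 4 / 3)
    exact key k T hk
  intro k
  induction k with
  | zero =>
    intro T hk hr hd h1 t hT ht hnear
    have hdR : (0 : ℝ) < T.det := by exact_mod_cast hd
    have h2 := hdirect t ht hnear (fun j => by
      have h3 : (T j j : ℝ) ≤ C * T.det := by exact_mod_cast (le_prod_of_one_le h1 j).trans hr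
      rw [hT]
      rw [pow_zero] at hk
      nlinarith [mul_nonneg (mul_nonneg (by norm_num : (0 : ℝ) ≤ 8) hB) hCR.le])
    have h4 := one_le_log_three_add hdR.le
    calc ‖c t‖ ≤ A := h2.trans (by linarith [le_max_left A₁ 0])
      _ ≤ A * Real.log (3 + (T.det : ℝ)) ^ 2 := le_mul_of_one_le_right hA (one_le_pow₀ h4)
      _ ≤ _ := by linarith [Real.add_one_le_exp (A * Real.log (3 + (T.det : ℝ)) ^ 2)]
  | succ k ih =>
    intro T hk hr hd h1 t hT ht hnear
    obtain ⟨hh, hp⟩ := hsupp t ht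
    have hdR : (0 : ℝ) < T.det := by exact_mod_cast hd
    have h4 := one_le_log_three_add hdR.le
    by_cases hsmall : ∀ j, ((low t j j : ℚ) : ℝ) ≤ J
    · have h2 := hdirect t ht hnear hsmall
      calc ‖c t‖ ≤ A := h2.trans (by linarith [le_max_left A₁ 0])
        _ ≤ A * Real.log (3 + (T.det : ℝ)) ^ 2 := le_mul_of_one_le_right hA (one_le_pow₀ h4)
        _ ≤ _ := by linarith [Real.add_one_le_exp (A * Real.log (3 + (T.det : ℝ)) ^ 2)]
    by_cases hdet : t.det = 0
    · have h2 := trace_le_of_near hh.1 hp hnear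
      rw [hT] at h2
      have h3 : (T.trace : ℝ) ≤ n * (C * T.det) := by
        exact_mod_cast trace_le_of_reduced h1 hr
      have h5 := hlog (t.trace) T.det (trace_nonneg_of_psd hp) hdR.le (by
        have := mul_le_mul_of_nonneg_left h3 (by positivity : (0 : ℝ) ≤ n + 1)
        linarith)
      refine (hsing t ht hdet).trans ((exp_log_sq_le hA₀ (trace_nonneg_of_psd hp) h5).trans ?_)
      rw [Real.exp_le_exp]
      exact mul_le_mul_of_nonneg_right (by linarith) (sq_nonneg _)
    push Not at hsmall
    obtain ⟨j, hj⟩ := hsmall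
    rcases n with _ | m
    · exact j.elim0
    -- move the long vector to the second place, then to the first
    set σ : Equiv.Perm (Fin (m + 1)) := Equiv.swap 0 j with hσ
    set p := bdZ ((1 : Matrix (Fin (m + 1)) (Fin (m + 1)) ℤ).submatrix id σ) with hpdef
    have hpu : IsUnit p.det := conjZ_bdZ_isUnit (isUnit_det_submatrix (by simp) σ)
    set t₂ := conjZ p t with ht₂
    have hn₂ : ‖c t₂‖ = ‖c t‖ := hsym p hpu t
    have hc₂ : c t₂ ≠ 0 := ne_zero_of_norm_eq hn₂ ht
    obtain ⟨hh₂, hp₂⟩ := hsupp t₂ hc₂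
    have hlow₂ : low t₂ = T.submatrix σ σ := by
      rw [ht₂, hpdef, low_conjZ_bdZ, conjZ_perm, hT]
    have hdet₂ : t₂.det ≠ 0 := by rw [ht₂, det_conjZ_of_isUnit hpu]; exact hdet
    have hdetT₂ : (low t₂).det = T.det := by rw [hlow₂, det_submatrix_equiv_self]
    have hprod₂ : ∏ i, low t₂ i i ≤ C * (low t₂).det := by
      rw [hdetT₂, hlow₂]
      refine le_trans (le_of_eq ?_) hr
      exact Fintype.prod_equiv σ _ _ fun i => rfl
    have h00 : low t₂ 0 0 = T j j := by rw [hlow₂]; simp [hσ]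
    have hex := det_low_exchange hC hh₂.1 hp₂ hdet₂ (hnear.perm σ) hprod₂ (by
      rw [h00, ← hT]; linarith [hj.le, mul_pos (by norm_num : (0 : ℝ) < 3) hCR])
    rw [hdetT₂] at hex
    set t₃ := t₂.submatrix (Equiv.swap 0 1) (Equiv.swap 0 1) with ht₃
    have hn₃ : ‖c t₃‖ = ‖c t‖ := by rw [ht₃, hsym.perm, hn₂]
    have hc₃ : c t₃ ≠ 0 := ne_zero_of_norm_eq hn₃ ht
    obtain ⟨hh₃, hp₃⟩ := hsupp t₃ hc₃
    have hdet₃ : 0 < (low t₃).det :=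
      det_low_pos hh₃.1 hp₃ (by rw [ht₃, det_submatrix_equiv_self]; exact hdet₂)
    obtain ⟨u, hu, hu_prod⟩ := hred (low t₃) (low_isSymm hh₃.1) (hp₃.low hh₃.1)
    set t₄ := conjZ (bdZ u) t₃ with ht₄
    have hn₄ : ‖c t₄‖ = ‖c t‖ := by rw [ht₄, hsym _ (conjZ_bdZ_isUnit hu), hn₃]
    have hc₄ : c t₄ ≠ 0 := ne_zero_of_norm_eq hn₄ ht
    obtain ⟨hh₄, hp₄⟩ := hsupp t₄ hc₄
    have hlow₄ : low t₄ = conjZ u (low t₃) := low_conjZ_bdZ _ _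
    have hdet₄ : (low t₄).det = (low t₃).det := by rw [hlow₄, det_conjZ_of_isUnit hu]
    have hdet₄0 : 0 < (low t₄).det := hdet₄ ▸ hdet₃
    have hone₄ := hh₄.low.one_le_diag (hp₄.low hh₄.1) hdet₄0
    have hprod₄ : ∏ i, low t₄ i i ≤ C * (low t₄).det := by rw [hdet₄, hlow₄]; exact hu_prod
    have hdet₄' : ((low t₄).det : ℝ) ≤ 3 / 4 * T.det := by rw [hdet₄]; exact hex
    have hdet₄R : (0 : ℝ) < ((low t₄).det : ℝ) := by exact_mod_cast hdet₄0
    have hV := ih (low t₄) (by rw [pow_succ] at hk; linarith) hprod₄ hdet₄0 hone₄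
    have hfin := hshrink (low t₄) _ (Real.exp_pos _).le hV t₄ rfl hc₄
    rw [hn₄] at hfin
    -- numerics
    have hTj : (T j j : ℝ) ≤ C * T.det := by
      exact_mod_cast (le_prod_of_one_le h1 j).trans hr
    have hD3 : 3 ≤ (T.det : ℝ) := by
      rw [hT] at hj
      have : C * 3 ≤ (C : ℝ) * T.det := by
        have := mul_nonneg (mul_nonneg (by norm_num : (0 : ℝ) ≤ 8) hB) hCR.le
        linarith
      exact le_of_mul_le_mul_left this hCR
    have htr₄ : (t₄.trace : ℝ) ≤ 0 + (C + (m + 1 : ℕ) * C) * (T.det : ℝ) ^ 1 := by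
      have e1 : t₄ 0 0 = T j j := by
        rw [ht₄, conjZ_bdZ_zero_zero, ← h00]
        simp [ht₃, low]
      have e2 : ((low t₄).trace : ℝ) ≤ (m + 1 : ℕ) * ((C : ℝ) * (((low t₄).det : ℚ) : ℝ)) := by
        exact_mod_cast trace_le_of_reduced hone₄ hprod₄
      have e3 : ((m + 1 : ℕ) : ℝ) * ((C : ℝ) * (((low t₄).det : ℚ) : ℝ)) ≤
          (m + 1 : ℕ) * ((C : ℝ) * ((T.det : ℚ) : ℝ)) :=
        mul_le_mul_of_nonneg_left (mul_le_mul_of_nonneg_left (by linarith) hCR.le)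
          (Nat.cast_nonneg _)
      rw [trace_eq_low, e1, Rat.cast_add, pow_one]
      linarith
    refine hfin.trans (exp_absorb hK (by linarith) hA hD3 hdet₄R.le hdet₄'
      (trace_nonneg_of_psd hp₄) (hlog₁ _ _ (trace_nonneg_of_psd hp₄) hdR.le htr₄))

theorem GrowthQ.of_siegelPhi {c : MatQ (n + 1) → ℂ} (hsupp : SuppQ c) (hsym : SymQ c)
    (hsh : ShrinkQ c) (hphi : GrowthQ (siegelPhi c)) : GrowthQ c := by
  obtain ⟨A₀, hA₀, hsing⟩ := growth_of_det_eq_zero hsupp hsym hphi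
  obtain ⟨K, B, κ, hK, hB, hshrink⟩ := hsh
  obtain ⟨C, hC, hred'⟩ := exists_reduced n
  have hred : ∀ t : MatQ n, t.IsSymm →
      (∀ v, 0 ≤ qf t v) → ∃ u : Matrix (Fin n) (Fin n) ℤ, IsUnit u.det ∧
      ∏ i, conjZ u t i i ≤ C * t.det := fun t h1 h2 => by
    obtain ⟨u, hu, hp, -⟩ := hred' t h1 h2
    exact ⟨u, hu, hp⟩
  have hCR : (0 : ℝ) < C := by exact_mod_cast hC
  obtain ⟨A, hA, hnear⟩ := near_bound hsupp hsym hK hB hshrink hA₀ hsing hC hred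
  obtain ⟨M, hM, hlog⟩ := exists_log_bound 0 1 le_rfl zero_le_one n
  obtain ⟨M₁, hM₁, hlog₁⟩ := exists_log_bound 0 (1 + n * C) le_rfl (by positivity) (n + 1)
  refine ⟨A₀ + A * M ^ 2 + (Real.log K + κ * (Real.log (4 + n * C) + (n + 1))), ?_, ?_⟩
  · have := Real.log_nonneg hK
    have : 0 ≤ Real.log (4 + n * C) := Real.log_nonneg (by nlinarith [Nat.cast_nonneg (α := ℝ) n])
    positivity
  intro t ht
  have hKl := Real.log_nonneg hK
  have hlC : 0 ≤ Real.log (4 + n * C) := Real.log_nonneg (by nlinarith [Nat.cast_nonneg (α := ℝ) n])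
  obtain ⟨hh, hp⟩ := hsupp t ht
  have htr := trace_nonneg_of_psd hp
  set y : ℝ := (t.trace : ℝ) with hy
  have hl := one_le_log_three_add htr
  have hl2 : Real.log (3 + y) ≤ Real.log (3 + y) ^ 2 := by nlinarith
  by_cases hdet : t.det = 0
  · refine (hsing t ht hdet).trans ?_
    rw [Real.exp_le_exp]
    refine mul_le_mul_of_nonneg_right ?_ (sq_nonneg _)
    have : 0 ≤ A * M ^ 2 := by positivity
    have : 0 ≤ κ * (Real.log (4 + n * C) + (n + 1)) := by positivity
    linarith
  have hlowdet := det_low_pos hh.1 hp hdet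
  obtain ⟨u, hu, hprod⟩ := hred (low t) (low_isSymm hh.1) (hp.low hh.1)
  set s := conjZ (bdZ u) t with hs
  have hn : ‖c s‖ = ‖c t‖ := hsym _ (conjZ_bdZ_isUnit hu) t
  have hc : c s ≠ 0 := ne_zero_of_norm_eq hn ht
  obtain ⟨hhs, hps⟩ := hsupp s hc
  have hlow : low s = conjZ u (low t) := low_conjZ_bdZ _ _
  have hdets : (low s).det = (low t).det := by rw [hlow, det_conjZ_of_isUnit hu]
  have hdets0 : 0 < (low s).det := hdets ▸ hlowdet
  have hones := hhs.low.one_le_diag (hps.low hhs.1) hdets0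
  have hprods : ∏ i, low s i i ≤ C * (low s).det := by rw [hdets, hlow]; exact hprod
  have hfin := hshrink (low s) _ (Real.exp_pos _).le (hnear (low s) hprods hdets0 hones) s rfl hc
  rw [hn, hdets] at hfin
  have htl : ∀ i, ((low t i i : ℚ) : ℝ) ≤ y := by
    intro i
    have h1 : t i.succ i.succ ≤ t.trace :=
      Finset.single_le_sum (f := fun i => t i i) (fun i _ => diag_nonneg (t := t) hp i)
        (Finset.mem_univ i.succ)
    exact Rat.cast_le.mpr h1
  have hD : ((low t).det : ℝ) ≤ y ^ n := by
    have h1 : ((low t).det : ℝ) ≤ ∏ i, ((low t i i : ℚ) : ℝ) := by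
      exact_mod_cast det_le_prod_diag (low_isSymm hh.1) (hp.low hh.1)
    refine h1.trans ?_
    calc _ ≤ ∏ _i : Fin n, y := Finset.prod_le_prod (fun i _ => by
            exact_mod_cast diag_nonneg (t := low t) (hp.low hh.1) i) fun i _ => htl i
      _ = y ^ n := by simp
  have hDpos : (0 : ℝ) < ((low t).det : ℝ) := by exact_mod_cast hlowdet
  have hs_tr : (s.trace : ℝ) ≤ y + n * C * y ^ n := by
    have e1 : s 0 0 = t 0 0 := conjZ_bdZ_zero_zero _ _
    have e2 : ((low s).trace : ℝ) ≤ n * ((C : ℝ) * (((low s).det : ℚ) : ℝ)) := by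
      exact_mod_cast trace_le_of_reduced hones hprods
    have e3 : (t 0 0 : ℝ) ≤ y := by
      have h1 : t 0 0 ≤ t.trace :=
        Finset.single_le_sum (f := fun i => t i i) (fun i _ => diag_nonneg (t := t) hp i)
          (Finset.mem_univ 0)
      exact Rat.cast_le.mpr h1
    rw [trace_eq_low, e1, Rat.cast_add]
    rw [hdets] at e2
    have e4 : (n : ℝ) * ((C : ℝ) * (((low t).det : ℚ) : ℝ)) ≤ n * (C * y ^ n) :=
      mul_le_mul_of_nonneg_left (mul_le_mul_of_nonneg_left hD hCR.le) (Nat.cast_nonneg _)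
    linarith
  have hpoly : (1 + (s.trace : ℝ)) ^ κ ≤
      Real.exp (κ * (Real.log (4 + n * C) + (n + 1)) * Real.log (3 + y)) := by
    have h0 : 0 ≤ (s.trace : ℝ) := trace_nonneg_of_psd hps
    have h1 : 1 + (s.trace : ℝ) ≤ (4 + n * C) * (3 + y) ^ (n + 1) := by
      have a1 : (1 : ℝ) ≤ (3 + y) ^ n := one_le_pow₀ (by linarith)
      have a2 : y ^ n ≤ (3 + y) ^ n := pow_le_pow_left₀ htr (by linarith) n
      have a3 : (3 + y) ^ n ≤ (3 + y) ^ (n + 1) := pow_le_pow_right₀ (by linarith) (by omega)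
      have a4 : 3 + y ≤ (3 + y) ^ (n + 1) := by
        rw [pow_succ]; nlinarith
      have a5 : (n : ℝ) * C * y ^ n ≤ n * C * (3 + y) ^ (n + 1) :=
        mul_le_mul_of_nonneg_left (a2.trans a3) (by positivity)
      linarith
    have h2 : (1 + (s.trace : ℝ)) ^ κ ≤ ((4 + n * C) * (3 + y) ^ (n + 1)) ^ κ :=
      pow_le_pow_left₀ (by linarith) h1 κ
    refine h2.trans ?_
    rw [← Real.exp_log (by positivity : (0 : ℝ) < ((4 + n * C) * (3 + y) ^ (n + 1)) ^ κ),
      Real.exp_le_exp, Real.log_pow, Real.log_mul (by positivity) (by positivity), Real.log_pow,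
      mul_assoc]
    refine mul_le_mul_of_nonneg_left ?_ (Nat.cast_nonneg κ)
    push_cast
    nlinarith
  have hV := exp_log_sq_le hA hDpos.le (hlog _ _ hDpos.le htr (by linarith))
  calc ‖c t‖ ≤ K * (1 + (s.trace : ℝ)) ^ κ *
        Real.exp (A * Real.log (3 + ((low t).det : ℝ)) ^ 2) := hfin
    _ ≤ Real.exp (Real.log K) * Real.exp (κ * (Real.log (4 + n * C) + (n + 1)) * Real.log (3 + y))
        * Real.exp (A * M ^ 2 * Real.log (3 + y) ^ 2) := by
        rw [Real.exp_log (by linarith)]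
        gcongr
    _ = Real.exp (Real.log K + κ * (Real.log (4 + n * C) + (n + 1)) * Real.log (3 + y)
        + A * M ^ 2 * Real.log (3 + y) ^ 2) := by rw [Real.exp_add, Real.exp_add]
    _ ≤ _ := by
        rw [Real.exp_le_exp]
        have b1 : 0 ≤ κ * (Real.log (4 + n * C) + (n + 1)) := by positivity
        have b2 := mul_le_mul_of_nonneg_left hl2 b1
        have b3 : Real.log K ≤ Real.log K * Real.log (3 + y) ^ 2 :=
          le_mul_of_one_le_right hKl (hl.trans hl2)
        have b4 : 0 ≤ A₀ * Real.log (3 + y) ^ 2 := by positivity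
        linarith

/-- Families all of whose coefficients are controlled by near vectors have subexponential
growth. -/
theorem GrowthQ.of_shrinkQ (n : ℕ) : ∀ c : MatQ (n + 1) → ℂ, SuppQ c → SymQ c → ShrinkQ c →
    GrowthQ c := by
  induction n with
  | zero =>
    intro c h1 h2 h3
    refine GrowthQ.of_siegelPhi h1 h2 h3 ⟨‖siegelPhi c 0‖, norm_nonneg _, fun t _ => ?_⟩
    have ht : t = 0 := Subsingleton.elim _ _
    subst ht
    have h4 := one_le_log_three_add (le_refl (0 : ℝ))
    simp only [Matrix.trace_zero, Rat.cast_zero]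
    have h5 : ‖siegelPhi c 0‖ ≤ ‖siegelPhi c 0‖ * Real.log (3 + 0) ^ 2 :=
      le_mul_of_one_le_right (norm_nonneg _) (one_le_pow₀ h4)
    linarith [Real.add_one_le_exp (‖siegelPhi c 0‖ * Real.log (3 + 0) ^ 2)]
  | succ n ih =>
    intro c h1 h2 h3
    exact GrowthQ.of_siegelPhi h1 h2 h3 (ih _ h1.siegelPhi h2.siegelPhi (h3.siegelPhi h1 h2))

end GrowthMain

section FourierBound

/-- `e(z) = exp(2πiz)`. -/
def ee (z : ℂ) : ℂ := Complex.exp (2 * (Real.pi : ℂ) * Complex.I * z)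

theorem ee_add (z w : ℂ) : ee (z + w) = ee z * ee w := by
  rw [ee, mul_add, Complex.exp_add]; rfl

theorem ee_neg (z : ℂ) : ee (-z) = (ee z)⁻¹ := by
  rw [ee, mul_neg, Complex.exp_neg]; rfl

theorem ee_zero : ee 0 = 1 := by simp [ee]

theorem ee_ne_zero (z : ℂ) : ee z ≠ 0 := Complex.exp_ne_zero _

theorem ee_int (n : ℤ) : ee n = 1 := by
  rw [ee, mul_comm]; exact Complex.exp_int_mul_two_pi_mul_I n

theorem norm_ee (z : ℂ) : ‖ee z‖ = Real.exp (-(2 * Real.pi * z.im)) := by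
  rw [ee, Complex.norm_exp]
  congr 1
  simp

theorem norm_ee_real (x : ℝ) : ‖ee x‖ = 1 := by simp [norm_ee]

theorem mFourier_coe {κ : Type*} [Fintype κ] (n : κ → ℤ) (x : κ → ℝ) :
    UnitAddTorus.mFourier n (fun i => ((x i : ℝ) : UnitAddCircle)) =
      ee (∑ i, (n i : ℂ) * (x i : ℂ)) := by
  rw [ee, Finset.mul_sum, Complex.exp_sum]
  refine Finset.prod_congr rfl fun i _ => ?_
  rw [fourier_coe_apply]
  congr 1
  simp
  ring

/-- The Haar probability measure on a torus. -/
def torusMeasure (κ : Type*) [Fintype κ] : MeasureTheory.Measure (UnitAddTorus κ) :=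
  MeasureTheory.Measure.pi fun _ : κ => AddCircle.haarAddCircle (T := 1)

instance (κ : Type*) [Fintype κ] : MeasureTheory.IsProbabilityMeasure (torusMeasure κ) := by
  unfold torusMeasure; infer_instance

theorem integral_mFourier {κ : Type*} [Fintype κ] (n : κ → ℤ) :
    ∫ x : UnitAddTorus κ, UnitAddTorus.mFourier n x ∂(torusMeasure κ) = if n = 0 then 1 else 0 := by
  have h := orthonormal_iff_ite.mp (UnitAddTorus.orthonormal_mFourier (d := κ)) 0 n
  simp only [UnitAddTorus.mFourierLp, MeasureTheory.ContinuousMap.inner_toLp, ← UnitAddTorus.mFourier_neg,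
    ← UnitAddTorus.mFourier_add, neg_zero, add_zero] at h
  refine Eq.trans h ?_
  simp [eq_comm]

/-- The coefficients of a bounded absolutely convergent trigonometric series are bounded. -/
theorem norm_fourier_coeff_le {ι κ : Type*} [Countable ι] [Fintype κ] [DecidableEq (κ → ℤ)] {b : ι → ℂ}
    (hb : Summable b) (N : ι → κ → ℤ) {M : ℝ}
    (hM : ∀ x : κ → ℝ, ‖∑' j, b j * ee (∑ i, (N j i : ℂ) * (x i : ℂ))‖ ≤ M) (n : κ → ℤ) :
    ‖∑' j, if N j = n then b j else 0‖ ≤ M := by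
  have hn : ∀ m : κ → ℤ, ∀ x, ‖UnitAddTorus.mFourier m x‖ ≤ 1 := fun m x => by
    exact (ContinuousMap.norm_coe_le_norm _ _).trans UnitAddTorus.mFourier_norm.le
  have hInt : ∀ m : κ → ℤ, MeasureTheory.Integrable
      (fun x : UnitAddTorus κ => UnitAddTorus.mFourier m x) (torusMeasure κ) := fun m =>
    (UnitAddTorus.mFourier m).continuous.integrable_of_hasCompactSupport
      (HasCompactSupport.of_compactSpace _)
  have key : HasSum (fun j => ∫ x : UnitAddTorus κ, b j * UnitAddTorus.mFourier (N j + -n) x ∂(torusMeasure κ))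
      (∫ x : UnitAddTorus κ, ∑' j, b j * UnitAddTorus.mFourier (N j + -n) x ∂(torusMeasure κ)) := by
    refine MeasureTheory.hasSum_integral_of_summable_integral_norm
      (fun j => (hInt _).const_mul _) ?_
    refine Summable.of_nonneg_of_le (fun j => MeasureTheory.integral_nonneg fun x => norm_nonneg _)
      (fun j => ?_) hb.norm
    calc ∫ x : UnitAddTorus κ, ‖b j * UnitAddTorus.mFourier (N j + -n) x‖ ∂(torusMeasure κ)
        ≤ ∫ x : UnitAddTorus κ, ‖b j‖ ∂(torusMeasure κ) := by
          refine MeasureTheory.integral_mono ((hInt _).const_mul _).norm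
            (MeasureTheory.integrable_const _) fun x => ?_
          rw [norm_mul]
          exact mul_le_of_le_one_right (norm_nonneg _) (hn _ _)
      _ = ‖b j‖ := by simp
  have h1 : (fun j => ∫ x : UnitAddTorus κ, b j * UnitAddTorus.mFourier (N j + -n) x ∂(torusMeasure κ)) =
      fun j => if N j = n then b j else 0 := by
    funext j
    rw [MeasureTheory.integral_const_mul, integral_mFourier]
    simp [← sub_eq_add_neg, sub_eq_zero]
  rw [h1] at key
  rw [key.tsum_eq]
  refine (MeasureTheory.norm_integral_le_of_norm_le_const (C := M)
    (Filter.Eventually.of_forall fun x => ?_)).trans (by simp)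
  obtain ⟨y, rfl⟩ : ∃ y : κ → ℝ, (fun i => ((y i : ℝ) : UnitAddCircle)) = x :=
    ⟨fun i => (QuotientAddGroup.mk_surjective (x i)).choose,
      funext fun i => (QuotientAddGroup.mk_surjective (x i)).choose_spec⟩
  simp only [UnitAddTorus.mFourier_add, ← mul_assoc]
  rw [tsum_mul_right, norm_mul]
  have := hM y
  simp_rw [← mFourier_coe] at this
  exact (mul_le_of_le_one_right (norm_nonneg _) (hn _ _)).trans this

end FourierBound

section InversionMap

variable {n : ℕ}

theorem posDef_iff_qf {ι : Type*} [Fintype ι] {M : Matrix ι ι ℝ} :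
    M.PosDef ↔ M.IsSymm ∧ ∀ v, v ≠ 0 → 0 < qf M v := by
  rw [Matrix.posDef_iff_dotProduct_mulVec]
  simp only [Matrix.IsHermitian, Matrix.IsSymm, conjTranspose_eq_transpose_of_trivial,
    star_trivial]
  rfl

theorem posDef_iff_schur {M : Matrix (Fin (n + 1)) (Fin (n + 1)) ℝ} (hM : M.IsSymm) :
    M.PosDef ↔ 0 < M 0 0 ∧ (schur M).PosDef := by
  rw [posDef_iff_qf, posDef_iff_qf]
  constructor
  · rintro ⟨-, h⟩
    have h0 : 0 < M 0 0 := by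
      rw [← qf_single M 0]; exact h _ (by simp)
    refine ⟨h0, schur_isSymm hM, fun v hv => ?_⟩
    have := h (Fin.cons (-((∑ i, M 0 i.succ * v i) / M 0 0)) v) (fun he => hv (by
      funext i; simpa using congrFun he i.succ))
    rw [qf_schur hM h0.ne'] at this
    simpa using this
  · rintro ⟨h0, -, h⟩
    refine ⟨hM, fun v hv => ?_⟩
    rw [← Fin.cons_self_tail v, qf_schur hM h0.ne']
    by_cases ht : Fin.tail v = 0
    · have : v 0 ≠ 0 := fun h00 => hv (by
        rw [← Fin.cons_self_tail v, ht, h00]; funext i; refine Fin.cases ?_ ?_ i <;> simp)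
      rw [ht]
      simp only [qf, Pi.zero_apply, mul_zero, Finset.sum_const_zero, zero_div, add_zero,
        mulVec_zero, dotProduct_zero]
      positivity
    · have := h _ ht
      have := mul_nonneg h0.le (sq_nonneg (v 0 + (∑ i, M 0 i.succ * Fin.tail v i) / M 0 0))
      linarith

/-- The partial inversion `τ₀₀ ↦ -1/τ₀₀` of the Siegel upper half space. -/
def sAct (τ : MatC (n + 1)) : MatC (n + 1) :=
  Matrix.of (Fin.cons (Fin.cons (-1 / τ 0 0) fun j => τ 0 j.succ / τ 0 0)
    fun i => Fin.cons (τ i.succ 0 / τ 0 0)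
      fun j => τ i.succ j.succ - τ i.succ 0 * τ 0 j.succ / τ 0 0)

theorem sAct_zero_zero (τ : MatC (n + 1)) : sAct τ 0 0 = -1 / τ 0 0 := rfl
theorem sAct_zero_succ (τ : MatC (n + 1)) (j : Fin n) : sAct τ 0 j.succ = τ 0 j.succ / τ 0 0 := rfl
theorem sAct_succ_zero (τ : MatC (n + 1)) (i : Fin n) : sAct τ i.succ 0 = τ i.succ 0 / τ 0 0 := rfl
theorem sAct_succ_succ (τ : MatC (n + 1)) (i j : Fin n) :
    sAct τ i.succ j.succ = τ i.succ j.succ - τ i.succ 0 * τ 0 j.succ / τ 0 0 := rfl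

theorem sAct_isSymm {τ : MatC (n + 1)} (h : τ.IsSymm) : (sAct τ).IsSymm := by
  have h' : ∀ i j, τ i j = τ j i := fun i j => h.apply j i
  refine Matrix.IsSymm.ext fun i j => ?_
  refine Fin.cases ?_ (fun i => ?_) i <;> refine Fin.cases ?_ (fun j => ?_) j
  · rfl
  · rw [sAct_succ_zero, sAct_zero_succ, h']
  · rw [sAct_succ_zero, sAct_zero_succ, h']
  · rw [sAct_succ_succ, sAct_succ_succ, h' i.succ j.succ, h' i.succ 0, h' 0 j.succ]; ring

theorem im_pos_of_mem_Sieg {τ : MatC (n + 1)} (h : τ ∈ Sieg (n + 1)) (i : Fin (n + 1)) :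
    0 < (τ i i).im := by
  have := (posDef_iff_qf.mp h.2).2 (Pi.single i 1) (by simp)
  rwa [qf_single] at this

theorem ne_zero_of_im_pos {w : ℂ} (h : 0 < w.im) : w ≠ 0 := by
  rintro rfl; simp at h

theorem neg_one_div_im (w : ℂ) : (-1 / w).im = w.im / Complex.normSq w := by
  simp [neg_div]

theorem map_im_isSymm {τ : MatC n} (h : τ.IsSymm) : (τ.map Complex.im).IsSymm := by
  rw [Matrix.IsSymm, ← Matrix.transpose_map, h.eq]

theorem schur_im_sAct {τ : MatC (n + 1)} (h : 0 < (τ 0 0).im) :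
    schur ((sAct τ).map Complex.im) = schur (τ.map Complex.im) := by
  ext i j
  simp only [schur, Matrix.of_apply, Matrix.map_apply, sAct_zero_zero, sAct_zero_succ,
    sAct_succ_zero, sAct_succ_succ]
  have hw := ne_zero_of_im_pos h
  set w := τ 0 0
  have hn : Complex.normSq w ≠ 0 := by simpa using hw
  rw [neg_one_div_im]
  simp only [Complex.sub_im, Complex.div_im, Complex.mul_im, Complex.mul_re]
  have h0 := h.ne'
  rw [Complex.normSq_apply] at hn ⊢
  field_simp
  ring

theorem sAct_mem_Sieg {τ : MatC (n + 1)} (h : τ ∈ Sieg (n + 1)) : sAct τ ∈ Sieg (n + 1) := by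
  have h0 := im_pos_of_mem_Sieg h 0
  refine ⟨sAct_isSymm h.1, ?_⟩
  rw [posDef_iff_schur (map_im_isSymm (sAct_isSymm h.1)), schur_im_sAct h0]
  refine ⟨?_, ((posDef_iff_schur (map_im_isSymm h.1)).mp h.2).2⟩
  have hn : 0 < Complex.normSq (τ 0 0) := Complex.normSq_pos.mpr (ne_zero_of_im_pos h0)
  rw [Matrix.map_apply, sAct_zero_zero, neg_one_div_im]
  positivity

/-- The symplectic matrix inducing the partial inversion. -/
def sGen (n : ℕ) : Matrix (Fin (n + 1) ⊕ Fin (n + 1)) (Fin (n + 1) ⊕ Fin (n + 1)) ℤ :=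
  Matrix.fromBlocks (1 - Matrix.single 0 0 1) (-Matrix.single 0 0 1) (Matrix.single 0 0 1)
    (1 - Matrix.single 0 0 1)

theorem sGen_mem : sGen n ∈ SpZ (n + 1) := by
  simp only [SpZ, Set.mem_ofPred_eq, sGen, sympJ, fromBlocks_transpose, fromBlocks_multiply]
  have h : (Matrix.single 0 0 1 : Matrix (Fin (n + 1)) (Fin (n + 1)) ℤ) * Matrix.single 0 0 1
    = Matrix.single 0 0 1 := by simp
  congr 1 <;> simp [mul_sub, sub_mul, h]; abel

theorem jmat_sGen (τ : MatC (n + 1)) :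
    jmat (sGen n) τ = Matrix.updateRow 1 0 (τ 0) := by
  ext i j
  simp only [jmat, blkC, blkD, sGen, Matrix.add_apply, Matrix.mul_apply, Matrix.of_apply,
    fromBlocks_apply₂₁, fromBlocks_apply₂₂, Matrix.sub_apply, Matrix.single_apply, Matrix.one_apply]
  refine Fin.cases ?_ (fun i => ?_) i
  · simp
  · simp [Fin.succ_ne_zero, (Fin.succ_ne_zero _).symm, Matrix.one_apply, Matrix.updateRow_ne]

theorem jden_sGen (τ : MatC (n + 1)) : jden (sGen n) τ = τ 0 0 := by
  rw [jden, jmat_sGen, Matrix.det_of_isUpperTriangular]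
  · rw [Fin.prod_univ_succ]
    simp [Matrix.updateRow_ne]
  · intro i j hij
    have : i ≠ 0 := fun h => by subst h; exact absurd hij (by simp)
    rw [Matrix.updateRow_ne this]
    exact Matrix.one_apply_ne (ne_of_gt hij)

theorem actSp_sGen {τ : MatC (n + 1)} (h : τ 0 0 ≠ 0) : actSp (sGen n) τ = sAct τ := by
  have hu : IsUnit (jmat (sGen n) τ).det := by
    have := jden_sGen τ
    rw [jden] at this
    rw [this]; exact h.isUnit
  rw [actSp]
  rw [show blkA (sGen n) * τ + blkB (sGen n) = sAct τ * jmat (sGen n) τ from ?_,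
    Matrix.mul_nonsing_inv_cancel_right _ _ hu]
  rw [jmat_sGen]
  ext i j
  simp only [blkA, blkB, sGen, Matrix.add_apply, Matrix.mul_apply, Matrix.of_apply,
    fromBlocks_apply₁₁, fromBlocks_apply₁₂, Matrix.sub_apply, Matrix.single_apply, Matrix.one_apply,
    Matrix.neg_apply]
  refine Fin.cases ?_ (fun i => ?_) i <;> refine Fin.cases ?_ (fun j => ?_) j <;>
  simp [Fin.sum_univ_succ, sAct_zero_zero, sAct_zero_succ, sAct_succ_zero, sAct_succ_succ,
    (Fin.succ_ne_zero _).symm, Matrix.updateRow_ne, Matrix.one_apply, Fin.succ_ne_zero] <;>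
  field_simp <;> try ring

end InversionMap

section FourierJacobi

variable {n : ℕ}

theorem blkQ_castSucc_castSucc {h : ℕ} (N : MatQ h) (r : MatRQ h 1) (m : MatQ 1) (i j : Fin h) :
    blkQ h 1 N r m i.castSucc j.castSucc = N i j := by
  simp only [blkQ, Matrix.reindex_apply, Matrix.submatrix_apply]
  have : ∀ i : Fin h, finSumFinEquiv.symm (i.castSucc : Fin (h + 1)) = Sum.inl i := fun i =>
    finSumFinEquiv_symm_apply_castAdd i
  rw [this, this, fromBlocks_apply₁₁]

theorem blkQ_castSucc_last {h : ℕ} (N : MatQ h) (r : MatRQ h 1) (m : MatQ 1) (i : Fin h) :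
    blkQ h 1 N r m i.castSucc (Fin.last h) = 1 / 2 * r i 0 := by
  simp only [blkQ, Matrix.reindex_apply, Matrix.submatrix_apply]
  have : ∀ i : Fin h, finSumFinEquiv.symm (i.castSucc : Fin (h + 1)) = Sum.inl i := fun i =>
    finSumFinEquiv_symm_apply_castAdd i
  have h2 : finSumFinEquiv.symm (Fin.last h : Fin (h + 1)) = Sum.inr 0 :=
    finSumFinEquiv_symm_apply_natAdd (m := h) (0 : Fin 1)
  rw [this, h2, fromBlocks_apply₁₂]
  simp

theorem blkQ_last_castSucc {h : ℕ} (N : MatQ h) (r : MatRQ h 1) (m : MatQ 1) (i : Fin h) :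
    blkQ h 1 N r m (Fin.last h) i.castSucc = 1 / 2 * r i 0 := by
  simp only [blkQ, Matrix.reindex_apply, Matrix.submatrix_apply]
  have : ∀ i : Fin h, finSumFinEquiv.symm (i.castSucc : Fin (h + 1)) = Sum.inl i := fun i =>
    finSumFinEquiv_symm_apply_castAdd i
  have h2 : finSumFinEquiv.symm (Fin.last h : Fin (h + 1)) = Sum.inr 0 :=
    finSumFinEquiv_symm_apply_natAdd (m := h) (0 : Fin 1)
  rw [this, h2, fromBlocks_apply₂₁]
  simp

theorem blkQ_last_last {h : ℕ} (N : MatQ h) (r : MatRQ h 1) (m : MatQ 1) :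
    blkQ h 1 N r m (Fin.last h) (Fin.last h) = m 0 0 := by
  simp only [blkQ, Matrix.reindex_apply, Matrix.submatrix_apply]
  have h2 : finSumFinEquiv.symm (Fin.last h : Fin (h + 1)) = Sum.inr 0 :=
    finSumFinEquiv_symm_apply_natAdd (m := h) (0 : Fin 1)
  rw [h2, fromBlocks_apply₂₂]

theorem eMat_eq_ee {g : ℕ} (t : MatQ g) (τ : MatC g) :
    eMat t τ = ee (∑ i, ∑ j, (t i j : ℂ) * τ j i) := by
  rw [eMat, ee]
  congr 2

theorem eMat_blkQ {h : ℕ} (N : MatQ h) (r : MatRQ h 1) (m : MatQ 1) {τ : MatC (h + 1)}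
    (hτ : τ.IsSymm) :
    eMat (blkQ h 1 N r m) τ =
      ee (((N.map fun q => (q : ℂ)) * τ.submatrix Fin.castSucc Fin.castSucc).trace
        + ((r.map fun q => (q : ℂ))ᵀ *
          (Matrix.of fun (i : Fin h) (_ : Fin 1) => τ i.castSucc (Fin.last h))).trace)
      * ee (m 0 0 * τ (Fin.last h) (Fin.last h)) := by
  rw [eMat_eq_ee, ← ee_add]
  congr 1
  have hs : ∀ i, τ (Fin.last h) i = τ i (Fin.last h) := fun i => hτ.apply _ _
  simp only [Fin.sum_univ_castSucc, blkQ_castSucc_castSucc, blkQ_castSucc_last,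
    blkQ_last_castSucc, blkQ_last_last, Finset.sum_add_distrib, hs]
  simp only [Matrix.trace, Matrix.diag_apply, Matrix.mul_apply, Matrix.map_apply,
    Matrix.transpose_apply, Matrix.of_apply, Matrix.submatrix_apply]
  have : ∑ i : Fin h, ((1 / 2 * r i 0 : ℚ) : ℂ) * τ i.castSucc (Fin.last h) =
      1 / 2 * ∑ i : Fin h, (r i 0 : ℂ) * τ i.castSucc (Fin.last h) := by
    rw [Finset.mul_sum]
    refine Finset.sum_congr rfl fun i _ => ?_
    push_cast; ring
  rw [this]
  simp
  ring

theorem jacobi_argument {h : ℕ} {τ : MatC (n + 1)} (h0 : τ 0 0 ≠ 0) (z : MatRC (n + 1) h) :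
    ((jmat (sGen n) τ)⁻¹)ᵀ * z = Matrix.of (Fin.cons (fun a => z 0 a / τ 0 0)
      fun i a => z i.succ a - τ 0 i.succ * z 0 a / τ 0 0) := by
  have hu : IsUnit (jmat (sGen n) τ)ᵀ.det := by
    have := jden_sGen τ
    rw [jden] at this
    rw [det_transpose, this]; exact h0.isUnit
  rw [Matrix.transpose_nonsing_inv]
  have : z = (jmat (sGen n) τ)ᵀ * Matrix.of (Fin.cons (fun a => z 0 a / τ 0 0)
      fun i a => z i.succ a - τ 0 i.succ * z 0 a / τ 0 0) := by
    rw [jmat_sGen]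
    ext i a
    simp only [Matrix.mul_apply, Matrix.transpose_apply, Fin.sum_univ_succ, Matrix.of_apply,
      Fin.cons_zero, Fin.cons_succ, Matrix.updateRow_self]
    refine Fin.cases ?_ (fun i => ?_) i
    · simp [Matrix.updateRow_ne, Fin.succ_ne_zero]
      field_simp
    · simp [Matrix.updateRow_ne, Fin.succ_ne_zero, Matrix.one_apply]
      ring
  conv_lhs => rw [this]
  rw [Matrix.nonsing_inv_mul_cancel_left _ _ hu]

theorem jacobi_cocycle {τ : MatC (n + 1)} (h0 : τ 0 0 ≠ 0) (z : MatRC (n + 1) 1) (m : MatQ 1) :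
    ((m.map fun q => (q : ℂ)) *
            (zᵀ * ((jmat (sGen n) τ)⁻¹ * (blkC (sGen n) * z)))).trace
      = m 0 0 * (z 0 0 ^ 2 / τ 0 0) := by
  have e1 : zᵀ * ((jmat (sGen n) τ)⁻¹ * (blkC (sGen n) * z)) =
      (((jmat (sGen n) τ)⁻¹)ᵀ * z)ᵀ * (blkC (sGen n) * z) := by
    rw [transpose_mul, transpose_transpose, Matrix.mul_assoc]
  have e2 : blkC (sGen n) * z = Matrix.of (Fin.cons (z 0) fun _ => 0) := by
    ext i a
    simp only [blkC, sGen, Matrix.mul_apply, Matrix.of_apply, fromBlocks_apply₂₁,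
      Matrix.single_apply]
    refine Fin.cases ?_ (fun i => ?_) i
    · simp
    · simp [(Fin.succ_ne_zero _).symm]
  rw [e1, jacobi_argument h0, e2]
  simp [Matrix.trace, Matrix.mul_apply, Fin.sum_univ_succ]
  left
  ring

end FourierJacobi

section FourierJacobiSum

variable {n : ℕ}

theorem blkQ_injective {h : ℕ} (m : MatQ 1) :
    Function.Injective fun nr : MatQ h × MatRQ h 1 => blkQ h 1 nr.1 nr.2 m := by
  rintro ⟨N, r⟩ ⟨N', r'⟩ he
  have he' : blkQ h 1 N r m = blkQ h 1 N' r' m := he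
  have h1 : N = N' := by
    ext i j
    rw [← blkQ_castSucc_castSucc N r m, he', blkQ_castSucc_castSucc]
  have h2 : r = r' := by
    ext i a
    have := congrFun (congrFun he' i.castSucc) (Fin.last h)
    rw [blkQ_castSucc_last, blkQ_castSucc_last] at this
    rw [Subsingleton.elim a 0]
    linarith
  rw [h1, h2]

theorem exists_blkQ_eq {h : ℕ} {t : MatQ (h + 1)} (ht : t.IsSymm) {m : MatQ 1}
    (hm : t (Fin.last h) (Fin.last h) = m 0 0) :
    ∃ nr : MatQ h × MatRQ h 1, blkQ h 1 nr.1 nr.2 m = t := by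
  refine ⟨⟨t.submatrix Fin.castSucc Fin.castSucc,
    Matrix.of fun (i : Fin h) _ => 2 * t i.castSucc (Fin.last h)⟩, ?_⟩
  ext i j
  refine Fin.lastCases ?_ (fun i => ?_) i <;> refine Fin.lastCases ?_ (fun j => ?_) j
  · rw [blkQ_last_last, hm]
  · rw [blkQ_last_castSucc, ht.apply j.castSucc (Fin.last h)]
    change 1 / 2 * (2 * t j.castSucc (Fin.last h)) = _
    ring
  · rw [blkQ_castSucc_last]
    change 1 / 2 * (2 * t i.castSucc (Fin.last h)) = _
    ring
  · rw [blkQ_castSucc_castSucc]; rfl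

/-- The Fourier–Jacobi slices converge, and satisfy the inversion law. -/
theorem IsSymFM.slice {k : ℤ} {c : MatQ (n + 1 + 1) → ℂ} (hc : IsSymFM (n + 1) 1 k c) (m : ℚ) :
    ∃ Φ : MatC (n + 1 + 1) → ℂ, ∀ τ : MatC (n + 1 + 1), τ.IsSymm →
      τ.submatrix Fin.castSucc Fin.castSucc ∈ Sieg (n + 1) →
      HasSum (fun t => (if t (Fin.last _) (Fin.last _) = m then c t else 0) * eMat t τ) (Φ τ) ∧
      Φ (sAct τ) = τ 0 0 ^ k * Φ τ := by
  by_cases hm : ∃ t, c t ≠ 0 ∧ t (Fin.last _) (Fin.last _) = m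
  swap
  · refine ⟨fun _ => 0, fun τ _ _ => ⟨?_, by simp⟩⟩
    convert! hasSum_zero with t
    by_cases h : t (Fin.last _) (Fin.last _) = m
    · have : c t = 0 := by by_contra h'; exact hm ⟨t, h', h⟩
      simp [this]
    · simp [h]
  obtain ⟨t₀, ht₀, hm⟩ := hm
  obtain ⟨hh₀, hp₀⟩ := hc.1 t₀ ht₀
  set M : MatQ 1 := Matrix.of fun _ _ => m with hM
  have hMh : HalfIntegral M := by
    obtain ⟨z, hz⟩ := hh₀.2.2 (Fin.last _)
    rw [hm] at hz
    exact ⟨Matrix.IsSymm.ext fun i j => rfl, fun i j => ⟨2 * z, by simp [hM, hz]⟩,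
      fun i => ⟨z, by simp [hM, hz]⟩⟩
  have hMp : PosSemidefQ M := by
    intro v
    have h1 : 0 ≤ m := hm ▸ diag_nonneg (t := t₀) hp₀ _
    simp [hM, dotProduct, Matrix.mulVec]
    nlinarith [mul_nonneg h1 (mul_self_nonneg (v 0))]
  obtain ⟨φ, hφ⟩ := hc.2.2 M hMh hMp
  let z : MatC (n + 1 + 1) → MatRC (n + 1) 1 := fun τ =>
    Matrix.of fun (i : Fin (n + 1)) (_ : Fin 1) => τ i.castSucc (Fin.last _)
  let τ₁ : MatC (n + 1 + 1) → MatC (n + 1) := fun τ => τ.submatrix Fin.castSucc Fin.castSucc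
  refine ⟨fun τ => φ.toFun (τ₁ τ, z τ) * ee (m * τ (Fin.last _) (Fin.last _)), fun τ hs hτ => ?_⟩
  constructor
  · have h1 := (φ.expansion (τ₁ τ, z τ) hτ).mul_right (ee (m * τ (Fin.last _) (Fin.last _)))
    rw [← (blkQ_injective M).hasSum_iff] 
    · convert! h1 using 2 with nr
      rw [hφ]
      simp only [sliceCoeff, Function.comp]
      rw [blkQ_last_last, eMat_blkQ _ _ _ hs]
      simp only [hM, Matrix.of_apply, if_true, ← mul_assoc]
      rfl
    · intro t ht
      by_cases h : t (Fin.last _) (Fin.last _) = m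
      · by_cases h' : c t = 0
        · simp [h']
        · exact absurd (exists_blkQ_eq (hc.1 t h').1.1 (m := M) h) ht
      · simp [h]
  · have h0 : τ₁ τ 0 0 ≠ 0 := ne_zero_of_im_pos (im_pos_of_mem_Sieg hτ 0)
    have h1 := φ.transfSp (sGen n) sGen_mem (τ₁ τ, z τ) hτ
    rw [actSp_sGen h0, jden_sGen, jacobi_argument h0, jacobi_cocycle h0] at h1
    have e1 : τ₁ (sAct τ) = sAct (τ₁ τ) := by
      ext i j
      refine Fin.cases ?_ (fun i => ?_) i <;> refine Fin.cases ?_ (fun j => ?_) j <;> rfl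
    have e2 : z (sAct τ) = Matrix.of (Fin.cons (fun a => z τ 0 a / τ₁ τ 0 0)
      fun i a => z τ i.succ a - τ₁ τ 0 i.succ * z τ 0 a / τ₁ τ 0 0) := by
      ext i a
      refine Fin.cases ?_ (fun i => ?_) i
      · rfl
      · change τ i.castSucc.succ (Fin.last _) - τ i.castSucc.succ 0 * τ 0 (Fin.last _) / τ 0 0 =
          τ i.castSucc.succ (Fin.last _) - τ 0 i.castSucc.succ * τ 0 (Fin.last _) / τ 0 0
        rw [hs.apply 0 i.castSucc.succ]
    have e3 : sAct τ (Fin.last _) (Fin.last _) =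
        τ (Fin.last _) (Fin.last _) - z τ 0 0 ^ 2 / τ₁ τ 0 0 := by
      change τ (Fin.last _) (Fin.last _) - τ (Fin.last _) 0 * τ 0 (Fin.last _) / τ 0 0 = _
      rw [hs.apply 0 (Fin.last _), sq]
      rfl
    simp only [e1, e2, h1, e3]
    rw [mul_sub, sub_eq_add_neg, ee_add, ee_neg]
    have e4 : Complex.exp (2 * (Real.pi : ℂ) * Complex.I * (M 0 0 * (z τ 0 0 ^ 2 / τ₁ τ 0 0))) =
      ee (m * (z τ 0 0 ^ 2 / τ₁ τ 0 0)) := rfl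
    rw [e4]
    have h2 := ee_ne_zero (m * (z τ 0 0 ^ 2 / τ₁ τ 0 0))
    have e5 : τ₁ τ 0 0 = τ 0 0 := rfl
    generalize ee (m * (z τ 0 0 ^ 2 / τ₁ τ 0 0)) = E at h2 ⊢
    rw [← e5]
    field_simp

end FourierJacobiSum

section LowSlice

variable {n : ℕ}

theorem eMat_add {g : ℕ} (t : MatQ g) (τ τ' : MatC g) :
    eMat t (τ + τ') = eMat t τ * eMat t τ' := by
  simp only [eMat_eq_ee, ← ee_add, Matrix.add_apply, mul_add, Finset.sum_add_distrib]

/-- The real symmetric shift `x + xᵀ` of the lower block. -/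
def lowShift (x : Fin n × Fin n → ℝ) : MatC (n + 1) :=
  Matrix.of (Fin.cons 0 fun i => Fin.cons 0 fun j => ((x (i, j) + x (j, i) : ℝ) : ℂ))

@[simp] theorem lowShift_zero (x : Fin n × Fin n → ℝ) (j) : lowShift x 0 j = 0 := rfl
@[simp] theorem lowShift_succ_zero (x : Fin n × Fin n → ℝ) (i) :
    lowShift x (Fin.succ i) 0 = 0 := rfl
@[simp] theorem lowShift_succ_succ (x : Fin n × Fin n → ℝ) (i j) :
    lowShift x (Fin.succ i) (Fin.succ j) = ((x (i, j) + x (j, i) : ℝ) : ℂ) := rfl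

theorem lowShift_isSymm (x : Fin n × Fin n → ℝ) : (lowShift x).IsSymm := by
  refine Matrix.IsSymm.ext fun i j => ?_
  refine Fin.cases ?_ (fun i => ?_) i <;> refine Fin.cases ?_ (fun j => ?_) j <;> simp [add_comm]

theorem lowShift_im (x : Fin n × Fin n → ℝ) (i j) : (lowShift x i j).im = 0 := by
  refine Fin.cases ?_ (fun i => ?_) i <;> refine Fin.cases ?_ (fun j => ?_) j <;> rfl

theorem sAct_add_lowShift (τ : MatC (n + 1)) (x : Fin n × Fin n → ℝ) :
    sAct (τ + lowShift x) = sAct τ + lowShift x := by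
  ext i j
  refine Fin.cases ?_ (fun i => ?_) i <;> refine Fin.cases ?_ (fun j => ?_) j <;>
    simp only [Matrix.add_apply, sAct_zero_zero, sAct_zero_succ, sAct_succ_zero, sAct_succ_succ,
      lowShift_zero, lowShift_succ_zero, lowShift_succ_succ, add_zero]
  ring

theorem eMat_lowShift {t : MatQ (n + 1)} (ht : t.IsSymm) (x : Fin n × Fin n → ℝ) :
    eMat t (lowShift x) = ee (∑ p : Fin n × Fin n, (2 * low t p.1 p.2 : ℂ) * (x p : ℂ)) := by
  rw [eMat_eq_ee, Fintype.sum_prod_type]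
  congr 1
  simp only [Fin.sum_univ_succ, lowShift_zero, lowShift_succ_zero, lowShift_succ_succ, mul_zero,
    zero_add, Finset.sum_const_zero, Complex.ofReal_add, mul_add, Finset.sum_add_distrib, low,
    Matrix.submatrix_apply]
  rw [Finset.sum_comm (f := fun (i j : Fin n) => (t i.succ j.succ : ℂ) * (x (j, i) : ℂ)),
    ← Finset.sum_add_distrib]
  refine Finset.sum_congr rfl fun i _ => ?_
  rw [← Finset.sum_add_distrib]
  refine Finset.sum_congr rfl fun j _ => ?_
  rw [ht.apply i.succ j.succ]
  ring

theorem submatrix_castSucc_sAct (τ : MatC (n + 1 + 1)) :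
    (sAct τ).submatrix Fin.castSucc Fin.castSucc = sAct (τ.submatrix Fin.castSucc Fin.castSucc) := by
  ext i j
  refine Fin.cases ?_ (fun i => ?_) i <;> refine Fin.cases ?_ (fun j => ?_) j <;> rfl

theorem Sieg_add_real {τ σ : MatC n} (hτ : τ ∈ Sieg n) (hσ : σ.IsSymm)
    (hi : ∀ i j, (σ i j).im = 0) : τ + σ ∈ Sieg n := by
  refine ⟨hτ.1.add hσ, ?_⟩
  have : (τ + σ).map Complex.im = τ.map Complex.im := by
    ext i j
    simp [hi]
  rw [this]
  exact hτ.2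

/-- The numerators of twice a half-integral matrix. -/
theorem HalfIntegral.floor_two_mul {t : MatQ n} (ht : HalfIntegral t) (i j : Fin n) :
    ((⌊2 * t i j⌋ : ℤ) : ℚ) = 2 * t i j := by
  obtain ⟨z, hz⟩ := ht.2.1 i j
  rw [hz, Int.floor_intCast]

/-- The part of the series with prescribed lower block converges and satisfies the inversion
law. -/
theorem IsSymFM.lowSlice {k : ℤ} {c : MatQ (n + 1 + 1) → ℂ} (hc : IsSymFM (n + 1) 1 k c)
    (T : MatQ (n + 1)) {τ : MatC (n + 1 + 1)} (hs : τ.IsSymm)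
    (hτ : τ.submatrix Fin.castSucc Fin.castSucc ∈ Sieg (n + 1)) :
    Summable (fun t => (if low t = T then c t else 0) * eMat t τ) ∧
    ∑' t, (if low t = T then c t else 0) * eMat t (sAct τ) =
      τ 0 0 ^ k * ∑' t, (if low t = T then c t else 0) * eMat t τ := by
  obtain ⟨Φ, hΦ⟩ := hc.slice (T (Fin.last n) (Fin.last n))
  have key : ∀ τ : MatC (n + 1 + 1), τ.IsSymm → τ.submatrix Fin.castSucc Fin.castSucc ∈ Sieg (n + 1) →
      Summable (fun t => (if low t = T then c t else 0) * eMat t τ) := by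
    intro τ hs hτ
    refine ((hΦ τ hs hτ).1.summable.indicator {t | low t = T}).congr fun t => ?_
    by_cases h : low t = T
    · have : t (Fin.last _) (Fin.last _) = T (Fin.last n) (Fin.last n) := by
        rw [← h]; rfl
      simp [Set.indicator, h, this]
    · simp [Set.indicator, h]
  refine ⟨key τ hs hτ, ?_⟩
  by_cases hT : ∃ t, c t ≠ 0 ∧ low t = T
  swap
  · have : ∀ t, (if low t = T then c t else 0) = 0 := by
      intro t
      by_cases h : low t = T
      · by_contra h'
        exact hT ⟨t, by simpa [h] using h', h⟩
      · simp [h]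
    simp [this]
  obtain ⟨t₀, ht₀, hT⟩ := hT
  have hTh : HalfIntegral T := hT ▸ (hc.1 t₀ ht₀).1.low
  set m := T (Fin.last n) (Fin.last n)
  have hs' : (sAct τ).IsSymm := sAct_isSymm hs
  have hτ' : (sAct τ).submatrix Fin.castSucc Fin.castSucc ∈ Sieg (n + 1) := by
    rw [submatrix_castSucc_sAct]; exact sAct_mem_Sieg hτ
  let N : MatQ (n + 1 + 1) → Fin (n + 1) × Fin (n + 1) → ℤ := fun t p => ⌊2 * low t p.1 p.2⌋
  let cm : MatQ (n + 1 + 1) → ℂ := fun t => if t (Fin.last _) (Fin.last _) = m then c t else 0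
  have hb : Summable fun t => cm t * (eMat t (sAct τ) - τ 0 0 ^ k * eMat t τ) := by
    refine ((hΦ _ hs' hτ').1.summable.sub ((hΦ _ hs hτ).1.summable.mul_left (τ 0 0 ^ k))).congr
      fun t => ?_
    simp only [cm]; ring
  have hM : ∀ x : Fin (n + 1) × Fin (n + 1) → ℝ,
      ‖∑' t, cm t * (eMat t (sAct τ) - τ 0 0 ^ k * eMat t τ) *
        ee (∑ p, (N t p : ℂ) * (x p : ℂ))‖ ≤ 0 := by
    intro x
    have hsx : (τ + lowShift x).IsSymm := hs.add (lowShift_isSymm x)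
    have hτx : (τ + lowShift x).submatrix Fin.castSucc Fin.castSucc ∈ Sieg (n + 1) :=
      Sieg_add_real (σ := (lowShift x).submatrix Fin.castSucc Fin.castSucc) hτ
        ((lowShift_isSymm x).submatrix _) fun i j => lowShift_im x i.castSucc j.castSucc
    obtain ⟨h1, h2⟩ := hΦ _ hsx hτx
    have h3 := (hΦ _ (sAct_isSymm hsx) (by
      rw [submatrix_castSucc_sAct]; exact sAct_mem_Sieg hτx)).1
    rw [h2, sAct_add_lowShift] at h3
    have h4 := h3.sub (h1.mul_left (τ 0 0 ^ k))
    have h00 : (τ + lowShift x) 0 0 = τ 0 0 := by simp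
    rw [h00, sub_self] at h4
    have h5 : (∑' t, cm t * (eMat t (sAct τ) - τ 0 0 ^ k * eMat t τ) *
        ee (∑ p, (N t p : ℂ) * (x p : ℂ))) = 0 := by
      refine HasSum.tsum_eq ?_
      convert! h4 using 2 with t
      by_cases hct : c t = 0
      · simp [cm, hct]
      have hth := (hc.1 t hct).1
      rw [eMat_add, eMat_add, eMat_lowShift hth.1]
      have : ∀ p, (N t p : ℂ) = 2 * ((low t p.1 p.2 : ℚ) : ℂ) := by
        intro p
        have := hth.low.floor_two_mul p.1 p.2
        exact_mod_cast congrArg (fun q : ℚ => (q : ℂ)) this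
      simp only [this, cm, m]
      ring
    rw [h5, norm_zero]
  classical
  have : Countable (MatQ (n + 1 + 1)) :=
    inferInstanceAs (Countable (Fin (n + 1 + 1) → Fin (n + 1 + 1) → ℚ))
  have h := norm_fourier_coeff_le hb N hM (fun p => ⌊2 * T p.1 p.2⌋)
  rw [norm_le_zero_iff] at h
  rw [← sub_eq_zero, ← tsum_mul_left, ← Summable.tsum_sub (key _ hs' hτ') ((key _ hs hτ).mul_left _)]
  refine Eq.trans (tsum_congr fun t => ?_) h
  by_cases hct : c t = 0
  · simp [cm, hct]
  have hth := (hc.1 t hct).1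
  have hiff : (N t = fun p => ⌊2 * T p.1 p.2⌋) ↔ low t = T := by
    constructor
    · intro h
      ext i j
      have h1 := congrArg (fun z : ℤ => (z : ℚ)) (congrFun h (i, j))
      simp only [N] at h1
      rw [hth.low.floor_two_mul, hTh.floor_two_mul] at h1
      linarith
    · rintro rfl; rfl
  by_cases hl : low t = T
  · have : t (Fin.last _) (Fin.last _) = m := by
      simp only [m]; rw [← hl]; rfl
    rw [if_pos (hiff.mpr hl), if_pos hl]
    simp only [cm, if_pos this]
    ring
  · rw [if_neg (fun h => hl (hiff.mp h)), if_neg hl]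
    ring

end LowSlice

section ExponentialDecay

theorem norm_mul_ee_real_mul (a : ℂ) (q : ℝ) (w : ℂ) :
    ‖a * ee (q * w)‖ = ‖a‖ * Real.exp (-(2 * Real.pi * q * w.im)) := by
  rw [norm_mul, norm_ee]
  congr 3
  rw [Complex.im_ofReal_mul]
  ring

/-- An exponential series with frequencies at least `B` which is bounded on a horizontal line
decays exponentially above it. -/
theorem norm_tsum_ee_le {ι : Type*} {d : ι → ℂ} {q : ι → ℝ} {B C : ℝ} (hB : 0 ≤ B)
    (hq : ∀ i, d i ≠ 0 → B ≤ q i)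
    (hs : Summable fun i => ‖d i‖ * Real.exp (-(2 * Real.pi * q i * (1 / 4))))
    (hC : ∀ w : ℂ, w.im = 1 / 2 → ‖∑' i, d i * ee (q i * w)‖ ≤ C) {w : ℂ} (hw : 1 / 2 ≤ w.im) :
    ‖∑' i, d i * ee (q i * w)‖ ≤ Real.exp (-(2 * Real.pi * B * (w.im - 1 / 2))) * C := by
  have hpi := Real.pi_pos
  have hle : ∀ (i : ι) (w : ℂ), 1 / 4 ≤ w.im →
      ‖d i * ee (q i * w)‖ ≤ ‖d i‖ * Real.exp (-(2 * Real.pi * q i * (1 / 4))) := by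
    intro i w hw
    by_cases hd : d i = 0
    · simp [hd]
    rw [norm_mul_ee_real_mul]
    have h1 : 0 ≤ q i := hB.trans (hq i hd)
    gcongr
  let W : ℂ → ℂ := fun z => Complex.I / 2 + Complex.I * z
  have hWim : ∀ z, (W z).im = 1 / 2 + z.re := fun z => by simp [W]
  let G : ℂ → ℂ := fun z => (∑' i, d i * ee (q i * W z)) * Complex.exp (2 * Real.pi * B * z)
  have hdiff : DifferentiableOn ℂ G {z | -(1 / 4) < z.re} := by
    refine DifferentiableOn.mul ?_ (by fun_prop)
    refine differentiableOn_tsum_of_summable_norm hs (fun i => ?_)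
      (isOpen_lt continuous_const Complex.continuous_re) fun i z hz => hle i _ ?_
    · unfold ee; simp only [W]; fun_prop
    · rw [hWim]; have : -(1 / 4) < z.re := hz
      linarith
  have hnG : ∀ z, ‖G z‖ = ‖∑' i, d i * ee (q i * W z)‖ * Real.exp (2 * Real.pi * B * z.re) := by
    intro z
    rw [norm_mul, Complex.norm_exp]
    congr 2
    simp [Complex.mul_re]
  have hbd : ∀ z : ℂ, 0 ≤ z.re →
      ‖G z‖ ≤ ∑' i, ‖d i‖ * Real.exp (-(2 * Real.pi * q i * (1 / 4))) := by
    intro z hz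
    have h1 : G z = ∑' i, d i * ee (q i * W z) * Complex.exp (2 * Real.pi * B * z) :=
      tsum_mul_right.symm
    rw [h1]
    refine tsum_of_norm_bounded hs.hasSum fun i => ?_
    by_cases hd : d i = 0
    · simp [hd]
    have h2 := hq i hd
    have h3 : (2 * Real.pi * B * z).re = 2 * Real.pi * B * z.re := by simp [Complex.mul_re]
    rw [norm_mul, norm_mul_ee_real_mul, Complex.norm_exp, h3, mul_assoc, ← Real.exp_add, hWim]
    refine mul_le_mul_of_nonneg_left (Real.exp_le_exp.mpr ?_) (norm_nonneg _)
    have h4 : 0 ≤ Real.pi * z.re * (q i - B) :=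
      mul_nonneg (mul_nonneg hpi.le hz) (sub_nonneg.mpr h2)
    have h5 : 0 ≤ Real.pi * q i := mul_nonneg hpi.le (hB.trans h2)
    nlinarith
  have hre : Filter.IsBoundedUnder (· ≤ ·) Filter.atTop fun x : ℝ => ‖G x‖ := by
    refine Filter.isBoundedUnder_of_eventually_le
      (a := ∑' i, ‖d i‖ * Real.exp (-(2 * Real.pi * q i * (1 / 4)))) ?_
    filter_upwards [Filter.eventually_ge_atTop 0] with x hx
    exact hbd x (by simpa using hx)
  have hexp : ∃ c < (2 : ℝ), ∃ B',
      G =O[Bornology.cobounded ℂ ⊓ Filter.principal {z | 0 < z.re}]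
        fun z => Real.exp (B' * ‖z‖ ^ c) := by
    refine ⟨1, by norm_num, 0, ?_⟩
    simp only [zero_mul, Real.exp_zero]
    refine Asymptotics.IsBigO.of_bound (∑' i, ‖d i‖ * Real.exp (-(2 * Real.pi * q i * (1 / 4))))
      (Filter.Eventually.filter_mono inf_le_right ?_)
    refine Filter.eventually_principal.mpr fun z hz => ?_
    simpa using hbd z (le_of_lt hz)
  have him : ∀ x : ℝ, ‖G (x * Complex.I)‖ ≤ C := by
    intro x
    have h0 : ((x : ℂ) * Complex.I).re = 0 := by simp
    rw [hnG, h0, mul_zero, Real.exp_zero, mul_one]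
    exact hC _ (by rw [hWim, h0, add_zero])
  have hdc : DiffContOnCl ℂ G {z | 0 < z.re} := by
    refine DifferentiableOn.diffContOnCl (hdiff.mono fun z hz => ?_)
    rw [Complex.closure_setOfPred_lt_re] at hz
    have : 0 ≤ z.re := hz
    show -(1 / 4) < z.re
    linarith
  have hz : 0 ≤ ((w - Complex.I / 2) / Complex.I).re := by
    simp only [Complex.div_I, Complex.neg_re, Complex.mul_re, Complex.I_re, Complex.I_im,
      Complex.sub_re, Complex.sub_im]
    simp
    linarith
  have hmain := PhragmenLindelof.right_half_plane_of_bounded_on_real hdc hexp hre him hz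
  have hWw : W ((w - Complex.I / 2) / Complex.I) = w := by
    simp only [W]
    field_simp
    ring
  have hzre : ((w - Complex.I / 2) / Complex.I).re = w.im - 1 / 2 := by
    have := hWim ((w - Complex.I / 2) / Complex.I)
    rw [hWw] at this
    linarith
  rw [hnG, hWw, hzre] at hmain
  rw [Real.exp_neg, inv_mul_eq_div, le_div_iff₀ (Real.exp_pos _)]
  exact hmain

end ExponentialDecay

section Theta

variable {n : ℕ}

/-- The part of a family with prescribed lower block. -/
def lowC (c : MatQ (n + 1) → ℂ) (T : MatQ n) : MatQ (n + 1) → ℂ := fun t => if low t = T then c t else 0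

/-- The value of `t` at `(1, α)`. -/
def heightQ (t : MatQ (n + 1)) (α : Fin n → ℝ) : ℝ := qf (toR t) (Fin.cons 1 α)

/-- The pairing of `β` with twice the first row of `t`. -/
def rowQ (t : MatQ (n + 1)) (β : Fin n → ℝ) : ℝ := 2 * ∑ j, (t 0 j.succ : ℝ) * β j

/-- The part of the series with given lower block, restricted to the elliptic curve fibre
with real coordinates `(α, β)` over `w`. -/
def fibreSum (c : MatQ (n + 1) → ℂ) (T : MatQ n) (w : ℂ) (α β : Fin n → ℝ) : ℂ :=
  ∑' t, lowC c T t * ee (rowQ t β) * ee (heightQ t α * w)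

theorem lowC_of_low {c : MatQ (n + 1) → ℂ} {T : MatQ n} {t : MatQ (n + 1)} (h : low t = T) :
    lowC c T t = c t := if_pos h

theorem lowC_ne_zero {c : MatQ (n + 1) → ℂ} {T : MatQ n} {t : MatQ (n + 1)} (h : lowC c T t ≠ 0) :
    low t = T ∧ c t ≠ 0 := by
  unfold lowC at h
  split_ifs at h with h1
  · exact ⟨h1, h⟩
  · exact absurd rfl h

theorem heightQ_eq {t : MatQ (n + 1)} (ht : t.IsSymm) (α : Fin n → ℝ) :
    heightQ t α = t 0 0 + rowQ t α + qf (toR (low t)) α := by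
  rw [heightQ, qf_cons (toR_isSymm ht), rowQ]
  simp only [toR, low, Matrix.map_apply, one_pow, one_mul, mul_one]
  rfl

/-- A base point with given elliptic data. -/
def fibreMat (w : ℂ) (α β : Fin n → ℝ) : MatC (n + 1) :=
  Matrix.of (Fin.cons (Fin.cons w fun j => α j * w + β j)
    fun i => Fin.cons (α i * w + β i) fun j => α i * α j * w + (if i = j then Complex.I else 0))

section
variable (w : ℂ) (α β : Fin n → ℝ)
@[simp] theorem fibreMat_zero_zero : fibreMat w α β 0 0 = w := rfl
@[simp] theorem fibreMat_zero_succ (j) : fibreMat w α β 0 (Fin.succ j) = α j * w + β j := rfl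
@[simp] theorem fibreMat_succ_zero (i) : fibreMat w α β (Fin.succ i) 0 = α i * w + β i := rfl
@[simp] theorem fibreMat_succ_succ (i j) : fibreMat w α β (Fin.succ i) (Fin.succ j) =
    α i * α j * w + (if i = j then Complex.I else 0) := rfl
end

theorem fibreMat_isSymm (w : ℂ) (α β : Fin n → ℝ) : (fibreMat w α β).IsSymm := by
  refine Matrix.IsSymm.ext fun i j => ?_
  refine Fin.cases ?_ (fun i => ?_) i <;> refine Fin.cases ?_ (fun j => ?_) j
  · rfl
  · rfl
  · rfl
  · simp only [fibreMat_succ_succ, eq_comm (a := i)]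
    ring

theorem fibreMat_mem_Sieg {w : ℂ} (hw : 0 < w.im) (α β : Fin n → ℝ) :
    fibreMat w α β ∈ Sieg (n + 1) := by
  refine ⟨fibreMat_isSymm w α β, ?_⟩
  rw [posDef_iff_schur (map_im_isSymm (fibreMat_isSymm w α β))]
  refine ⟨by simpa using hw, ?_⟩
  have : schur ((fibreMat w α β).map Complex.im) = 1 := by
    ext i j
    simp only [schur, Matrix.of_apply, Matrix.map_apply, fibreMat_zero_zero, fibreMat_zero_succ,
      fibreMat_succ_zero, fibreMat_succ_succ, Complex.add_im, Complex.ofReal_im, add_zero,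
      Complex.im_ofReal_mul, mul_assoc, Matrix.one_apply]
    split_ifs <;> simp <;> field_simp <;> ring
  rw [this]
  exact Matrix.PosDef.one

theorem submatrix_castSucc_fibreMat (w : ℂ) (α β : Fin (n + 1) → ℝ) :
    (fibreMat w α β).submatrix Fin.castSucc Fin.castSucc =
      fibreMat w (fun i => α i.castSucc) fun i => β i.castSucc := by
  ext i j
  refine Fin.cases ?_ (fun i => ?_) i <;> refine Fin.cases ?_ (fun j => ?_) j
  · rfl
  · rfl
  · rfl
  · change fibreMat w α β i.castSucc.succ j.castSucc.succ = _
    simp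

theorem sAct_fibreMat {w : ℂ} (hw : w ≠ 0) (α β : Fin n → ℝ) :
    sAct (fibreMat w α β) =
      fibreMat (-1 / w) (-β) α + lowShift fun p => -(α p.1 * β p.2) := by
  ext i j
  refine Fin.cases ?_ (fun i => ?_) i <;> refine Fin.cases ?_ (fun j => ?_) j <;>
    simp only [sAct_zero_zero, sAct_zero_succ, sAct_succ_zero, sAct_succ_succ, Matrix.add_apply,
      fibreMat_zero_zero, fibreMat_zero_succ, fibreMat_succ_zero, fibreMat_succ_succ, lowShift_zero,
      lowShift_succ_zero, lowShift_succ_succ, add_zero, Pi.neg_apply, Complex.ofReal_neg,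
      Complex.ofReal_add, Complex.ofReal_mul] <;>
    field_simp <;> ring

theorem eMat_fibreMat {t : MatQ (n + 1)} (ht : t.IsSymm) (w : ℂ) (α β : Fin n → ℝ) :
    eMat t (fibreMat w α β) = ee (rowQ t β) * ee (heightQ t α * w) *
      ee (((low t).trace : ℂ) * Complex.I) := by
  rw [eMat_eq_ee, ← ee_add, ← ee_add, heightQ_eq ht, qf_eq_sum]
  congr 1
  have h : ∀ i : Fin n, t i.succ 0 = t 0 i.succ := fun i => ht.apply _ _
  simp only [Fin.sum_univ_succ, fibreMat_zero_zero, fibreMat_zero_succ, fibreMat_succ_zero,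
    fibreMat_succ_succ, rowQ, Matrix.trace, Matrix.diag_apply, low, Matrix.submatrix_apply, toR,
    Matrix.map_apply, h, mul_add, Finset.sum_add_distrib, mul_ite, mul_zero, Finset.sum_ite_eq',
    Finset.mem_univ, if_true]
  push_cast
  simp only [Finset.mul_sum, Finset.sum_mul, add_mul, ← Finset.sum_add_distrib]
  have e : ∀ i j : Fin n, (t i.succ j.succ : ℂ) * ((α j : ℂ) * α i * w) =
    (α i : ℂ) * (t i.succ j.succ : ℂ) * α j * w := fun i j => by ring
  simp only [e]
  have hr : ∀ A B C D E : ℂ, A + (B + C + D) + E = B + (A + (C + (D + E))) := fun _ _ _ _ _ => by ring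
  rw [add_assoc, hr]
  simp only [← Finset.sum_add_distrib]
  congr 1
  exact Finset.sum_congr rfl fun i _ => by ring

variable {k : ℤ} {c : MatQ (n + 1 + 1) → ℂ}

theorem IsSymFM.isSymm (hc : IsSymFM (n + 1) 1 k c) (T : MatQ (n + 1)) {t : MatQ (n + 1 + 1)}
    (ht : lowC c T t ≠ 0) : t.IsSymm := (hc.1 t (lowC_ne_zero ht).2).1.1

theorem ee_trace_mul_eMat (hc : IsSymFM (n + 1) 1 k c) (T : MatQ (n + 1)) (w : ℂ)
    (α β : Fin (n + 1) → ℝ) (t : MatQ (n + 1 + 1)) :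
    lowC c T t * eMat t (fibreMat w α β) =
      lowC c T t * ee (rowQ t β) * ee (heightQ t α * w) * ee ((T.trace : ℂ) * Complex.I) := by
  by_cases h : lowC c T t = 0
  · simp [h]
  rw [eMat_fibreMat (hc.isSymm T h), (lowC_ne_zero h).1]
  ring

theorem fibreMat_castSucc_mem {w : ℂ} (hw : 0 < w.im) (α β : Fin (n + 1) → ℝ) :
    (fibreMat w α β).submatrix Fin.castSucc Fin.castSucc ∈ Sieg (n + 1) := by
  rw [submatrix_castSucc_fibreMat]
  exact fibreMat_mem_Sieg hw _ _

theorem summable_fibreSum (hc : IsSymFM (n + 1) 1 k c) (T : MatQ (n + 1)) {w : ℂ} (hw : 0 < w.im)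
    (α β : Fin (n + 1) → ℝ) :
    Summable fun t => lowC c T t * ee (rowQ t β) * ee (heightQ t α * w) := by
  have h := (hc.lowSlice T (fibreMat_isSymm w α β) (fibreMat_castSucc_mem hw α β)).1
  have h2 : Summable fun t => lowC c T t * eMat t (fibreMat w α β) := h
  simp only [ee_trace_mul_eMat hc] at h2
  exact (summable_mul_right_iff (ee_ne_zero _)).mp h2

theorem norm_fibreSum_inv (hc : IsSymFM (n + 1) 1 k c) (T : MatQ (n + 1)) {w : ℂ} (hw : 0 < w.im)
    (α β : Fin (n + 1) → ℝ) :
    ‖fibreSum c T (-1 / w) (-β) α‖ = ‖w‖ ^ k * ‖fibreSum c T w α β‖ := by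
  have h : ∑' t, lowC c T t * eMat t (sAct (fibreMat w α β)) =
      w ^ k * ∑' t, lowC c T t * eMat t (fibreMat w α β) :=
    (hc.lowSlice T (fibreMat_isSymm w α β) (fibreMat_castSucc_mem hw α β)).2
  rw [sAct_fibreMat (ne_zero_of_im_pos hw)] at h
  set u : ℝ := ∑ p : Fin (n + 1) × Fin (n + 1), 2 * (T p.1 p.2 : ℝ) * -(α p.1 * β p.2) with hu
  have h1 : ∀ t, lowC c T t * eMat t (fibreMat (-1 / w) (-β) α + lowShift fun p => -(α p.1 * β p.2)) =
      lowC c T t * ee (rowQ t α) * ee (heightQ t (-β) * (-1 / w)) *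
        (ee ((T.trace : ℂ) * Complex.I) * ee u) := by
    intro t
    by_cases ht : lowC c T t = 0
    · simp [ht]
    rw [eMat_add, ← mul_assoc, ee_trace_mul_eMat hc, eMat_lowShift (hc.isSymm T ht),
      (lowC_ne_zero ht).1, hu, mul_assoc]
    push_cast
    rfl
  simp only [h1, ee_trace_mul_eMat hc] at h
  rw [tsum_mul_right, tsum_mul_right] at h
  have h2 := congrArg norm h
  simp only [norm_mul, norm_ee_real, mul_one, norm_zpow] at h2
  have h3 : ‖ee ((T.trace : ℂ) * Complex.I)‖ ≠ 0 := norm_ne_zero_iff.mpr (ee_ne_zero _)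
  rw [← mul_assoc] at h2
  exact mul_right_cancel₀ h3 h2

end Theta

section Modular

variable {n : ℕ} {k : ℤ} {c : MatQ (n + 1 + 1) → ℂ}

theorem norm_fibreSum_add_one (hc : IsSymFM (n + 1) 1 k c) (T : MatQ (n + 1)) (w : ℂ)
    (α β : Fin (n + 1) → ℝ) :
    ‖fibreSum c T (w + 1) α β‖ = ‖fibreSum c T w α (β + α)‖ := by
  have h : ∀ t, lowC c T t * ee (rowQ t β) * ee (heightQ t α * (w + 1)) =
      lowC c T t * ee (rowQ t (β + α)) * ee (heightQ t α * w) * ee (qf (toR T) α : ℝ) := by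
    intro t
    by_cases ht : lowC c T t = 0
    · simp [ht]
    obtain ⟨h1, h2⟩ := lowC_ne_zero ht
    obtain ⟨z, hz⟩ := (hc.1 t h2).1.2.2 0
    have h3 : rowQ t (β + α) = rowQ t β + rowQ t α := by
      simp only [rowQ, Pi.add_apply, mul_add, Finset.sum_add_distrib]
    have h4 : ((heightQ t α : ℝ) : ℂ) = z + rowQ t α + (qf (toR T) α : ℝ) := by
      rw [heightQ_eq (hc.isSymm T ht), h1, hz]
      push_cast
      rfl
    rw [mul_add, mul_one, ee_add, h3, Complex.ofReal_add, ee_add]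
    conv_lhs => rw [h4]
    rw [ee_add, ee_add, ee_int, h4]
    ring
  rw [fibreSum, tsum_congr h, tsum_mul_right, norm_mul, norm_ee_real, mul_one]
  rfl

/-- The integral matrix sending the first basis vector to `(1, a)` and fixing the others. -/
def shearZ (a : Fin n → ℤ) : Matrix (Fin (n + 1)) (Fin (n + 1)) ℤ :=
  Matrix.of (Fin.cons (Fin.cons 1 0) fun i => Fin.cons (a i) ((1 : Matrix (Fin n) (Fin n) ℤ) i))

@[simp] theorem shearZ_zero_zero (a : Fin n → ℤ) : shearZ a 0 0 = 1 := rfl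
@[simp] theorem shearZ_zero_succ (a : Fin n → ℤ) (j) : shearZ a 0 (Fin.succ j) = 0 := rfl
@[simp] theorem shearZ_succ_zero (a : Fin n → ℤ) (i) : shearZ a (Fin.succ i) 0 = a i := rfl
@[simp] theorem shearZ_succ_succ (a : Fin n → ℤ) (i j) :
    shearZ a (Fin.succ i) (Fin.succ j) = (1 : Matrix (Fin n) (Fin n) ℤ) i j := rfl

theorem det_shearZ (a : Fin n → ℤ) : (shearZ a).det = 1 := by
  rw [Matrix.det_succ_row_zero, Fin.sum_univ_succ]
  have : (shearZ a).submatrix Fin.succ Fin.succ = 1 := by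
    ext i j; simp
  simp [this]

theorem shearZ_mul_shearZ (a b : Fin n → ℤ) : shearZ a * shearZ b = shearZ (a + b) := by
  ext i j
  refine Fin.cases ?_ (fun i => ?_) i <;> refine Fin.cases ?_ (fun j => ?_) j <;>
    simp [Matrix.mul_apply, Fin.sum_univ_succ, Matrix.one_apply]

theorem shearZ_zero : shearZ (0 : Fin n → ℤ) = 1 := by
  ext i j
  refine Fin.cases ?_ (fun i => ?_) i <;> refine Fin.cases ?_ (fun j => ?_) j <;>
    simp [Matrix.one_apply, Fin.succ_ne_zero, eq_comm]

/-- Conjugation by a shear as a permutation. -/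
def shearEquiv (a : Fin n → ℤ) : MatQ (n + 1) ≃ MatQ (n + 1) where
  toFun := conjZ (shearZ a)
  invFun := conjZ (shearZ (-a))
  left_inv t := by rw [conjZ_conjZ, shearZ_mul_shearZ, add_neg_cancel, shearZ_zero, conjZ_one]
  right_inv t := by rw [conjZ_conjZ, shearZ_mul_shearZ, neg_add_cancel, shearZ_zero, conjZ_one]

theorem low_conjZ_shearZ (a : Fin n → ℤ) (t : MatQ (n + 1)) : low (conjZ (shearZ a) t) = low t := by
  ext i j
  simp [low, conjZ_apply, Fin.sum_univ_succ, Matrix.one_apply]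

theorem rowQ_conjZ_shearZ (a : Fin n → ℤ) (t : MatQ (n + 1)) (β : Fin n → ℝ) :
    rowQ (conjZ (shearZ a) t) β =
      rowQ t β + 2 * ∑ j, (∑ i, (a i : ℝ) * (low t i j : ℚ)) * β j := by
  simp [rowQ, low, conjZ_apply, Fin.sum_univ_succ, Matrix.one_apply, add_mul,
    Finset.sum_add_distrib, mul_add]

theorem heightQ_conjZ_shearZ (a : Fin n → ℤ) (t : MatQ (n + 1)) (α : Fin n → ℝ) :
    heightQ (conjZ (shearZ a) t) α = heightQ t (α + fun i => (a i : ℝ)) := by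
  have h : toR (conjZ (shearZ a) t) = ((shearZ a).map fun z => (z : ℝ))ᵀ * toR t *
      (shearZ a).map fun z => (z : ℝ) := by
    ext i j
    simp only [toR, Matrix.map_apply, conjZ, Matrix.mul_apply, transpose_apply]
    push_cast
    rfl
  have h2 : ((shearZ a).map fun z => (z : ℝ)) *ᵥ (Fin.cons 1 α : Fin (n + 1) → ℝ) =
      Fin.cons 1 (α + fun i => (a i : ℝ)) := by
    ext i
    refine Fin.cases ?_ (fun i => ?_) i <;>
      simp [Matrix.mulVec, dotProduct, Fin.sum_univ_succ, Matrix.one_apply, add_comm]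
  rw [heightQ, heightQ, ← h2, h, qf, qf, ← Matrix.mulVec_mulVec, ← Matrix.mulVec_mulVec,
    Matrix.dotProduct_mulVec, Matrix.vecMul_transpose]

theorem norm_fibreSum_add_int (hc : IsSymFM (n + 1) 1 k c) (T : MatQ (n + 1)) (w : ℂ)
    (α β : Fin (n + 1) → ℝ) (a : Fin (n + 1) → ℤ) :
    ‖fibreSum c T w (α + fun i => (a i : ℝ)) β‖ = ‖fibreSum c T w α β‖ := by
  set r : ℝ := 2 * ∑ j, (∑ i, (a i : ℝ) * (T i j : ℚ)) * β j with hr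
  have h : ∀ t, lowC c T (shearEquiv a t) * ee (rowQ (shearEquiv a t) β) *
      ee (heightQ (shearEquiv a t) α * w) = lowC c T t * ee (rowQ t β) *
        ee (heightQ t (α + fun i => (a i : ℝ)) * w) * ee r := by
    intro t
    change lowC c T (conjZ _ t) * ee (rowQ (conjZ _ t) β) * ee (heightQ (conjZ _ t) α * w) = _
    have hct : c (conjZ (shearZ a) t) = c t := by
      have := hc.2.1 (shearZ a) (by rw [det_shearZ]; exact isUnit_one) t
      rw [det_shearZ] at this
      rw [Int.cast_one, Rat.cast_one, _root_.one_zpow, one_mul] at this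
      exact this.symm
    have hl : lowC c T (conjZ (shearZ a) t) = lowC c T t := by
      simp only [lowC, low_conjZ_shearZ, hct]
    by_cases ht : lowC c T t = 0
    · simp [hl, ht]
    rw [hl, rowQ_conjZ_shearZ, heightQ_conjZ_shearZ, (lowC_ne_zero ht).1, ← hr,
      Complex.ofReal_add, ee_add]
    ring
  have h2 : fibreSum c T w α β = fibreSum c T w (α + fun i => (a i : ℝ)) β * ee r := by
    rw [fibreSum, ← (shearEquiv a).tsum_eq, tsum_congr h, tsum_mul_right]
    rfl
  rw [h2, norm_mul, norm_ee_real, mul_one]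

open UpperHalfPlane ModularGroup in
theorem range_fibreSum_smul (hc : IsSymFM (n + 1) 1 k c) (T : MatQ (n + 1))
    (γ : Matrix.SpecialLinearGroup (Fin 2) ℤ) (w : ℍ) :
    Set.range (fun p : (Fin (n + 1) → ℝ) × (Fin (n + 1) → ℝ) =>
        ‖fibreSum c T (γ • w : ℍ) p.1 p.2‖ ^ 2 * (γ • w).im ^ k) =
      Set.range fun p : (Fin (n + 1) → ℝ) × (Fin (n + 1) → ℝ) =>
        ‖fibreSum c T (w : ℂ) p.1 p.2‖ ^ 2 * w.im ^ k := by
  have hγ : γ ∈ Subgroup.closure {ModularGroup.S, ModularGroup.T} := by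
    simp [SpecialLinearGroup.SL2Z_generators]
  induction hγ using Subgroup.closure_induction generalizing w with
  | mem x hx =>
    rcases hx with rfl | rfl
    · have hw := w.im_pos
      have hw0 : ‖(w : ℂ)‖ ≠ 0 := norm_ne_zero_iff.mpr w.ne_zero
      have h1 : ((ModularGroup.S • w : ℍ) : ℂ) = -1 / w := by
        rw [modular_S_smul]
        change (-(w : ℂ))⁻¹ = _
        rw [← neg_inv, neg_div, one_div]
      have h2 : (ModularGroup.S • w).im = w.im / ‖(w : ℂ)‖ ^ 2 := by
        rw [← coe_im, h1, neg_one_div_im, Complex.normSq_eq_norm_sq]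
        rfl
      have key : ∀ α β : Fin (n + 1) → ℝ,
          ‖fibreSum c T (ModularGroup.S • w : ℍ) (-β) α‖ ^ 2 * (ModularGroup.S • w).im ^ k =
            ‖fibreSum c T (w : ℂ) α β‖ ^ 2 * w.im ^ k := by
        intro α β
        rw [h1, h2, norm_fibreSum_inv hc T hw, div_zpow, mul_pow, ← zpow_natCast (‖(w : ℂ)‖ ^ k),
          ← _root_.zpow_mul, ← zpow_natCast ‖(w : ℂ)‖ 2, ← _root_.zpow_mul, mul_comm k]
        have := zpow_ne_zero (((2 : ℕ) : ℤ) * k) hw0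
        field_simp
      ext r
      constructor
      · rintro ⟨⟨α, β⟩, rfl⟩
        exact ⟨(β, -α), by simp only [← key, neg_neg]⟩
      · rintro ⟨⟨α, β⟩, rfl⟩
        exact ⟨(-β, α), key α β⟩
    · have h1 : ((ModularGroup.T • w : ℍ) : ℂ) = w + 1 := by
        rw [modular_T_smul, coe_vadd, add_comm, Complex.ofReal_one]
      have h2 : (ModularGroup.T • w).im = w.im := by
        rw [← coe_im, h1]; simp
      have key : ∀ α β : Fin (n + 1) → ℝ,
          ‖fibreSum c T (ModularGroup.T • w : ℍ) α β‖ ^ 2 * (ModularGroup.T • w).im ^ k =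
            ‖fibreSum c T (w : ℂ) α (β + α)‖ ^ 2 * w.im ^ k := by
        intro α β
        rw [h1, h2, norm_fibreSum_add_one hc]
      ext r
      constructor
      · rintro ⟨⟨α, β⟩, rfl⟩
        exact ⟨(α, β + α), (key α β).symm⟩
      · rintro ⟨⟨α, β⟩, rfl⟩
        exact ⟨(α, β - α), by simp only [key, sub_add_cancel]⟩
  | one => simp
  | mul x y _ _ hx hy => rw [mul_smul, hx, hy]
  | inv x _ hx => rw [← hx, smul_inv_smul]

end Modular

section Shrink

variable {n : ℕ} {k : ℤ} {c : MatQ (n + 1 + 1) → ℂ}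

theorem zpow_le_pow_natAbs {r X : ℝ} (hr : 0 < r) (h1 : r ≤ X) (h2 : r⁻¹ ≤ X) (k : ℤ) :
    r ^ k ≤ X ^ k.natAbs := by
  obtain h | h := Int.natAbs_eq k <;> rw [h]
  · rw [_root_.zpow_natCast, Int.natAbs_natCast]
    gcongr
  · rw [_root_.zpow_neg, _root_.zpow_natCast, ← inv_pow, Int.natAbs_neg, Int.natAbs_natCast]
    gcongr

open UpperHalfPlane ModularGroup in
theorem im_smul_le_inv (γ : Matrix.SpecialLinearGroup (Fin 2) ℤ) (w : ℍ) (hw : w.im ≤ 1) :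
    (γ • w).im ≤ w.im⁻¹ := by
  have hy := w.im_pos
  have hden : w.im ^ 2 ≤ Complex.normSq (denom γ w) := by
    rw [denom_apply, Complex.normSq_apply]
    simp only [Complex.add_re, Complex.add_im, Complex.mul_re, Complex.mul_im, Complex.intCast_re,
      Complex.intCast_im, zero_mul, add_zero, sub_zero, UpperHalfPlane.coe_im]
    by_cases h : γ 1 0 = 0
    · have hdet := γ.det_coe
      rw [Matrix.det_fin_two, h, mul_zero, sub_zero] at hdet
      have hd : γ 1 1 ^ 2 = 1 := by
        rcases Int.isUnit_iff.mp (IsUnit.of_mul_eq_one_right _ hdet) with h | h <;> simp [h]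
      have hd' : ((γ 1 1 : ℤ) : ℝ) ^ 2 = 1 := by exact_mod_cast hd
      rw [h]
      simp only [Int.cast_zero, zero_mul, zero_add]
      nlinarith
    · have : (1 : ℤ) ≤ γ 1 0 ^ 2 := by
        have := sq_nonneg (γ 1 0)
        have : γ 1 0 ^ 2 ≠ 0 := by positivity
        omega
      have : (1 : ℝ) ≤ ((γ 1 0 : ℤ) : ℝ) ^ 2 := by exact_mod_cast this
      nlinarith [mul_self_nonneg (((γ 1 0 : ℤ) : ℝ) * (w : ℂ).re + ((γ 1 1 : ℤ) : ℝ)),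
        mul_nonneg (sub_nonneg.mpr this) (sq_nonneg w.im)]
  rw [ModularGroup.im_smul_eq_div_normSq]
  calc w.im / Complex.normSq (denom γ w) ≤ w.im / w.im ^ 2 := by gcongr
    _ = w.im⁻¹ := by field_simp

open UpperHalfPlane ModularGroup in
theorem norm_fibreSum_le_of_fd (hc : IsSymFM (n + 1) 1 k c) (T : MatQ (n + 1)) {M : ℝ}
    (hM : ∀ w : ℂ, 3 ≤ 4 * w.im ^ 2 → 0 < w.im → ∀ α β, ‖fibreSum c T w α β‖ ≤ M)
    {w : ℂ} (hw : 0 < w.im) (hw1 : w.im ≤ 1) (α β : Fin (n + 1) → ℝ) :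
    ‖fibreSum c T w α β‖ ≤ (2 / w.im) ^ k.natAbs * M := by
  set z : ℍ := ⟨w, hw⟩ with hz
  have hM0 : 0 ≤ M := (norm_nonneg _).trans
    (hM (2 * Complex.I) (by norm_num) (by norm_num) 0 0)
  obtain ⟨γ, hγ⟩ := exists_smul_mem_fd z
  have h34 := three_le_four_mul_im_sq_of_mem_fd hγ
  have hv := (γ • z).im_pos
  obtain ⟨⟨α', β'⟩, hp⟩ : (‖fibreSum c T w α β‖ ^ 2 * w.im ^ k) ∈ Set.range
      fun p : (Fin (n + 1) → ℝ) × (Fin (n + 1) → ℝ) =>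
        ‖fibreSum c T (γ • z : ℍ) p.1 p.2‖ ^ 2 * (γ • z).im ^ k := by
    rw [range_fibreSum_smul hc T γ z]
    exact ⟨(α, β), rfl⟩
  have hb := hM (γ • z : ℍ) h34 hv α' β'
  have hle := im_smul_le_inv γ z hw1
  set v := (γ • z).im with hvdef
  change v ≤ w.im⁻¹ at hle
  have hr : 0 < v / w.im := by positivity
  have hrk : (v / w.im) ^ k ≤ ((2 / w.im) ^ 2) ^ k.natAbs := by
    have hinv : 1 ≤ w.im⁻¹ := (one_le_inv₀ hw).mpr hw1
    apply zpow_le_pow_natAbs hr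
    · rw [div_eq_mul_inv, div_pow, div_eq_mul_inv, ← inv_pow]
      nlinarith
    · rw [inv_div, div_le_iff₀ hv]
      have : 1 / 2 ≤ v := by nlinarith
      rw [div_pow, div_mul_eq_mul_div, le_div_iff₀ (by positivity)]
      have : w.im ^ 3 ≤ 1 := pow_le_one₀ hw.le hw1
      nlinarith
  refine (pow_le_pow_iff_left₀ (norm_nonneg _) (by positivity) two_ne_zero).mp ?_
  have hwk : 0 < w.im ^ k := zpow_pos hw k
  have : ‖fibreSum c T w α β‖ ^ 2 = ‖fibreSum c T (γ • z : ℍ) α' β'‖ ^ 2 * (v / w.im) ^ k := by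
    rw [div_zpow, ← mul_div_assoc, eq_div_iff hwk.ne']
    exact hp.symm
  rw [this, mul_pow, ← pow_mul, mul_comm k.natAbs 2, pow_mul, mul_comm]
  gcongr

end Shrink

section Count

variable {n : ℕ}

/-- The integral frequencies attached to the first row of a half-integral matrix. -/
def rowFreq (t : MatQ (n + 1)) : Fin (n + 1) → ℤ := Fin.cons ⌊t 0 0⌋ fun j => ⌊2 * t 0 j.succ⌋

theorem HalfIntegral.floor_diag {t : MatQ n} (h : HalfIntegral t) (i : Fin n) :
    ((⌊t i i⌋ : ℤ) : ℚ) = t i i := by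
  obtain ⟨z, hz⟩ := h.2.2 i
  rw [hz, Int.floor_intCast]

theorem eq_of_rowFreq_eq {t t' : MatQ (n + 1)} (h : HalfIntegral t) (h' : HalfIntegral t')
    (hl : low t = low t') (hf : rowFreq t = rowFreq t') : t = t' := by
  have h0 : t 0 0 = t' 0 0 := by
    have := congrFun hf 0
    rw [← h.floor_diag, ← h'.floor_diag]
    exact congrArg _ this
  have h1 : ∀ j : Fin n, t 0 j.succ = t' 0 j.succ := fun j => by
    have := congrFun hf j.succ
    have e : (⌊2 * t 0 j.succ⌋ : ℚ) = ⌊2 * t' 0 j.succ⌋ := congrArg _ this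
    rw [h.floor_two_mul, h'.floor_two_mul] at e
    linarith
  ext i j
  refine Fin.cases ?_ (fun i => ?_) i <;> refine Fin.cases ?_ (fun j => ?_) j
  · exact h0
  · exact h1 j
  · rw [h.1.apply, h'.1.apply, h1]
  · exact congrFun (congrFun hl i) j

theorem abs_rowFreq_le {t : MatQ (n + 1)} (h : HalfIntegral t) (hp : PosSemidefQ t) {N : ℕ}
    (hN : 2 * (t.trace : ℝ) ≤ N) (i : Fin (n + 1)) : |rowFreq t i| ≤ N := by
  have hd := fun i => diag_nonneg (t := t) hp i
  have hle : ∀ j, t j j ≤ t.trace := fun j =>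
    Finset.single_le_sum (f := fun j => t j j) (fun j _ => hd j) (Finset.mem_univ j)
  have hN' : 2 * t.trace ≤ (N : ℚ) := by
    have : ((2 * t.trace : ℚ) : ℝ) ≤ ((N : ℚ) : ℝ) := by push_cast; exact hN
    exact Rat.cast_le.mp this
  have htr : 0 ≤ t.trace := Finset.sum_nonneg fun i _ => hd i
  have key : (|rowFreq t i| : ℚ) ≤ N := by
    refine Fin.cases ?_ (fun j => ?_) i
    · rw [rowFreq, Fin.cons_zero, h.floor_diag, abs_of_nonneg (hd 0)]
      linarith [hle 0]
    · rw [rowFreq, Fin.cons_succ, h.floor_two_mul, abs_mul, abs_two]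
      have := abs_entry_le h.1 hp 0 j.succ
      linarith [hle 0, hle j.succ]
  exact_mod_cast key

theorem NearQ.of_heightQ {B : ℝ} {t : MatQ (n + 1)} {α : Fin n → ℝ} (hα : ∀ i, |α i| ≤ 1 / 2)
    (h : heightQ t α ≤ B) : NearQ B t := ⟨α, hα, h⟩

theorem exists_near_finset {c : MatQ (n + 1) → ℂ} (hs : SuppQ c) (T : MatQ n) (B : ℝ) {N : ℕ}
    (hN : 2 * (2 * B + (n + 1) * (T.trace : ℝ)) ≤ N) :
    ∃ s : Finset (MatQ (n + 1)), s.card ≤ (2 * N + 1) ^ (n + 1) ∧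
      ∀ t, lowC c T t ≠ 0 → NearQ B t → t ∈ s := by
  set S : Set (MatQ (n + 1)) := {t | lowC c T t ≠ 0 ∧ NearQ B t} with hS
  set box : Finset (Fin (n + 1) → ℤ) := Fintype.piFinset fun _ => Finset.Icc (-(N : ℤ)) N with hbox
  have hmaps : Set.MapsTo rowFreq S (box : Set (Fin (n + 1) → ℤ)) := by
    rintro t ⟨ht, hnear⟩
    obtain ⟨hl, hct⟩ := lowC_ne_zero ht
    obtain ⟨hh, hp⟩ := hs t hct
    have htr := trace_le_of_near hh.1 hp hnear
    rw [hl] at htr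
    rw [hbox, Finset.mem_coe, Fintype.mem_piFinset]
    intro i
    rw [Finset.mem_Icc, ← abs_le]
    exact abs_rowFreq_le hh hp (by linarith) i
  have hinj : Set.InjOn rowFreq S := by
    rintro t ⟨ht, -⟩ t' ⟨ht', -⟩ he
    obtain ⟨hl, hct⟩ := lowC_ne_zero ht
    obtain ⟨hl', hct'⟩ := lowC_ne_zero ht'
    exact eq_of_rowFreq_eq (hs t hct).1 (hs t' hct').1 (hl.trans hl'.symm) he
  have hfin : S.Finite := Set.Finite.of_injOn hmaps hinj box.finite_toSet
  refine ⟨hfin.toFinset, ?_, fun t h1 h2 => by simpa using ⟨h1, h2⟩⟩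
  have hcard := Finset.card_le_card_of_injOn (s := hfin.toFinset) (t := box) rowFreq
    (by simpa using hmaps) (by simpa using hinj)
  refine hcard.trans (le_of_eq ?_)
  rw [hbox, Fintype.card_piFinset, Finset.prod_const, Finset.card_univ, Fintype.card_fin, Int.card_Icc]
  congr 1
  omega

theorem tsum_near_le {c : MatQ (n + 1) → ℂ} (hs : SuppQ c) (T : MatQ n) (B : ℝ) {N : ℕ}
    (hN : 2 * (2 * B + (n + 1) * (T.trace : ℝ)) ≤ N) {V : ℝ} (hV : 0 ≤ V)
    (hnear : ∀ t, low t = T → c t ≠ 0 → NearQ B t → ‖c t‖ ≤ V)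
    (e : MatQ (n + 1) → ℂ) (P : MatQ (n + 1) → Prop) [DecidablePred P] (hP : ∀ t, P t → NearQ B t)
    (he : ∀ t, lowC c T t ≠ 0 → P t → ‖e t‖ ≤ 1) :
    (Summable fun t => if P t then lowC c T t * e t else 0) ∧
    ‖∑' t, if P t then lowC c T t * e t else 0‖ ≤ (2 * N + 1) ^ (n + 1) * V := by
  obtain ⟨s, hcard, hsub⟩ := exists_near_finset hs T B hN
  have hz : ∀ t, t ∉ s → (if P t then lowC c T t * e t else 0) = 0 := by
    intro t ht
    split_ifs with h
    · by_cases hl : lowC c T t = 0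
      · simp [hl]
      · exact absurd (hsub t hl (hP t h)) ht
    · rfl
  refine ⟨summable_of_ne_finset_zero (s := s) hz, ?_⟩
  rw [tsum_eq_sum (s := s) hz]
  calc _ ≤ ∑ t ∈ s, ‖if P t then lowC c T t * e t else 0‖ := norm_sum_le _ _
    _ ≤ ∑ t ∈ s, V := by
      refine Finset.sum_le_sum fun t _ => ?_
      split_ifs with h
      · by_cases hl : lowC c T t = 0
        · simpa [hl] using hV
        · obtain ⟨h1, h2⟩ := lowC_ne_zero hl
          rw [norm_mul, lowC_of_low h1]
          have h3 := hnear t h1 h2 (hP t h)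
          have h4 := he t hl h
          nlinarith [norm_nonneg (c t), norm_nonneg (e t)]
      · simpa using hV
    _ = s.card * V := by rw [Finset.sum_const, nsmul_eq_mul]
    _ ≤ _ := by
      gcongr
      exact_mod_cast hcard

end Count

section MainBound

variable {n : ℕ}

theorem heightQ_zero {t : MatQ (n + 1)} (ht : t.IsSymm) : heightQ t 0 = t 0 0 := by
  rw [heightQ_eq ht, rowQ, qf_eq_sum]
  simp

theorem half_sub_le_heightQ {t : MatQ (n + 1)} (ht : t.IsSymm) (hp : PosSemidefQ t)
    (α : Fin n → ℝ) : (t 0 0 : ℝ) / 2 - qf (toR (low t)) α ≤ heightQ t α := by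
  have h : 0 ≤ heightQ t ((2 : ℝ) • α) := qf_toR_nonneg hp _
  have hr : rowQ t ((2 : ℝ) • α) = 2 * rowQ t α := by
    simp only [rowQ, Pi.smul_apply, smul_eq_mul, Finset.mul_sum]
    exact Finset.sum_congr rfl fun j _ => by ring
  rw [heightQ_eq ht, qf_smul, hr] at h
  rw [heightQ_eq ht]
  nlinarith

theorem norm_fibre_term (a : ℂ) (r q : ℝ) (w : ℂ) :
    ‖a * ee r * ee (q * w)‖ = ‖a‖ * Real.exp (-(2 * Real.pi * q * w.im)) := by
  rw [norm_mul_ee_real_mul, norm_mul, norm_ee_real, mul_one]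

variable {k : ℤ} {c : MatQ (n + 1 + 1) → ℂ}

theorem exists_round_fibreSum (hc : IsSymFM (n + 1) 1 k c) (T : MatQ (n + 1)) (w : ℂ)
    (α β : Fin (n + 1) → ℝ) :
    ∃ α', (∀ i, |α' i| ≤ 1 / 2) ∧ ‖fibreSum c T w α β‖ = ‖fibreSum c T w α' β‖ := by
  refine ⟨fun i => α i - round (α i), fun i => abs_sub_round _, ?_⟩
  rw [← norm_fibreSum_add_int hc T w (fun i => α i - round (α i)) β fun i => round (α i)]
  congr 2
  ext i
  simp

theorem exists_fibreSum_bound (hc : IsSymFM (n + 1) 1 k c) (T : MatQ (n + 1)) :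
    ∃ M : ℝ, ∀ w : ℂ, 3 ≤ 4 * w.im ^ 2 → 0 < w.im → ∀ α β, ‖fibreSum c T w α β‖ ≤ M := by
  obtain ⟨C, hC⟩ := (isCompact_Icc (a := fun _ : Fin (n + 1) => (-(1 / 2) : ℝ))
    (b := fun _ => 1 / 2)).exists_bound_of_continuousOn (continuous_qf (toR T)).continuousOn
  have hs := (summable_fibreSum hc T (w := (1 / 4 : ℝ) * Complex.I) (by simp) 0 0).norm
  simp only [norm_fibre_term] at hs
  have him : ((1 / 4 : ℝ) * Complex.I : ℂ).im = 1 / 4 := by simp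
  rw [him] at hs
  have hs2 := hs.mul_right (Real.exp (Real.pi * C))
  refine ⟨∑' t, ‖lowC c T t‖ * Real.exp (-(2 * Real.pi * heightQ t 0 * (1 / 4))) *
    Real.exp (Real.pi * C), fun w h34 hw α β => ?_⟩
  obtain ⟨α, hα, he⟩ := exists_round_fibreSum hc T w α β
  rw [he]
  have hCα : qf (toR T) α ≤ C := (le_abs_self _).trans
    (hC α ⟨fun i => (abs_le.mp (hα i)).1, fun i => (abs_le.mp (hα i)).2⟩)
  refine tsum_of_norm_bounded hs2.hasSum fun t => ?_
  rw [norm_fibre_term]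
  by_cases ht : lowC c T t = 0
  · simp [ht]
  have hsym := hc.isSymm T ht
  obtain ⟨hl, hct⟩ := lowC_ne_zero ht
  have hp := (hc.1 t hct).2
  rw [mul_assoc ‖lowC c T t‖ _ (Real.exp (Real.pi * C)), ← Real.exp_add]
  refine mul_le_mul_of_nonneg_left (Real.exp_le_exp.mpr ?_) (norm_nonneg _)
  have h1 := half_sub_le_heightQ hsym hp α
  rw [hl] at h1
  have h2 : 0 ≤ heightQ t α := qf_toR_nonneg hp _
  have h3 : 1 / 2 ≤ w.im := by nlinarith
  rw [heightQ_zero hsym]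
  have h4 : heightQ t α * (1 / 2) ≤ heightQ t α * w.im := by gcongr
  have h5 : 0 ≤ Real.pi * (heightQ t α - (t 0 0 : ℝ) / 2 + C) :=
    mul_nonneg Real.pi_pos.le (by linarith)
  have h6 := mul_le_mul_of_nonneg_left h4 Real.pi_pos.le
  linarith

theorem norm_fibreSum_improve (hc : IsSymFM (n + 1) 1 k c) (T : MatQ (n + 1)) {B S M : ℝ}
    (hB : 0 ≤ B) (hBk : Real.exp (-(2 * Real.pi * B * (1 / 3))) * 4 ^ k.natAbs ≤ 1 / 2)
    (hS : ∀ (α β : Fin (n + 1) → ℝ) (w : ℂ), (∀ i, |α i| ≤ 1 / 2) → 0 < w.im →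
      (Summable fun t => if heightQ t α < B then lowC c T t * (ee (rowQ t β) * ee (heightQ t α * w)) else 0) ∧
      ‖∑' t, if heightQ t α < B then lowC c T t * (ee (rowQ t β) * ee (heightQ t α * w)) else 0‖ ≤ S)
    (hM : ∀ w : ℂ, 3 ≤ 4 * w.im ^ 2 → 0 < w.im → ∀ α β, ‖fibreSum c T w α β‖ ≤ M)
    {w : ℂ} (h34 : 3 ≤ 4 * w.im ^ 2) (hw : 0 < w.im) (α β : Fin (n + 1) → ℝ) :
    ‖fibreSum c T w α β‖ ≤ M / 2 + 2 * S := by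
  obtain ⟨α, hα, he⟩ := exists_round_fibreSum hc T w α β
  rw [he]
  have hS0 : 0 ≤ S := (norm_nonneg _).trans (hS α β w hα hw).2
  have hM0 : 0 ≤ M := (norm_nonneg _).trans (hM w h34 hw α β)
  set d : MatQ (n + 1 + 1) → ℂ := fun t => if heightQ t α < B then 0 else lowC c T t * ee (rowQ t β)
    with hd
  have hsplit : ∀ w : ℂ, 0 < w.im → ∑' t, d t * ee (heightQ t α * w) = fibreSum c T w α β -
      ∑' t, if heightQ t α < B then lowC c T t * (ee (rowQ t β) * ee (heightQ t α * w)) else 0 := by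
    intro w hw
    rw [fibreSum, ← (summable_fibreSum hc T hw α β).tsum_sub (hS α β w hα hw).1]
    refine tsum_congr fun t => ?_
    simp only [hd]
    split_ifs <;> ring
  have hC : ∀ w : ℂ, w.im = 1 / 2 → ‖∑' t, d t * ee (heightQ t α * w)‖ ≤ 4 ^ k.natAbs * M + S := by
    intro w hw
    have hw0 : 0 < w.im := by rw [hw]; norm_num
    rw [hsplit w hw0]
    refine (norm_sub_le _ _).trans (add_le_add ?_ (hS α β w hα hw0).2)
    have := norm_fibreSum_le_of_fd hc T hM hw0 (by rw [hw]; norm_num) α β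
    rw [hw] at this
    norm_num at this ⊢
    exact this
  have hsum : Summable fun t => ‖d t‖ * Real.exp (-(2 * Real.pi * heightQ t α * (1 / 4))) := by
    have hs := (summable_fibreSum hc T (w := (1 / 4 : ℝ) * Complex.I) (by simp) α 0).norm
    simp only [norm_fibre_term] at hs
    have him : ((1 / 4 : ℝ) * Complex.I : ℂ).im = 1 / 4 := by simp
    rw [him] at hs
    refine hs.of_nonneg_of_le (fun t => by positivity) fun t => ?_
    gcongr
    simp only [hd]
    split_ifs
    · simp
    · rw [norm_mul, norm_ee_real, mul_one]
  have hy : 1 / 3 ≤ w.im - 1 / 2 := by nlinarith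
  have hPL := norm_tsum_ee_le hB (d := d) (q := fun t => heightQ t α)
    (fun t ht => by
      by_contra hlt
      exact ht (if_pos (not_le.mp hlt))) hsum hC (w := w) (by linarith)
  have hexp : Real.exp (-(2 * Real.pi * B * (w.im - 1 / 2))) ≤
      Real.exp (-(2 * Real.pi * B * (1 / 3))) := by
    apply Real.exp_le_exp.mpr
    have : 0 ≤ 2 * Real.pi * B := by have := Real.pi_pos; positivity
    nlinarith
  have hone : Real.exp (-(2 * Real.pi * B * (1 / 3))) ≤ 1 := by
    apply Real.exp_le_one_iff.mpr
    have : 0 ≤ 2 * Real.pi * B := by have := Real.pi_pos; positivity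
    nlinarith
  have h1 := hPL.trans (mul_le_mul_of_nonneg_right hexp (by positivity))
  rw [hsplit w hw] at h1
  have h2 := norm_le_norm_sub_add (fibreSum c T w α β)
    (∑' t, if heightQ t α < B then lowC c T t * (ee (rowQ t β) * ee (heightQ t α * w)) else 0)
  have h3 := (hS α β w hα hw).2
  nlinarith [mul_le_mul_of_nonneg_right hBk hM0, mul_le_mul_of_nonneg_right hone hS0]

end MainBound

section Growth

variable {n : ℕ} {k : ℤ} {c : MatQ (n + 1 + 1) → ℂ}

theorem norm_fibreSum_le_of_improve (hc : IsSymFM (n + 1) 1 k c) (T : MatQ (n + 1)) {S : ℝ}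
    (h : ∀ M : ℝ, (∀ w : ℂ, 3 ≤ 4 * w.im ^ 2 → 0 < w.im → ∀ α β, ‖fibreSum c T w α β‖ ≤ M) →
      ∀ w : ℂ, 3 ≤ 4 * w.im ^ 2 → 0 < w.im → ∀ α β, ‖fibreSum c T w α β‖ ≤ M / 2 + 2 * S) :
    ∀ w : ℂ, 3 ≤ 4 * w.im ^ 2 → 0 < w.im → ∀ α β, ‖fibreSum c T w α β‖ ≤ 4 * S := by
  set A : Set ℝ :=
    {M | ∀ w : ℂ, 3 ≤ 4 * w.im ^ 2 → 0 < w.im → ∀ α β, ‖fibreSum c T w α β‖ ≤ M} with hA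
  have hne : A.Nonempty := exists_fibreSum_bound hc T
  have hbdd : BddBelow A := ⟨0, fun M hM => (norm_nonneg _).trans
    (hM (2 * Complex.I) (by norm_num) (by norm_num) 0 0)⟩
  have hmem : sInf A ∈ A := fun w h1 h2 α β => le_csInf hne fun M hM => hM w h1 h2 α β
  have hle : sInf A ≤ sInf A / 2 + 2 * S := csInf_le hbdd (h _ hmem)
  exact fun w h1 h2 α β => (hmem w h1 h2 α β).trans (by linarith)

theorem ee_rowFreq {t : MatQ (n + 1)} (ht : HalfIntegral t) (x : Fin (n + 1) → ℝ) (y : ℝ) :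
    ee (∑ i, (rowFreq t i : ℂ) * (x i : ℂ)) * ee (heightQ t 0 * (y * Complex.I)) =
      ee (rowQ t (Fin.tail x)) * ee (heightQ t 0 * (x 0 + y * Complex.I)) := by
  rw [← ee_add, ← ee_add]
  congr 1
  have h0 : (rowFreq t 0 : ℂ) = (t 0 0 : ℂ) := by
    exact_mod_cast congrArg (fun q : ℚ => (q : ℂ)) (ht.floor_diag 0)
  have h1 : ∀ j : Fin n, (rowFreq t j.succ : ℂ) = 2 * (t 0 j.succ : ℂ) := fun j => by
    exact_mod_cast congrArg (fun q : ℚ => (q : ℂ)) (ht.floor_two_mul 0 j.succ)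
  rw [heightQ_zero ht.1, Fin.sum_univ_succ, h0, rowQ]
  simp only [h1, Fin.tail, Complex.ofReal_mul, Complex.ofReal_sum, Complex.ofReal_ratCast,
    Complex.ofReal_ofNat, Finset.mul_sum, mul_assoc]
  ring

theorem norm_coeff_le_of_fibreSum (hc : IsSymFM (n + 1) 1 k c) (T : MatQ (n + 1)) {y M : ℝ}
    (hy : 0 < y) (hM : ∀ w : ℂ, w.im = y → ∀ β, ‖fibreSum c T w 0 β‖ ≤ M)
    {t : MatQ (n + 1 + 1)} (hl : low t = T) (ht : c t ≠ 0) :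
    ‖c t‖ * Real.exp (-(2 * Real.pi * (t 0 0 : ℝ) * y)) ≤ M := by
  classical
  set b : MatQ (n + 1 + 1) → ℂ := fun t => lowC c T t * ee (heightQ t 0 * (y * Complex.I)) with hb
  have hsum : Summable b := by
    have := summable_fibreSum hc T (w := y * Complex.I) (by simpa using hy) 0 0
    refine this.congr fun t => ?_
    have : rowQ t 0 = 0 := by simp [rowQ]
    simp [hb, this, ee_zero]
  have : Countable (MatQ (n + 1 + 1)) :=
    inferInstanceAs (Countable (Fin (n + 1 + 1) → Fin (n + 1 + 1) → ℚ))
  have h := norm_fourier_coeff_le hsum (fun t => rowFreq t) (M := M) (fun x => by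
    have := hM (x 0 + y * Complex.I) (by simp) (Fin.tail x)
    rw [fibreSum] at this
    refine le_trans (le_of_eq ?_) this
    congr 1
    refine tsum_congr fun t => ?_
    by_cases h0 : lowC c T t = 0
    · simp [hb, h0]
    have := ee_rowFreq (hc.1 t (lowC_ne_zero h0).2).1 x y
    simp only [hb]
    rw [mul_assoc, mul_assoc, ← this, mul_comm (ee (_ * (_ * I)))]) (rowFreq t)
  rw [tsum_eq_single t, if_pos rfl] at h
  · simp only [hb] at h
    rw [norm_mul_ee_real_mul, lowC_of_low hl, heightQ_zero (hc.1 t ht).1.1] at h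
    simpa using h
  · intro t' hne
    split_ifs with hf
    · by_contra h0
      have h0' : lowC c T t' ≠ 0 := fun h => h0 (by simp [hb, h])
      obtain ⟨h1, h2⟩ := lowC_ne_zero h0'
      exact hne (eq_of_rowFreq_eq (hc.1 t' h2).1 (hc.1 t ht).1 (h1.trans hl.symm) hf)
    · rfl

theorem IsSymFM.suppQ (hc : IsSymFM (n + 1) 1 k c) : SuppQ c := hc.1

theorem IsSymFM.symQ (hc : IsSymFM (n + 1) 1 k c) : SymQ c := by
  intro u hu t
  have h := congrArg norm (hc.2.1 u hu t)
  have hd : ‖((u.det : ℚ) : ℂ)‖ = 1 := by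
    rcases Int.isUnit_iff.mp hu with h | h <;> rw [h] <;> simp
  rw [norm_mul, norm_zpow, hd, _root_.one_zpow, one_mul] at h
  exact h.symm

theorem IsSymFM.shrinkQ (hc : IsSymFM (n + 1) 1 k c) : ShrinkQ c := by
  have hpi := Real.pi_pos
  obtain ⟨B, hB, hBk⟩ : ∃ B : ℝ, 0 ≤ B ∧
      Real.exp (-(2 * Real.pi * B * (1 / 3))) * 4 ^ k.natAbs ≤ 1 / 2 := by
    refine ⟨3 * (Real.log (2 * 4 ^ k.natAbs) / (2 * Real.pi)), ?_, ?_⟩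
    · have : 0 ≤ Real.log (2 * 4 ^ k.natAbs) :=
        Real.log_nonneg (by nlinarith [one_le_pow₀ (M₀ := ℝ) (a := 4) (n := k.natAbs) (by norm_num)])
      positivity
    · have : 2 * Real.pi * (3 * (Real.log (2 * 4 ^ k.natAbs) / (2 * Real.pi))) * (1 / 3) =
          Real.log (2 * 4 ^ k.natAbs) := by field_simp
      rw [this, Real.exp_neg, Real.exp_log (by positivity)]
      apply le_of_eq
      field_simp
  set D : ℝ := 3 + 8 * B + 4 * (n + 2) with hD
  have hD1 : 1 ≤ D := by
    have : (0 : ℝ) ≤ n := Nat.cast_nonneg n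
    rw [hD]; linarith
  refine ⟨Real.exp (2 * Real.pi) * 2 ^ k.natAbs * 4 * D ^ (n + 2), B, k.natAbs + (n + 2), ?_, hB, ?_⟩
  · have h1 : 1 ≤ Real.exp (2 * Real.pi) := Real.one_le_exp (by positivity)
    have h2 : (1 : ℝ) ≤ 2 ^ k.natAbs := one_le_pow₀ (by norm_num)
    have h3 : 1 ≤ D ^ (n + 2) := one_le_pow₀ hD1
    exact one_le_mul_of_one_le_of_one_le (one_le_mul_of_one_le_of_one_le
      (one_le_mul_of_one_le_of_one_le h1 h2) (by norm_num)) h3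
  intro T V hV hnear t hl ht
  obtain ⟨hh, hp⟩ := hc.1 t ht
  have hlp : PosSemidefQ (low t) := hp.low hh.1
  have htT : 0 ≤ (T.trace : ℝ) := hl ▸ trace_nonneg_of_psd hlp
  have ht0 : (0 : ℝ) ≤ (t 0 0 : ℝ) := Rat.cast_nonneg.mpr (diag_nonneg (t := t) hp 0)
  have htr : (t.trace : ℝ) = (t 0 0 : ℝ) + (T.trace : ℝ) := by
    rw [trace_eq_low, hl]; push_cast; rfl
  obtain ⟨N, hN⟩ : ∃ N : ℕ, N = ⌈2 * (2 * B + ((n + 1 : ℕ) + 1) * (T.trace : ℝ))⌉₊ := ⟨_, rfl⟩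
  have hN1 : 2 * (2 * B + ((n + 1 : ℕ) + 1) * (T.trace : ℝ)) ≤ N := hN ▸ Nat.le_ceil _
  have hN2 : (N : ℝ) ≤ 2 * (2 * B + ((n + 1 : ℕ) + 1) * (T.trace : ℝ)) + 1 := by
    rw [hN]
    exact (Nat.ceil_lt_add_one (by positivity)).le
  set S : ℝ := (2 * N + 1) ^ (n + 1 + 1) * V with hS
  have hbound := norm_fibreSum_le_of_improve hc T (S := S) fun M hM w h1 h2 α β =>
    norm_fibreSum_improve hc T hB hBk (fun α β w hα hw =>
      tsum_near_le hc.suppQ T B hN1 hV hnear (fun t => ee (rowQ t β) * ee (heightQ t α * w))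
        (fun t => heightQ t α < B) (fun t h => NearQ.of_heightQ hα h.le) fun t hl0 _ => by
        rw [norm_mul, norm_ee_real, one_mul, ← one_mul (ee _), norm_mul_ee_real_mul, norm_one,
          one_mul, Real.exp_le_one_iff, neg_nonpos]
        have : 0 ≤ heightQ t α := qf_toR_nonneg (hc.1 t (lowC_ne_zero hl0).2).2 _
        positivity) hM h1 h2 α β
  have hy : (0 : ℝ) < (1 + (t 0 0 : ℝ))⁻¹ := by positivity
  have hy1 : (1 + (t 0 0 : ℝ))⁻¹ ≤ 1 := inv_le_one_of_one_le₀ (by linarith)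
  have hco := norm_coeff_le_of_fibreSum hc T hy (M := (2 * (1 + (t 0 0 : ℝ))) ^ k.natAbs * (4 * S))
    (fun w hw β => by
      have := norm_fibreSum_le_of_fd hc T hbound (w := w) (by rw [hw]; exact hy)
        (by rw [hw]; exact hy1) 0 β
      rw [hw, div_inv_eq_mul] at this
      exact this) hl ht
  have hexp : Real.exp (-(2 * Real.pi)) ≤
      Real.exp (-(2 * Real.pi * (t 0 0 : ℝ) * (1 + (t 0 0 : ℝ))⁻¹)) := by
    apply Real.exp_le_exp.mpr
    rw [neg_le_neg_iff, ← div_eq_mul_inv, div_le_iff₀ (by positivity)]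
    nlinarith
  have h1 : ‖c t‖ ≤ Real.exp (2 * Real.pi) * ((2 * (1 + (t 0 0 : ℝ))) ^ k.natAbs * (4 * S)) := by
    have h2 := (mul_le_mul_of_nonneg_left hexp (norm_nonneg (c t))).trans hco
    rw [Real.exp_neg, ← div_eq_mul_inv, div_le_iff₀ (Real.exp_pos _)] at h2
    linarith
  refine h1.trans ?_
  have hN3 : 2 * (N : ℝ) + 1 ≤ D * (1 + (t.trace : ℝ)) := by
    push_cast at hN2
    have hn : (0 : ℝ) ≤ n := Nat.cast_nonneg n
    have e1 : 0 ≤ (n : ℝ) * (t 0 0 : ℝ) := by positivity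
    have e2 : 0 ≤ B * (t 0 0 : ℝ) := by positivity
    have e3 : 0 ≤ B * (T.trace : ℝ) := by positivity
    rw [htr, hD]
    nlinarith
  have hx : 1 + (t 0 0 : ℝ) ≤ 1 + (t.trace : ℝ) := by linarith
  have hx0 : 0 ≤ 1 + (t.trace : ℝ) := by linarith
  calc Real.exp (2 * Real.pi) * ((2 * (1 + (t 0 0 : ℝ))) ^ k.natAbs * (4 * S))
      ≤ Real.exp (2 * Real.pi) * ((2 * (1 + (t.trace : ℝ))) ^ k.natAbs *
          (4 * ((D * (1 + (t.trace : ℝ))) ^ (n + 1 + 1) * V))) := by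
        rw [hS]
        gcongr
    _ = _ := by
        rw [mul_pow, mul_pow, pow_add (1 + (t.trace : ℝ))]
        ring

theorem IsSymFM.growthQ (hc : IsSymFM (n + 1) 1 k c) : GrowthQ c :=
  GrowthQ.of_shrinkQ (n + 1) c hc.suppQ hc.symQ hc.shrinkQ

end Growth

section Convergence

variable {m : ℕ}

theorem exists_spectral {Y : Matrix (Fin m) (Fin m) ℝ} (hY : Y.PosDef) :
    ∃ (v : Fin m → Fin m → ℝ) (l : Fin m → ℝ), (∀ k, 0 < l k) ∧
      (∀ i j, Y i j = ∑ k, l k * (v k i * v k j)) ∧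
      ∀ i j, ∑ k, v k i * v k j = if i = j then 1 else 0 := by
  have hH := hY.1
  set U : Matrix (Fin m) (Fin m) ℝ := (hH.eigenvectorUnitary : Matrix (Fin m) (Fin m) ℝ) with hU
  refine ⟨fun k i => U i k, hH.eigenvalues, hY.eigenvalues_pos, fun i j => ?_, fun i j => ?_⟩
  · have h := congrFun (congrFun hH.spectral_theorem i) j
    rw [Unitary.conjStarAlgAut_apply] at h
    rw [h, Matrix.mul_apply]
    refine Finset.sum_congr rfl fun k _ => ?_
    rw [Matrix.mul_diagonal, Matrix.star_apply]
    simp [hU]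
    ring
  · have h : U * star U = 1 := Unitary.coe_mul_star_self hH.eigenvectorUnitary
    have h := congrFun (congrFun h i) j
    rw [Matrix.mul_apply, Matrix.one_apply] at h
    rw [← h]
    exact Finset.sum_congr rfl fun k _ => by simp [Matrix.star_apply]

theorem exists_trace_lower {Y : Matrix (Fin m) (Fin m) ℝ} (hY : Y.PosDef) :
    ∃ ε : ℝ, 0 < ε ∧ ∀ t : MatQ m, PosSemidefQ t →
      ε * (t.trace : ℝ) ≤ ∑ i, ∑ j, (t i j : ℝ) * Y j i := by
  obtain ⟨v, l, hl, h1, h2⟩ := exists_spectral hY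
  obtain ⟨ε, hε, hle⟩ : ∃ ε : ℝ, 0 < ε ∧ ∀ k, ε ≤ l k := by
    rcases isEmpty_or_nonempty (Fin m) with h | h
    · exact ⟨1, one_pos, fun k => h.elim k⟩
    · obtain ⟨k0, hk0⟩ := Finite.exists_min l
      exact ⟨l k0, hl k0, hk0⟩
  refine ⟨ε, hε, fun t hp => ?_⟩
  have hq := fun k => qf_toR_nonneg (t := t) hp (v k)
  have e1 : ∑ i, ∑ j, (t i j : ℝ) * Y j i = ∑ k, l k * qf (toR t) (v k) := by
    simp only [h1, qf_eq_sum, Finset.mul_sum]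
    rw [Finset.sum_congr rfl fun i _ => Finset.sum_comm, Finset.sum_comm]
    refine Finset.sum_congr rfl fun k _ => Finset.sum_congr rfl fun i _ =>
      Finset.sum_congr rfl fun j _ => ?_
    simp only [toR, Matrix.map_apply]
    ring
  have e2 : (t.trace : ℝ) = ∑ k, qf (toR t) (v k) := by
    have : (t.trace : ℝ) = ∑ i, ∑ j, (t i j : ℝ) * if i = j then 1 else 0 := by
      simp [Matrix.trace]
    rw [this]
    simp only [← h2, qf_eq_sum, Finset.mul_sum]
    rw [Finset.sum_congr rfl fun i _ => Finset.sum_comm, Finset.sum_comm]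
    refine Finset.sum_congr rfl fun k _ => Finset.sum_congr rfl fun i _ =>
      Finset.sum_congr rfl fun j _ => ?_
    simp only [toR, Matrix.map_apply]
    ring
  rw [e1, e2, Finset.mul_sum]
  exact Finset.sum_le_sum fun k _ => mul_le_mul_of_nonneg_right (hle k) (hq k)

theorem abs_entry_le_trace {t : MatQ m} (hs : t.IsSymm) (hp : PosSemidefQ t) (i j : Fin m) :
    |(t i j : ℝ)| ≤ (t.trace : ℝ) := by
  have hd := fun i => diag_nonneg (t := t) hp i
  have hle : ∀ j, t j j ≤ t.trace := fun j =>
    Finset.single_le_sum (f := fun j => t j j) (fun j _ => hd j) (Finset.mem_univ j)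
  have h : |t i j| ≤ t.trace := by
    have := abs_entry_le hs hp i j
    linarith [hle i, hle j]
  have h2 : ((|t i j| : ℚ) : ℝ) ≤ ((t.trace : ℚ) : ℝ) := Rat.cast_le.mpr h
  rwa [Rat.cast_abs] at h2

theorem summable_pi_prod {ι κ : Type*} [Fintype κ] [DecidableEq κ] [DecidableEq ι]
    {f : ι → ℝ} (h0 : ∀ i, 0 ≤ f i) (hf : Summable f) : Summable fun x : κ → ι => ∏ k, f (x k) := by
  refine summable_of_sum_le (c := ∏ _k : κ, ∑' i, f i)
    (fun x => Finset.prod_nonneg fun k _ => h0 _) fun u => ?_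
  calc ∑ x ∈ u, ∏ k, f (x k) ≤ ∑ x ∈ Fintype.piFinset fun k => u.image fun x => x k, ∏ k, f (x k) := by
        refine Finset.sum_le_sum_of_subset_of_nonneg (fun x hx => ?_)
          fun x _ _ => Finset.prod_nonneg fun k _ => h0 _
        rw [Fintype.mem_piFinset]
        exact fun k => Finset.mem_image_of_mem _ hx
    _ = ∏ k, ∑ i ∈ u.image (fun x => x k), f i := (Finset.prod_univ_sum _ _).symm
    _ ≤ _ := Finset.prod_le_prod (fun k _ => Finset.sum_nonneg fun i _ => h0 i)
        fun k _ => hf.sum_le_tsum _ fun i _ => h0 i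

theorem summable_exp_neg_abs {s : ℝ} (hs : 0 < s) : Summable fun z : ℤ => Real.exp (-s * |(z : ℝ)|) := by
  have h : Summable fun n : ℕ => Real.exp (-s * |((n : ℤ) : ℝ)|) := by
    have := summable_geometric_of_lt_one (r := Real.exp (-s)) (Real.exp_pos _).le
      (Real.exp_lt_one_iff.mpr (by linarith))
    refine this.congr fun n => ?_
    rw [← Real.exp_nat_mul]
    congr 1
    simp
    ring
  refine Summable.of_nat_of_neg h ?_
  simpa using h

theorem summable_exp_neg_trace {s : ℝ} (hs : 0 < s) :
    Summable fun t : {t : MatQ m // HalfIntegral t ∧ PosSemidefQ t} =>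
      Real.exp (-s * (t.1.trace : ℝ)) := by
  classical
  set s' : ℝ := s / (2 * (m * m : ℕ) + 1) with hs'
  have hs0 : 0 < s' := by positivity
  have h := summable_pi_prod (κ := Fin m × Fin m) (fun z => (Real.exp_pos _).le)
    (summable_exp_neg_abs hs0)
  set φ : {t : MatQ m // HalfIntegral t ∧ PosSemidefQ t} → (Fin m × Fin m → ℤ) :=
    fun t p => ⌊2 * t.1 p.1 p.2⌋ with hφ
  have hφ' : ∀ t p, (φ t p : ℚ) = 2 * t.1 p.1 p.2 := fun t p => t.2.1.floor_two_mul _ _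
  have hinj : Function.Injective φ := by
    intro t t' he
    ext i j
    have := congrFun he (i, j)
    have h2 : (φ t (i, j) : ℚ) = φ t' (i, j) := by rw [this]
    rw [hφ', hφ'] at h2
    simpa using h2
  refine (h.comp_injective hinj).of_nonneg_of_le (fun t => (Real.exp_pos _).le) fun t => ?_
  rw [Function.comp_apply, ← Real.exp_sum]
  apply Real.exp_le_exp.mpr
  have htr := trace_nonneg_of_psd t.2.2
  have hb : ∀ p, |(φ t p : ℝ)| ≤ 2 * (t.1.trace : ℝ) := fun p => by
    have : (φ t p : ℝ) = 2 * (t.1 p.1 p.2 : ℝ) := by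
      exact_mod_cast congrArg (fun q : ℚ => (q : ℝ)) (hφ' t p)
    rw [this, abs_mul, abs_two]
    have := abs_entry_le_trace t.2.1.1 t.2.2 p.1 p.2
    linarith
  have hsum : ∑ p, |(φ t p : ℝ)| ≤ (m * m : ℕ) * (2 * (t.1.trace : ℝ)) := by
    have := Finset.sum_le_card_nsmul Finset.univ (fun p => |(φ t p : ℝ)|) _ fun p _ => hb p
    simpa [Finset.card_univ] using this
  rw [← Finset.mul_sum]
  have h3 : s' * ∑ p, |(φ t p : ℝ)| ≤ s * (t.1.trace : ℝ) := by
    calc _ ≤ s' * ((m * m : ℕ) * (2 * (t.1.trace : ℝ))) := by gcongr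
      _ ≤ s' * ((2 * (m * m : ℕ) + 1) * (t.1.trace : ℝ)) := by
        refine mul_le_mul_of_nonneg_left ?_ hs0.le
        linarith
      _ = _ := by rw [hs']; field_simp
  linarith

end Convergence

section Holomorphy

variable {m : ℕ}

theorem exists_log_sq_le {A s : ℝ} (hA : 0 ≤ A) (hs : 0 < s) :
    ∃ C : ℝ, ∀ x : ℝ, 0 ≤ x → (1 + x) * Real.exp (A * Real.log (3 + x) ^ 2) ≤ C * Real.exp (s * x) := by
  have h1 : (fun x : ℝ => Real.log x ^ 2) =o[Filter.atTop] fun x : ℝ => x :=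
    Real.isLittleO_pow_log_id_atTop
  have hA1 : 0 < A + 1 := by linarith
  have h2 := h1.bound (c := s / (A + 1)) (by positivity)
  rw [Filter.eventually_atTop] at h2
  obtain ⟨X, hX⟩ := h2
  -- beyond `X` the estimate is immediate, below it everything is bounded
  have key : ∀ x : ℝ, 0 ≤ x → (A + 1) * Real.log (3 + x) ^ 2 ≤
      s * x + (3 * s + (A + 1) * Real.log (3 + |X|) ^ 2) := by
    intro x hx
    by_cases h : X ≤ 3 + x
    · have := hX _ h
      rw [Real.norm_eq_abs, Real.norm_eq_abs, abs_of_nonneg (sq_nonneg _),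
        abs_of_nonneg (by linarith), div_mul_eq_mul_div, le_div_iff₀ hA1] at this
      have h3 : 0 ≤ (A + 1) * Real.log (3 + |X|) ^ 2 := by positivity
      linarith
    · have h3 : Real.log (3 + x) ≤ Real.log (3 + |X|) :=
        Real.log_le_log (by linarith) (by linarith [le_abs_self X])
      have h4 := one_le_log_three_add hx
      have h5 : Real.log (3 + x) ^ 2 ≤ Real.log (3 + |X|) ^ 2 := by gcongr
      have := mul_le_mul_of_nonneg_left h5 hA1.le
      have : 0 ≤ s * x := by positivity
      linarith
  refine ⟨Real.exp (3 * s + (A + 1) * Real.log (3 + |X|) ^ 2), fun x hx => ?_⟩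
  have h4 := one_le_log_three_add hx
  have h5 : 1 + x ≤ Real.exp (Real.log (3 + x) ^ 2) := by
    calc 1 + x ≤ 3 + x := by linarith
      _ = Real.exp (Real.log (3 + x)) := (Real.exp_log (by linarith)).symm
      _ ≤ _ := Real.exp_le_exp.mpr (by nlinarith)
  calc (1 + x) * Real.exp (A * Real.log (3 + x) ^ 2)
      ≤ Real.exp (Real.log (3 + x) ^ 2) * Real.exp (A * Real.log (3 + x) ^ 2) := by gcongr
    _ = Real.exp ((A + 1) * Real.log (3 + x) ^ 2) := by rw [← Real.exp_add]; ring_nf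
    _ ≤ _ := by
      rw [← Real.exp_add]
      apply Real.exp_le_exp.mpr
      linarith [key x hx]

theorem norm_eMat (t : MatQ m) (τ : MatC m) :
    ‖eMat t τ‖ = Real.exp (-(2 * Real.pi * ∑ i, ∑ j, (t i j : ℝ) * (τ j i).im)) := by
  rw [eMat_eq_ee, norm_ee]
  congr 4
  rw [Complex.im_sum]
  refine Finset.sum_congr rfl fun i _ => ?_
  rw [Complex.im_sum]
  refine Finset.sum_congr rfl fun j _ => ?_
  rw [← Complex.ofReal_ratCast, Complex.im_ofReal_mul]

theorem exists_majorant {c : MatQ m → ℂ} (hs : SuppQ c) (hg : GrowthQ c) {τ₀ : MatC m}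
    (hτ₀ : τ₀ ∈ Sieg m) :
    ∃ δ : ℝ, 0 < δ ∧ ∃ u : MatQ m → ℝ, Summable u ∧ ∀ t, ∀ τ ∈ Metric.ball τ₀ δ,
      (1 + |(t.trace : ℝ)|) * ‖c t * eMat t τ‖ ≤ u t := by
  classical
  obtain ⟨ε, hε, hY⟩ := exists_trace_lower hτ₀.2
  obtain ⟨A, hA, hgr⟩ := hg
  obtain ⟨C, hC⟩ := exists_log_sq_le hA (s := ε / 4) (by positivity)
  set δ : ℝ := ε / (2 * (m * m : ℕ) + 1) with hδ
  have hδ0 : 0 < δ := by positivity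
  refine ⟨δ, hδ0, fun t => if h : HalfIntegral t ∧ PosSemidefQ t then
    C * Real.exp (-(ε / 4) * (t.trace : ℝ)) else 0, ?_, fun t τ hτ => ?_⟩
  · have h := (summable_exp_neg_trace (m := m) (s := ε / 4) (by positivity)).mul_left C
    rw [← (Subtype.val_injective).summable_iff (f := fun t : MatQ m =>
      if h : HalfIntegral t ∧ PosSemidefQ t then C * Real.exp (-(ε / 4) * (t.trace : ℝ)) else 0)
      (g := fun t : {t : MatQ m // HalfIntegral t ∧ PosSemidefQ t} => t.1)]
    · refine h.congr fun t => ?_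
      rw [Function.comp_apply, dif_pos t.2]
    · intro t ht
      rw [dif_neg]
      intro h
      exact ht ⟨⟨t, h⟩, rfl⟩
  · by_cases hct : c t = 0
    · rw [hct, zero_mul, norm_zero, mul_zero]
      beta_reduce
      split_ifs with h
      · have h1 := hC _ (trace_nonneg_of_psd h.2)
        have h2 := trace_nonneg_of_psd h.2
        have h3 : 0 ≤ C := by
          by_contra hneg
          push Not at hneg
          have : 0 ≤ C * Real.exp (ε / 4 * (t.trace : ℝ)) := le_trans (by positivity) h1
          nlinarith [Real.exp_pos (ε / 4 * (t.trace : ℝ))]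
        positivity
      · rfl
    have hsup := hs t hct
    beta_reduce
    rw [dif_pos hsup, norm_mul, norm_eMat]
    have htr := trace_nonneg_of_psd hsup.2
    have hlow := hY t hsup.2
    rw [abs_of_nonneg htr]
    have hdiff : |∑ i, ∑ j, (t i j : ℝ) * ((τ j i).im - (τ₀ j i).im)| ≤
        (m * m : ℕ) * ((t.trace : ℝ) * δ) := by
      calc _ ≤ ∑ i : Fin m, ∑ j : Fin m, (t.trace : ℝ) * δ := by
            refine (Finset.abs_sum_le_sum_abs _ _).trans (Finset.sum_le_sum fun i _ =>
              (Finset.abs_sum_le_sum_abs _ _).trans (Finset.sum_le_sum fun j _ => ?_))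
            rw [abs_mul]
            refine mul_le_mul (abs_entry_le_trace hsup.1.1 hsup.2 i j) ?_ (abs_nonneg _) htr
            rw [← Complex.sub_im]
            refine (Complex.abs_im_le_norm _).trans ?_
            have h1 : ‖(τ - τ₀) j i‖ ≤ ‖τ - τ₀‖ := Matrix.norm_entry_le_entrywise_sup_norm _
            rw [mem_ball_iff_norm] at hτ
            exact h1.trans hτ.le
        _ = _ := by simp; ring
    have hsub : ∑ i, ∑ j, (t i j : ℝ) * ((τ j i).im - (τ₀ j i).im) =
        (∑ i, ∑ j, (t i j : ℝ) * (τ j i).im) - ∑ i, ∑ j, (t i j : ℝ) * (τ₀ j i).im := by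
      simp only [mul_sub, Finset.sum_sub_distrib]
    rw [hsub] at hdiff
    have hδm : (m * m : ℕ) * ((t.trace : ℝ) * δ) ≤ ε / 2 * (t.trace : ℝ) := by
      have h1 : (m * m : ℕ) * δ ≤ ε / 2 := by
        rw [hδ, ← mul_div_assoc, div_le_iff₀ (by positivity)]
        linarith
      calc (m * m : ℕ) * ((t.trace : ℝ) * δ) = (m * m : ℕ) * δ * (t.trace : ℝ) := by ring
        _ ≤ _ := by gcongr
    have hfin : ε / 2 * (t.trace : ℝ) ≤ ∑ i, ∑ j, (t i j : ℝ) * (τ j i).im := by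
      have := (abs_le.mp hdiff).1
      have hlow' : ε * (t.trace : ℝ) ≤ ∑ i, ∑ j, (t i j : ℝ) * (τ₀ j i).im := hlow
      linarith
    have hexp : Real.exp (-(2 * Real.pi * ∑ i, ∑ j, (t i j : ℝ) * (τ j i).im)) ≤
        Real.exp (-(ε / 2) * (t.trace : ℝ)) := by
      apply Real.exp_le_exp.mpr
      have h0 : 0 ≤ ε / 2 * (t.trace : ℝ) := by positivity
      have hp3 := Real.pi_gt_three
      nlinarith
    have h1 := hgr t hct
    calc (1 + (t.trace : ℝ)) * (‖c t‖ * _)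
        ≤ (1 + (t.trace : ℝ)) * (Real.exp (A * Real.log (3 + (t.trace : ℝ)) ^ 2) *
            Real.exp (-(ε / 2) * (t.trace : ℝ))) := by gcongr
      _ ≤ C * Real.exp (ε / 4 * (t.trace : ℝ)) * Real.exp (-(ε / 2) * (t.trace : ℝ)) := by
          rw [← mul_assoc]
          exact mul_le_mul_of_nonneg_right (hC _ htr) (Real.exp_pos _).le
      _ = _ := by
          rw [mul_assoc, ← Real.exp_add]
          ring_nf

/-- The linear form `τ ↦ tr(tτ)`. -/
def traceForm (t : MatQ m) : (Fin m → Fin m → ℂ) →L[ℂ] ℂ :=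
  LinearMap.toContinuousLinearMap
    { toFun := fun τ => ∑ i, ∑ j, (t i j : ℂ) * τ j i
      map_add' := fun x y => by simp only [Pi.add_apply, mul_add, Finset.sum_add_distrib]
      map_smul' := fun a x => by
        simp only [Pi.smul_apply, smul_eq_mul, Finset.mul_sum, RingHom.id_apply, mul_left_comm] }

theorem traceForm_apply (t : MatQ m) (τ : Fin m → Fin m → ℂ) : traceForm t τ = ∑ i, ∑ j, (t i j : ℂ) * τ j i := rfl

theorem norm_traceForm_le {t : MatQ m} (hs : t.IsSymm) (hp : PosSemidefQ t) :
    ‖traceForm t‖ ≤ (m * m : ℕ) * (t.trace : ℝ) := by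
  have htr := trace_nonneg_of_psd hp
  refine ContinuousLinearMap.opNorm_le_bound _ (by positivity) fun τ => ?_
  rw [traceForm_apply]
  calc _ ≤ ∑ i : Fin m, ∑ j : Fin m, (t.trace : ℝ) * ‖τ‖ := by
        refine (norm_sum_le _ _).trans (Finset.sum_le_sum fun i _ =>
          (norm_sum_le _ _).trans (Finset.sum_le_sum fun j _ => ?_))
        rw [norm_mul]
        refine mul_le_mul ?_ ((norm_le_pi_norm (τ j) i).trans (norm_le_pi_norm τ j)) (norm_nonneg _) htr
        rw [Complex.norm_ratCast]
        exact abs_entry_le_trace hs hp i j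
    _ = _ := by simp; ring

theorem hasFDerivAt_eMat (t : MatQ m) (τ : Fin m → Fin m → ℂ) :
    HasFDerivAt (fun τ : Fin m → Fin m → ℂ => eMat t τ) ((eMat t τ * (2 * Real.pi * Complex.I)) • traceForm t) τ := by
  have h : (fun τ : Fin m → Fin m → ℂ => eMat t τ) = fun τ =>
      Complex.exp (2 * Real.pi * Complex.I * traceForm t τ) := by
    ext τ
    exact eMat_eq_ee t τ
  rw [h]
  have h2 := (((traceForm t).hasFDerivAt (x := τ)).const_mul (2 * Real.pi * Complex.I)).cexp
  rw [show eMat t τ = Complex.exp (2 * Real.pi * Complex.I * traceForm t τ) from congrFun h τ]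
  rwa [smul_smul] at h2

/-- The sum of the Fourier series with coefficients `c`. -/
def fourierSum (c : MatQ m → ℂ) (τ : MatC m) : ℂ := ∑' t, c t * eMat t τ

theorem hasSum_fourierSum {c : MatQ m → ℂ} (hs : SuppQ c) (hg : GrowthQ c) {τ : MatC m}
    (hτ : τ ∈ Sieg m) : HasSum (fun t => c t * eMat t τ) (fourierSum c τ) := by
  obtain ⟨δ, hδ, u, hu, hb⟩ := exists_majorant hs hg hτ
  refine (Summable.of_norm_bounded hu fun t => ?_).hasSum
  have := hb t τ (Metric.mem_ball_self hδ)
  nlinarith [abs_nonneg (t.trace : ℝ), norm_nonneg (c t * eMat t τ)]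

theorem differentiableAt_fourierSum {c : MatQ m → ℂ} (hs : SuppQ c) (hg : GrowthQ c) {τ : MatC m}
    (hτ : τ ∈ Sieg m) : DifferentiableAt ℂ (fourierSum c) τ := by
  obtain ⟨δ, hδ, u, hu, hb⟩ := exists_majorant hs hg hτ
  refine (hasFDerivAt_tsum_of_isPreconnected (𝕜 := ℂ) (E := Fin m → Fin m → ℂ)
    (f := fun t τ => c t * eMat t τ)
    (f' := fun t τ => c t • ((eMat t τ * (2 * Real.pi * Complex.I)) • traceForm t))
    (hu.mul_left (2 * Real.pi * (m * m : ℕ)))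
    Metric.isOpen_ball (convex_ball τ δ).isPreconnected (fun t x _ => (hasFDerivAt_eMat t x).const_mul _)
    (fun t x hx => ?_) (Metric.mem_ball_self hδ) (hasSum_fourierSum hs hg hτ).summable
    (Metric.mem_ball_self hδ)).differentiableAt
  by_cases hct : c t = 0
  · have := hb t x hx
    simp only [hct, zero_mul, norm_zero, mul_zero] at this
    have hz : c t • ((eMat t x * (2 * Real.pi * Complex.I)) • traceForm t) = 0 := by
      rw [hct]
      exact zero_smul ℂ ((eMat t x * (2 * Real.pi * Complex.I)) • traceForm t)
    refine le_trans (le_of_eq ?_) (mul_nonneg (by positivity) this)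
    exact (congrArg norm hz).trans norm_zero
  obtain ⟨hh, hp⟩ := hs t hct
  have htr := trace_nonneg_of_psd hp
  have h1 := hb t x hx
  rw [abs_of_nonneg htr, norm_mul] at h1
  rw [norm_smul, norm_smul, norm_mul]
  have h2 : ‖(2 * Real.pi * Complex.I : ℂ)‖ = 2 * Real.pi := by
    simp [abs_of_pos Real.pi_pos]
  rw [h2]
  have hpi := Real.pi_pos
  calc ‖c t‖ * (‖eMat t x‖ * (2 * Real.pi) * ‖traceForm t‖)
      ≤ ‖c t‖ * (‖eMat t x‖ * (2 * Real.pi) * ((m * m : ℕ) * (t.trace : ℝ))) := by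
        gcongr
        exact norm_traceForm_le hh.1 hp
    _ = 2 * Real.pi * (m * m : ℕ) * ((t.trace : ℝ) * (‖c t‖ * ‖eMat t x‖)) := by ring
    _ ≤ 2 * Real.pi * (m * m : ℕ) * u t := by
        gcongr
        nlinarith [mul_nonneg (norm_nonneg (c t)) (norm_nonneg (eMat t x))]

end Holomorphy

section Generation

variable {m : ℕ}

/-- The unipotent block matrix `(1, S; 0, 1)`. -/
def upGen (S : Matrix (Fin m) (Fin m) ℤ) : Matrix (Fin m ⊕ Fin m) (Fin m ⊕ Fin m) ℤ :=
  Matrix.fromBlocks 1 S 0 1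

/-- The unipotent block matrix `(1, 0; S, 1)`. -/
def lowGen (S : Matrix (Fin m) (Fin m) ℤ) : Matrix (Fin m ⊕ Fin m) (Fin m ⊕ Fin m) ℤ :=
  Matrix.fromBlocks 1 0 S 1

/-- The block diagonal matrix `(U, 0; 0, V)`. -/
def glGen (U V : Matrix (Fin m) (Fin m) ℤ) : Matrix (Fin m ⊕ Fin m) (Fin m ⊕ Fin m) ℤ :=
  Matrix.fromBlocks U 0 0 V

theorem SpZ_mul {γ δ : Matrix (Fin m ⊕ Fin m) (Fin m ⊕ Fin m) ℤ} (hγ : γ ∈ SpZ m)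
    (hδ : δ ∈ SpZ m) : γ * δ ∈ SpZ m := by
  simp only [SpZ, Set.mem_ofPred_eq] at *
  calc (γ * δ)ᵀ * sympJ m * (γ * δ) = δᵀ * (γᵀ * sympJ m * γ) * δ := by
        rw [Matrix.transpose_mul]; simp only [Matrix.mul_assoc]
    _ = _ := by rw [hγ, hδ]

theorem upGen_mem {S : Matrix (Fin m) (Fin m) ℤ} (hS : S.IsSymm) : upGen S ∈ SpZ m := by
  simp only [SpZ, Set.mem_ofPred_eq, upGen, sympJ, fromBlocks_transpose, fromBlocks_multiply]
  congr 1 <;> simp [hS.eq]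

theorem lowGen_mem {S : Matrix (Fin m) (Fin m) ℤ} (hS : S.IsSymm) : lowGen S ∈ SpZ m := by
  simp only [SpZ, Set.mem_ofPred_eq, lowGen, sympJ, fromBlocks_transpose, fromBlocks_multiply]
  congr 1 <;> simp [hS.eq]

theorem glGen_mem {U V : Matrix (Fin m) (Fin m) ℤ} (h : U * Vᵀ = 1) : glGen U V ∈ SpZ m := by
  have h1 : Vᵀ * U = 1 := mul_eq_one_comm.mp h
  have h2 : Uᵀ * V = 1 := by
    have := congrArg Matrix.transpose h1
    rwa [Matrix.transpose_mul, Matrix.transpose_transpose, Matrix.transpose_one] at this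
  simp only [SpZ, Set.mem_ofPred_eq, glGen, sympJ, fromBlocks_transpose, fromBlocks_multiply]
  congr 1 <;> simp [h1, h2]

theorem SpZ_entry {γ : Matrix (Fin m ⊕ Fin m) (Fin m ⊕ Fin m) ℤ} (h : γ ∈ SpZ m)
    (x y : Fin m ⊕ Fin m) :
    ∑ p, (γ (Sum.inl p) x * γ (Sum.inr p) y - γ (Sum.inr p) x * γ (Sum.inl p) y) = sympJ m x y := by
  have h' : γᵀ * sympJ m * γ = sympJ m := h
  rw [← h']
  have e : γᵀ * sympJ m * γ = γᵀ * (sympJ m * γ) := Matrix.mul_assoc _ _ _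
  rw [e, Matrix.mul_apply, Fintype.sum_sum_type]
  have h1 : ∀ p : Fin m, (sympJ m * γ) (Sum.inl p) y = γ (Sum.inr p) y := by
    intro p
    simp [sympJ, Matrix.mul_apply, Matrix.one_apply]
  have h2 : ∀ p : Fin m, (sympJ m * γ) (Sum.inr p) y = -γ (Sum.inl p) y := by
    intro p
    simp [sympJ, Matrix.mul_apply, Matrix.one_apply]
  simp only [h1, h2, Matrix.transpose_apply, Finset.sum_sub_distrib, mul_neg,
    Finset.sum_neg_distrib]
  ring

theorem upGen_single_mul_inl (i : Fin m) (x : ℤ) (γ : Matrix (Fin m ⊕ Fin m) (Fin m ⊕ Fin m) ℤ)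
    (p : Fin m) (y : Fin m ⊕ Fin m) : (upGen (Matrix.single i i x) * γ) (Sum.inl p) y =
      γ (Sum.inl p) y + if p = i then x * γ (Sum.inr i) y else 0 := by
  rw [upGen, Matrix.mul_apply, Fintype.sum_sum_type]
  by_cases h : p = i
  · subst h
    simp [Matrix.one_apply, Matrix.single_apply]
  · simp [Matrix.one_apply, h, Ne.symm h]

theorem upGen_mul_inr (S : Matrix (Fin m) (Fin m) ℤ) (γ : Matrix (Fin m ⊕ Fin m) (Fin m ⊕ Fin m) ℤ)
    (p : Fin m) (y : Fin m ⊕ Fin m) : (upGen S * γ) (Sum.inr p) y = γ (Sum.inr p) y := by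
  rw [upGen, Matrix.mul_apply, Fintype.sum_sum_type]
  simp [Matrix.one_apply]

theorem lowGen_single_mul_inr (i : Fin m) (x : ℤ) (γ : Matrix (Fin m ⊕ Fin m) (Fin m ⊕ Fin m) ℤ)
    (p : Fin m) (y : Fin m ⊕ Fin m) : (lowGen (Matrix.single i i x) * γ) (Sum.inr p) y =
      γ (Sum.inr p) y + if p = i then x * γ (Sum.inl i) y else 0 := by
  rw [lowGen, Matrix.mul_apply, Fintype.sum_sum_type]
  by_cases h : p = i
  · subst h
    simp [Matrix.one_apply, Matrix.single_apply, add_comm]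
  · simp [Matrix.one_apply, h, Ne.symm h]

theorem lowGen_mul_inl (S : Matrix (Fin m) (Fin m) ℤ) (γ : Matrix (Fin m ⊕ Fin m) (Fin m ⊕ Fin m) ℤ)
    (p : Fin m) (y : Fin m ⊕ Fin m) : (lowGen S * γ) (Sum.inl p) y = γ (Sum.inl p) y := by
  rw [lowGen, Matrix.mul_apply, Fintype.sum_sum_type]
  simp [Matrix.one_apply]

/-- The elementary row operation adding `x` times row `j` to row `i`, as a symplectic matrix. -/
def elGen (i j : Fin m) (x : ℤ) : Matrix (Fin m ⊕ Fin m) (Fin m ⊕ Fin m) ℤ :=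
  glGen (Matrix.transvection i j x) (Matrix.transvection j i (-x))

theorem elGen_mul_inl (i j : Fin m) (x : ℤ) (γ : Matrix (Fin m ⊕ Fin m) (Fin m ⊕ Fin m) ℤ)
    (p : Fin m) (y : Fin m ⊕ Fin m) : (elGen i j x * γ) (Sum.inl p) y =
      γ (Sum.inl p) y + if p = i then x * γ (Sum.inl j) y else 0 := by
  rw [elGen, glGen, Matrix.mul_apply, Fintype.sum_sum_type]
  by_cases h : p = i
  · subst h
    simp [Matrix.transvection, Matrix.one_apply, Matrix.single_apply, add_mul,
      Finset.sum_add_distrib]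
  · simp [Matrix.transvection, Matrix.one_apply, h, Ne.symm h]

theorem elGen_mul_inr (i j : Fin m) (x : ℤ) (γ : Matrix (Fin m ⊕ Fin m) (Fin m ⊕ Fin m) ℤ)
    (p : Fin m) (y : Fin m ⊕ Fin m) : (elGen i j x * γ) (Sum.inr p) y =
      γ (Sum.inr p) y + if p = j then -x * γ (Sum.inr i) y else 0 := by
  rw [elGen, glGen, Matrix.mul_apply, Fintype.sum_sum_type]
  by_cases h : p = j
  · subst h
    simp [Matrix.transvection, Matrix.one_apply, Matrix.single_apply, add_mul,
      Finset.sum_add_distrib]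
  · simp [Matrix.transvection, Matrix.one_apply, h, Ne.symm h]

theorem elGen_mem {i j : Fin m} (h : i ≠ j) (x : ℤ) : elGen i j x ∈ SpZ m := by
  apply glGen_mem
  have : (Matrix.transvection j i (-x))ᵀ = Matrix.transvection i j (-x) := by
    simp [Matrix.transvection]
  rw [this, Matrix.transvection_mul_transvection_same _ _ h]
  simp

/-- The Euclidean algorithm, for a state space with two integer registers. -/
theorem euclid_descent {X : Type*} (P I : X → Prop) (u v : X → ℤ) (f h : ℤ → X → X)
    (hf : ∀ x γ, I γ → I (f x γ) ∧ u (f x γ) = u γ + x * v γ ∧ v (f x γ) = v γ ∧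
      (P (f x γ) → P γ))
    (hh : ∀ x γ, I γ → I (h x γ) ∧ u (h x γ) = u γ ∧ v (h x γ) = v γ + x * u γ ∧
      (P (h x γ) → P γ))
    (h0 : ∀ γ, I γ → v γ = 0 → P γ) : ∀ γ, I γ → P γ := by
  suffices H : ∀ N : ℕ, ∀ γ, I γ → (v γ).natAbs = N → P γ from fun γ hγ => H _ γ hγ rfl
  intro N
  induction N using Nat.strong_induction_on with
  | _ N ih =>
    intro γ hγ hN
    by_cases hv : v γ = 0
    · exact h0 γ hγ hv
    obtain ⟨i1, u1, v1, p1⟩ := hf (-(u γ / v γ)) γ hγ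
    set γ1 := f (-(u γ / v γ)) γ with hγ1
    have hu1 : u γ1 = u γ % v γ := by rw [u1, Int.emod_def]; ring
    apply p1
    by_cases hu : u γ1 = 0
    · obtain ⟨i2, u2, v2, p2⟩ := hf 1 γ1 i1
      apply p2
      obtain ⟨i3, u3, v3, p3⟩ := hh (-1) _ i2
      apply p3
      apply h0 _ i3
      rw [v3, v2, u2, hu]; ring
    · obtain ⟨i2, u2, v2, p2⟩ := hh (-(v γ1 / u γ1)) γ1 i1
      have hv2 : v (h (-(v γ1 / u γ1)) γ1) = v γ1 % u γ1 := by rw [v2, Int.emod_def]; ring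
      refine p2 (ih _ ?_ _ i2 rfl)
      have b1 := Int.emod_nonneg (u γ) hv
      have b2 := Int.emod_lt_abs (u γ) hv
      have b3 := Int.emod_nonneg (v γ1) hu
      have b4 := Int.emod_lt_abs (v γ1) hu
      rw [← hu1] at b1 b2
      rw [← hv2] at b3 b4
      rw [abs_of_nonneg b1] at b4
      rw [← hN]
      zify
      rw [abs_of_nonneg b3]
      linarith

/-- The first `j` columns have vanishing lower part and upper triangular upper part. -/
def TriSp (j : ℕ) (γ : Matrix (Fin m ⊕ Fin m) (Fin m ⊕ Fin m) ℤ) : Prop :=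
  ∀ l : Fin m, l.val < j → (∀ p, γ (Sum.inr p) (Sum.inl l) = 0) ∧
    ∀ p, l < p → γ (Sum.inl p) (Sum.inl l) = 0

theorem TriSp.inr_eq_zero {j : ℕ} {γ : Matrix (Fin m ⊕ Fin m) (Fin m ⊕ Fin m) ℤ}
    (hγ : γ ∈ SpZ m) (h : TriSp j γ) : ∀ i : Fin m, i.val < j → ∀ x : Fin m ⊕ Fin m,
      (∀ l : Fin m, l ≤ i → sympJ m (Sum.inl l) x = 0) → γ (Sum.inr i) x = 0 := by
  suffices H : ∀ N : ℕ, ∀ i : Fin m, i.val = N → i.val < j → ∀ x : Fin m ⊕ Fin m,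
      (∀ l : Fin m, l ≤ i → sympJ m (Sum.inl l) x = 0) → γ (Sum.inr i) x = 0 from
    fun i => H _ i rfl
  intro N
  induction N using Nat.strong_induction_on with
  | _ N ih =>
    intro i hiN hij x hx
    have red : ∀ y : Fin m ⊕ Fin m, (∀ l : Fin m, l < i → sympJ m (Sum.inl l) y = 0) →
        γ (Sum.inl i) (Sum.inl i) * γ (Sum.inr i) y = sympJ m (Sum.inl i) y := by
      intro y hy
      rw [← SpZ_entry hγ, Finset.sum_eq_single i]
      · rw [(h i hij).1 i, zero_mul, sub_zero]
      · intro p _ hp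
        rw [(h i hij).1 p, zero_mul, sub_zero]
        rcases lt_or_gt_of_ne hp with hlt | hgt
        · rw [ih p.val (hiN ▸ hlt) p rfl (lt_trans hlt hij) y fun l hl => hy l (lt_of_le_of_lt hl hlt),
            mul_zero]
        · rw [(h i hij).2 p hgt, zero_mul]
      · simp
    have hne : γ (Sum.inl i) (Sum.inl i) ≠ 0 := by
      intro h0
      have := red (Sum.inr i) fun l hl => by simp [sympJ, hl.ne]
      rw [h0, zero_mul] at this
      simp [sympJ] at this
    have := red x fun l hl => hx l hl.le
    rw [hx i le_rfl] at this
    exact (mul_eq_zero.mp this).resolve_left hne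

theorem TriSp.succ_step {P : Matrix (Fin m ⊕ Fin m) (Fin m ⊕ Fin m) ℤ → Prop}
    (hT : ∀ i x γ, P (upGen (Matrix.single i i x) * γ) → P γ)
    (hL : ∀ i x γ, P (lowGen (Matrix.single i i x) * γ) → P γ)
    (hE : ∀ i j, i ≠ j → ∀ x γ, P (elGen i j x * γ) → P γ) (J : Fin m)
    (hP : ∀ γ ∈ SpZ m, TriSp (J.val + 1) γ → P γ) : ∀ γ ∈ SpZ m, TriSp J.val γ → P γ := by
  classical
  have stage2 : ∀ s : Finset (Fin m), ∀ γ ∈ SpZ m, TriSp J.val γ →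
      (∀ p, γ (Sum.inr p) (Sum.inl J) = 0) →
      (∀ p ∉ s, J < p → γ (Sum.inl p) (Sum.inl J) = 0) → P γ := by
    intro s
    induction s using Finset.induction_on with
    | empty =>
      intro γ hγ ht hc ha
      refine hP γ hγ fun l hl => ?_
      rcases Nat.lt_succ_iff_lt_or_eq.mp hl with h | h
      · exact ht l h
      · obtain rfl : l = J := Fin.ext h
        exact ⟨hc, fun p hp => ha p (Finset.notMem_empty p) hp⟩
    | insert i s his ih =>
      intro γ hγ ht hc ha
      by_cases hJi : J < i
      swap
      · exact ih γ hγ ht hc fun p hp hJp => ha p (by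
          rw [Finset.mem_insert]; rintro (rfl | h)
          · exact hJi hJp
          · exact hp h) hJp
      refine euclid_descent P (fun γ => γ ∈ SpZ m ∧ TriSp J.val γ ∧
        (∀ p, γ (Sum.inr p) (Sum.inl J) = 0) ∧
        ∀ p ∉ insert i s, J < p → γ (Sum.inl p) (Sum.inl J) = 0)
        (fun γ => γ (Sum.inl J) (Sum.inl J)) (fun γ => γ (Sum.inl i) (Sum.inl J))
        (fun x γ => elGen J i x * γ) (fun x γ => elGen i J x * γ) ?_ ?_ ?_ γ ⟨hγ, ht, hc, ha⟩
      · rintro x γ ⟨hγ, ht, hc, ha⟩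
        refine ⟨⟨SpZ_mul (elGen_mem hJi.ne x) hγ, fun l hl => ⟨fun p => ?_, fun p hp => ?_⟩,
          fun p => ?_, fun p hp hJp => ?_⟩, ?_, ?_, hE J i hJi.ne x γ⟩
        · simp [elGen_mul_inr, (ht l hl).1]
        · simp [elGen_mul_inl, (ht l hl).2 p hp, (ht l hl).2 i (lt_trans hl hJi)]
        · simp [elGen_mul_inr, hc]
        · simp [elGen_mul_inl, hJp.ne', ha p hp hJp]
        · simp [elGen_mul_inl]
        · simp [elGen_mul_inl, hJi.ne']
      · rintro x γ ⟨hγ, ht, hc, ha⟩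
        refine ⟨⟨SpZ_mul (elGen_mem hJi.ne' x) hγ, fun l hl => ⟨fun p => ?_, fun p hp => ?_⟩,
          fun p => ?_, fun p hp hJp => ?_⟩, ?_, ?_, hE i J hJi.ne' x γ⟩
        · simp [elGen_mul_inr, (ht l hl).1]
        · simp [elGen_mul_inl, (ht l hl).2 p hp, (ht l hl).2 J hl]
        · simp [elGen_mul_inr, hc]
        · have : p ≠ i := fun h => hp (h ▸ Finset.mem_insert_self _ _)
          simp [elGen_mul_inl, this, ha p hp hJp]
        · simp [elGen_mul_inl, hJi.ne]
        · simp [elGen_mul_inl]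
      · rintro γ ⟨hγ, ht, hc, ha⟩ hv
        refine ih γ hγ ht hc fun p hp hJp => ?_
        by_cases hpi : p = i
        · rw [hpi]; exact hv
        · exact ha p (by simp [hpi, hp]) hJp
  have stage1 : ∀ s : Finset (Fin m), ∀ γ ∈ SpZ m, TriSp J.val γ →
      (∀ p ∉ s, J ≤ p → γ (Sum.inr p) (Sum.inl J) = 0) → P γ := by
    intro s
    induction s using Finset.induction_on with
    | empty =>
      intro γ hγ ht hc
      refine stage2 Finset.univ γ hγ ht (fun p => ?_) fun p hp => absurd (Finset.mem_univ p) hp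
      by_cases hp : J ≤ p
      · exact hc p (Finset.notMem_empty p) hp
      · exact ht.inr_eq_zero hγ p (not_le.mp hp) _ fun l _ => by simp [sympJ]
    | insert i s his ih =>
      intro γ hγ ht hc
      by_cases hJi : J ≤ i
      swap
      · exact ih γ hγ ht fun p hp hJp => hc p (by
          rw [Finset.mem_insert]; rintro (rfl | h)
          · exact hJi hJp
          · exact hp h) hJp
      have hsym : ∀ x : ℤ, (Matrix.single i i x).IsSymm := fun x => by
        rw [Matrix.IsSymm, Matrix.transpose_single]
      refine euclid_descent P (fun γ => γ ∈ SpZ m ∧ TriSp J.val γ ∧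
        ∀ p ∉ insert i s, J ≤ p → γ (Sum.inr p) (Sum.inl J) = 0)
        (fun γ => γ (Sum.inl i) (Sum.inl J)) (fun γ => γ (Sum.inr i) (Sum.inl J))
        (fun x γ => upGen (Matrix.single i i x) * γ) (fun x γ => lowGen (Matrix.single i i x) * γ)
        ?_ ?_ ?_ γ ⟨hγ, ht, hc⟩
      · rintro x γ ⟨hγ, ht, hc⟩
        refine ⟨⟨SpZ_mul (upGen_mem (hsym x)) hγ, fun l hl => ⟨fun p => ?_, fun p hp => ?_⟩,
          fun p hp hJp => ?_⟩, ?_, ?_, hT i x γ⟩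
        · simp [upGen_mul_inr, (ht l hl).1]
        · simp [upGen_single_mul_inl, (ht l hl).2 p hp, (ht l hl).1]
        · simp [upGen_mul_inr, hc p hp hJp]
        · simp [upGen_single_mul_inl]
        · simp [upGen_mul_inr]
      · rintro x γ ⟨hγ, ht, hc⟩
        refine ⟨⟨SpZ_mul (lowGen_mem (hsym x)) hγ, fun l hl => ⟨fun p => ?_, fun p hp => ?_⟩,
          fun p hp hJp => ?_⟩, ?_, ?_, hL i x γ⟩
        · simp [lowGen_single_mul_inr, (ht l hl).1, (ht l hl).2 i (lt_of_lt_of_le hl hJi)]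
        · simp [lowGen_mul_inl, (ht l hl).2 p hp]
        · have : p ≠ i := fun h => hp (h ▸ Finset.mem_insert_self _ _)
          simp [lowGen_single_mul_inr, this, hc p hp hJp]
        · simp [lowGen_mul_inl]
        · simp [lowGen_single_mul_inr]
      · rintro γ ⟨hγ, ht, hc⟩ hv
        refine ih γ hγ ht fun p hp hJp => ?_
        by_cases hpi : p = i
        · rw [hpi]; exact hv
        · exact hc p (by simp [hpi, hp]) hJp
  exact fun γ hγ ht => stage1 Finset.univ γ hγ ht fun p hp => absurd (Finset.mem_univ p) hp

/-- Generation of the integral symplectic group, as an induction principle. -/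
theorem SpZ_induction {P : Matrix (Fin m ⊕ Fin m) (Fin m ⊕ Fin m) ℤ → Prop}
    (hT : ∀ i x γ, P (upGen (Matrix.single i i x) * γ) → P γ)
    (hL : ∀ i x γ, P (lowGen (Matrix.single i i x) * γ) → P γ)
    (hE : ∀ i j, i ≠ j → ∀ x γ, P (elGen i j x * γ) → P γ)
    (hB : ∀ γ ∈ SpZ m, (∀ p q, γ (Sum.inr p) (Sum.inl q) = 0) → P γ) : ∀ γ ∈ SpZ m, P γ := by
  have key : ∀ i j : ℕ, i + j = m → ∀ γ ∈ SpZ m, TriSp j γ → P γ := by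
    intro i
    induction i with
    | zero =>
      intro j hj γ hγ ht
      exact hB γ hγ fun p q => (ht q (by omega)).1 p
    | succ i ih =>
      intro j hj
      exact TriSp.succ_step hT hL hE ⟨j, by omega⟩ (ih (j + 1) (by omega))
  exact fun γ hγ => key m 0 (by omega) γ hγ fun l hl => absurd hl (Nat.not_lt_zero _)

end Generation

section Automorphy

variable {m : ℕ}

theorem jmat_mul {γ δ : Matrix (Fin m ⊕ Fin m) (Fin m ⊕ Fin m) ℤ} {τ : MatC m}
    (h : jden γ τ ≠ 0) : jmat (δ * γ) τ = jmat δ (actSp γ τ) * jmat γ τ := by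
  have hC : blkC (δ * γ) = blkC δ * blkA γ + blkD δ * blkC γ := by
    ext i j
    simp [blkC, blkA, blkD, Matrix.mul_apply, Fintype.sum_sum_type]
  have hD : blkD (δ * γ) = blkC δ * blkB γ + blkD δ * blkD γ := by
    ext i j
    simp [blkC, blkB, blkD, Matrix.mul_apply, Fintype.sum_sum_type]
  have hact : actSp γ τ * jmat γ τ = blkA γ * τ + blkB γ :=
    Matrix.nonsing_inv_mul_cancel_right _ _ (Ne.isUnit h)
  have e : jmat δ (actSp γ τ) * jmat γ τ = blkC δ * (actSp γ τ * jmat γ τ) + blkD δ * jmat γ τ := by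
    rw [jmat, Matrix.add_mul, Matrix.mul_assoc]
  rw [e, hact, jmat, jmat, hC, hD]
  simp only [Matrix.add_mul, Matrix.mul_add, Matrix.mul_assoc]
  abel

theorem num_mul {γ δ : Matrix (Fin m ⊕ Fin m) (Fin m ⊕ Fin m) ℤ} {τ : MatC m}
    (h : jden γ τ ≠ 0) : blkA (δ * γ) * τ + blkB (δ * γ) =
      (blkA δ * actSp γ τ + blkB δ) * jmat γ τ := by
  have hA : blkA (δ * γ) = blkA δ * blkA γ + blkB δ * blkC γ := by
    ext i j
    simp [blkC, blkA, blkB, Matrix.mul_apply, Fintype.sum_sum_type]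
  have hB : blkB (δ * γ) = blkA δ * blkB γ + blkB δ * blkD γ := by
    ext i j
    simp [blkA, blkB, blkD, Matrix.mul_apply, Fintype.sum_sum_type]
  have hact : actSp γ τ * jmat γ τ = blkA γ * τ + blkB γ :=
    Matrix.nonsing_inv_mul_cancel_right _ _ (Ne.isUnit h)
  rw [Matrix.add_mul, Matrix.mul_assoc, hact, jmat, hA, hB]
  simp only [Matrix.add_mul, Matrix.mul_add, Matrix.mul_assoc]
  abel

theorem actSp_mul {γ δ : Matrix (Fin m ⊕ Fin m) (Fin m ⊕ Fin m) ℤ} {τ : MatC m}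
    (h : jden γ τ ≠ 0) : actSp (δ * γ) τ = actSp δ (actSp γ τ) := by
  rw [actSp, num_mul h, jmat_mul h, Matrix.mul_inv_rev, Matrix.mul_assoc,
    ← Matrix.mul_assoc (jmat γ τ), Matrix.mul_nonsing_inv _ (Ne.isUnit h), Matrix.one_mul]
  rfl

/-- `F` transforms with weight `k` under the symplectic matrix `γ`. -/
def Automorphic (F : MatC m → ℂ) (k : ℤ) (γ : Matrix (Fin m ⊕ Fin m) (Fin m ⊕ Fin m) ℤ) : Prop :=
  ∀ τ ∈ Sieg m, jden γ τ ≠ 0 ∧ actSp γ τ ∈ Sieg m ∧ F (actSp γ τ) = jden γ τ ^ k * F τ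

theorem Automorphic.mul {F : MatC m → ℂ} {k : ℤ} {γ δ : Matrix (Fin m ⊕ Fin m) (Fin m ⊕ Fin m) ℤ}
    (hδ : Automorphic F k δ) (hγ : Automorphic F k γ) : Automorphic F k (δ * γ) := by
  intro τ hτ
  obtain ⟨h1, h2, h3⟩ := hγ τ hτ
  obtain ⟨h4, h5, h6⟩ := hδ _ h2
  have e : jden (δ * γ) τ = jden δ (actSp γ τ) * jden γ τ := by
    rw [jden, jmat_mul h1, Matrix.det_mul]; rfl
  rw [actSp_mul h1, e]
  exact ⟨mul_ne_zero h4 h1, h5, by rw [h6, h3, mul_zpow, mul_assoc]⟩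

theorem actSp_upGen (S : Matrix (Fin m) (Fin m) ℤ) (τ : MatC m) :
    jden (upGen S) τ = 1 ∧ actSp (upGen S) τ = τ + S.map fun z => (z : ℂ) := by
  have hA : blkA (upGen S) = 1 := by
    ext i j; simp [blkA, upGen, Matrix.one_apply]
  have hB : blkB (upGen S) = S.map fun z => (z : ℂ) := rfl
  have hC : blkC (upGen S) = 0 := by
    ext i j; simp [blkC, upGen]
  have hD : blkD (upGen S) = 1 := by
    ext i j; simp [blkD, upGen, Matrix.one_apply]
  have hj : jmat (upGen S) τ = 1 := by rw [jmat, hC, hD, Matrix.zero_mul, zero_add]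
  rw [jden, actSp, hj, hA, hB, Matrix.det_one, inv_one, Matrix.mul_one, Matrix.one_mul]
  exact ⟨rfl, rfl⟩

theorem HalfIntegral.exists_sum_eq {t : MatQ m} (ht : HalfIntegral t) {S : Matrix (Fin m) (Fin m) ℤ}
    (hS : S.IsSymm) : ∃ z : ℤ, ∑ i, ∑ j, t i j * (S j i : ℚ) = z := by
  obtain ⟨hs, h2, h1⟩ := ht
  choose a ha using h2
  choose b hb using h1
  have e : ∀ i j, t i j * (S j i : ℚ) = (if i < j then t i j * (S j i : ℚ) else 0) +
      (if j < i then t j i * (S i j : ℚ) else 0) + if i = j then t i i * (S i i : ℚ) else 0 := by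
    intro i j
    rcases lt_trichotomy i j with h | rfl | h
    · simp [h, h.not_gt, h.ne]
    · simp
    · rw [if_neg h.not_gt, if_pos h, if_neg h.ne', hs.apply i j, hS.apply j i]
      ring
  have sw : ∑ i, ∑ j, (if j < i then t j i * (S i j : ℚ) else 0) =
      ∑ i, ∑ j, (if i < j then t i j * (S j i : ℚ) else 0) := Finset.sum_comm
  refine ⟨(∑ i, ∑ j, if i < j then a i j * S j i else 0) + ∑ i, b i * S i i, ?_⟩
  rw [Finset.sum_congr rfl fun i _ => Finset.sum_congr rfl fun j _ => e i j]
  simp only [Finset.sum_add_distrib]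
  rw [sw, ← Finset.sum_add_distrib]
  push_cast
  congr 1
  · refine Finset.sum_congr rfl fun i _ => ?_
    rw [← Finset.sum_add_distrib]
    refine Finset.sum_congr rfl fun j _ => ?_
    split_ifs
    · rw [← ha]; ring
    · simp
  · refine Finset.sum_congr rfl fun i _ => ?_
    simp [hb]

theorem eMat_add_int {t : MatQ m} (ht : HalfIntegral t) {S : Matrix (Fin m) (Fin m) ℤ}
    (hS : S.IsSymm) (τ : MatC m) : eMat t (τ + S.map fun z => (z : ℂ)) = eMat t τ := by
  obtain ⟨z, hz⟩ := ht.exists_sum_eq hS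
  rw [eMat_add, eMat_eq_ee t (S.map _)]
  have : ∑ i, ∑ j, (t i j : ℂ) * (S.map fun z => (z : ℂ)) j i = ((z : ℤ) : ℂ) := by
    have := congrArg (fun q : ℚ => (q : ℂ)) hz
    push_cast at this
    exact this
  rw [this, ee_int, mul_one]

theorem automorphic_upGen {c : MatQ m → ℂ} (hs : SuppQ c) (k : ℤ) {S : Matrix (Fin m) (Fin m) ℤ}
    (hS : S.IsSymm) : Automorphic (fourierSum c) k (upGen S) := by
  intro τ hτ
  obtain ⟨h1, h2⟩ := actSp_upGen S τ
  rw [h1, h2]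
  refine ⟨one_ne_zero, ?_, ?_⟩
  · refine ⟨hτ.1.add ?_, ?_⟩
    · rw [Matrix.IsSymm, ← Matrix.transpose_map, hS.eq]
    · have : (τ + S.map fun z => (z : ℂ)).map Complex.im = τ.map Complex.im := by
        ext i j; simp
      rw [this]
      exact hτ.2
  · rw [_root_.one_zpow, one_mul]
    refine tsum_congr fun t => ?_
    by_cases h : c t = 0
    · rw [h, zero_mul, zero_mul]
    · rw [eMat_add_int (hs t h).1 hS]

theorem actSp_glGen {U V : Matrix (Fin m) (Fin m) ℤ} (h : U * Vᵀ = 1) (τ : MatC m) :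
    jden (glGen U V) τ = (V.det : ℂ) ∧ actSp (glGen U V) τ =
      (U.map fun z => (z : ℂ)) * τ * (U.map fun z => (z : ℂ))ᵀ := by
  have hA : blkA (glGen U V) = U.map fun z => (z : ℂ) := rfl
  have hB : blkB (glGen U V) = 0 := by
    ext i j; simp [blkB, glGen]
  have hC : blkC (glGen U V) = 0 := by
    ext i j; simp [blkC, glGen]
  have hD : blkD (glGen U V) = V.map fun z => (z : ℂ) := rfl
  have hj : jmat (glGen U V) τ = V.map fun z => (z : ℂ) := by
    rw [jmat, hC, hD, Matrix.zero_mul, zero_add]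
  have hinv : (V.map fun z => (z : ℂ))⁻¹ = (U.map fun z => (z : ℂ))ᵀ := by
    apply Matrix.inv_eq_left_inv
    have h1 : Uᵀ * V = 1 := by
      rw [mul_eq_one_comm]
      have := congrArg Matrix.transpose h
      rwa [Matrix.transpose_mul, Matrix.transpose_transpose, Matrix.transpose_one] at this
    have := congrArg (Int.castRingHom ℂ).mapMatrix h1
    rw [map_mul, map_one] at this
    exact this
  rw [jden, actSp, hj, hA, hB, add_zero, hinv]
  exact ⟨(Int.cast_det V).symm, rfl⟩

theorem eMat_conj (t : MatQ m) (U : Matrix (Fin m) (Fin m) ℤ) (τ : MatC m) :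
    eMat t ((U.map fun z => (z : ℂ)) * τ * (U.map fun z => (z : ℂ))ᵀ) = eMat (conjZ U t) τ := by
  have hm : (conjZ U t).map (fun q => (q : ℂ)) =
      (U.map fun z => (z : ℂ))ᵀ * t.map (fun q => (q : ℂ)) * U.map fun z => (z : ℂ) := by
    ext i j
    simp [conjZ, Matrix.mul_apply]
  rw [eMat, eMat, hm, ← Matrix.mul_assoc, ← Matrix.mul_assoc, Matrix.trace_mul_comm]
  simp only [Matrix.mul_assoc]

theorem Sieg_conj {U V : Matrix (Fin m) (Fin m) ℤ} (h : U * Vᵀ = 1) {τ : MatC m} (hτ : τ ∈ Sieg m) :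
    (U.map fun z => (z : ℂ)) * τ * (U.map fun z => (z : ℂ))ᵀ ∈ Sieg m := by
  refine ⟨?_, ?_⟩
  · rw [Matrix.IsSymm, Matrix.transpose_mul, Matrix.transpose_mul, Matrix.transpose_transpose,
      hτ.1.eq, Matrix.mul_assoc]
  · have e : ((U.map fun z => (z : ℂ)) * τ * (U.map fun z => (z : ℂ))ᵀ).map Complex.im =
        (U.map fun z => (z : ℝ)) * τ.map Complex.im * (U.map fun z => (z : ℝ))ᴴ := by
      ext i j
      simp [Matrix.mul_apply, Complex.im_sum, Complex.mul_im, Finset.sum_mul]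
    rw [e]
    refine hτ.2.mul_mul_conjTranspose_same ?_
    have h2 : (U.map fun z => (z : ℝ)) * (Vᵀ.map fun z => (z : ℝ)) = 1 := by
      have h1 := congrArg (Int.castRingHom ℝ).mapMatrix h
      rw [map_mul, map_one] at h1
      exact h1
    intro x y hxy
    have := congrArg (fun v => v ᵥ* (Vᵀ.map fun z => (z : ℝ))) hxy
    simpa [Matrix.vecMul_vecMul, h2] using this

theorem automorphic_glGen {c : MatQ m → ℂ} {k : ℤ}
    (hc : ∀ u : Matrix (Fin m) (Fin m) ℤ, IsUnit u.det → ∀ t,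
      c t = ((u.det : ℚ) : ℂ) ^ k * c (conjZ u t)) {U V : Matrix (Fin m) (Fin m) ℤ}
    (h : U * Vᵀ = 1) : Automorphic (fourierSum c) k (glGen U V) := by
  intro τ hτ
  obtain ⟨h1, h2⟩ := actSp_glGen h τ
  have hdet : U.det * V.det = 1 := by
    rw [← Matrix.det_transpose V, ← Matrix.det_mul, h, Matrix.det_one]
  have hU : IsUnit U.det := IsUnit.of_mul_eq_one _ hdet
  have hUV : U.det = V.det := by
    rcases Int.isUnit_iff.mp hU with h' | h' <;> rw [h'] at hdet ⊢ <;> omega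
  rw [h1, h2]
  refine ⟨?_, Sieg_conj h hτ, ?_⟩
  · rw [← hUV]
    exact Int.cast_ne_zero.mpr hU.ne_zero
  · have hVU : Vᵀ * U = 1 := mul_eq_one_comm.mp h
    let e : MatQ m ≃ MatQ m :=
      { toFun := conjZ U
        invFun := conjZ Vᵀ
        left_inv := fun t => by rw [conjZ_conjZ, h, conjZ_one]
        right_inv := fun t => by rw [conjZ_conjZ, hVU, conjZ_one] }
    have e1 : ∀ t, c t * eMat t ((U.map fun z => (z : ℂ)) * τ * (U.map fun z => (z : ℂ))ᵀ) =
        (V.det : ℂ) ^ k * (c (e t) * eMat (e t) τ) := by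
      intro t
      rw [eMat_conj, hc U hU t, hUV, mul_assoc, Rat.cast_intCast]
      rfl
    rw [fourierSum, tsum_congr e1, tsum_mul_left, e.tsum_eq fun t => c t * eMat t τ]
    rfl

theorem fourierSum_sAct {n : ℕ} {k : ℤ} {c : MatQ (n + 1 + 1) → ℂ} (hc : IsSymFM (n + 1) 1 k c)
    {τ : MatC (n + 1 + 1)} (hτ : τ ∈ Sieg (n + 1 + 1)) :
    fourierSum c (sAct τ) = τ 0 0 ^ k * fourierSum c τ := by
  choose Φ hΦ using hc.slice
  have castSucc_mem : ∀ σ ∈ Sieg (n + 1 + 1), σ.submatrix Fin.castSucc Fin.castSucc ∈ Sieg (n + 1) :=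
    fun σ hσ => ⟨hσ.1.submatrix _, hσ.2.submatrix (Fin.castSucc_injective _)⟩
  have key : ∀ σ ∈ Sieg (n + 1 + 1), fourierSum c σ = ∑' q, Φ q σ := by
    intro σ hσ
    have h1 := (hasSum_fourierSum hc.suppQ hc.growthQ hσ).tsum_fiberwise
      fun t => t (Fin.last _) (Fin.last _)
    rw [← h1.tsum_eq]
    refine tsum_congr fun q => ?_
    rw [← (hΦ q σ hσ.1 (castSucc_mem σ hσ)).1.tsum_eq]
    refine (tsum_subtype ((fun t : MatQ (n + 1 + 1) => t (Fin.last _) (Fin.last _)) ⁻¹' {q})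
      fun t => c t * eMat t σ).trans (tsum_congr fun t => ?_)
    by_cases h : t (Fin.last _) (Fin.last _) = q
    · rw [Set.indicator_of_mem (by exact h), if_pos h]
    · rw [Set.indicator_of_notMem (by exact h), if_neg h, zero_mul]
  rw [key _ (sAct_mem_Sieg hτ), key τ hτ, ← tsum_mul_left]
  exact tsum_congr fun q => (hΦ q τ hτ.1 (castSucc_mem τ hτ)).2

theorem automorphic_sGen {n : ℕ} {k : ℤ} {c : MatQ (n + 1 + 1) → ℂ} (hc : IsSymFM (n + 1) 1 k c) :
    Automorphic (fourierSum c) k (sGen (n + 1)) := by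
  intro τ hτ
  have h0 := ne_zero_of_im_pos (im_pos_of_mem_Sieg hτ 0)
  rw [jden_sGen, actSp_sGen h0]
  exact ⟨h0, sAct_mem_Sieg hτ, fourierSum_sAct hc hτ⟩

theorem lowGen_single_zero (n : ℕ) (x : ℤ) : lowGen (Matrix.single (0 : Fin (n + 1)) 0 x) =
    sGen n * upGen (Matrix.single 0 0 (-x)) *
      (sGen n * glGen (1 - (2 : ℤ) • Matrix.single 0 0 1) (1 - (2 : ℤ) • Matrix.single 0 0 1)) := by
  rw [sGen, upGen, lowGen, glGen]
  simp only [fromBlocks_multiply]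
  have hE : (Matrix.single 0 0 1 : Matrix (Fin (n + 1)) (Fin (n + 1)) ℤ) * Matrix.single 0 0 1
    = Matrix.single 0 0 1 := by simp
  have h1 : ∀ y : ℤ, (Matrix.single 0 0 y : Matrix (Fin (n + 1)) (Fin (n + 1)) ℤ) =
      y • Matrix.single 0 0 1 := fun y => by simp
  rw [h1 x, h1 (-x)]
  generalize (Matrix.single 0 0 1 : Matrix (Fin (n + 1)) (Fin (n + 1)) ℤ) = E at hE
  congr 1 <;> simp only [mul_sub, sub_mul, mul_add, add_mul, mul_one, one_mul, mul_zero, zero_mul,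
    mul_neg, neg_mul, smul_mul_assoc, mul_smul_comm, hE] <;> module

theorem automorphic_lowGen {n : ℕ} {k : ℤ} {c : MatQ (n + 1 + 1) → ℂ}
    (hc : IsSymFM (n + 1) 1 k c) (i : Fin (n + 1 + 1)) (x : ℤ) :
    Automorphic (fourierSum c) k (lowGen (Matrix.single i i x)) := by
  have hgl : ∀ U V : Matrix (Fin (n + 1 + 1)) (Fin (n + 1 + 1)) ℤ, U * Vᵀ = 1 →
      Automorphic (fourierSum c) k (glGen U V) := fun U V h => automorphic_glGen hc.2.1 h
  have h0 : Automorphic (fourierSum c) k (lowGen (Matrix.single 0 0 x)) := by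
    rw [lowGen_single_zero]
    refine ((automorphic_sGen hc).mul (automorphic_upGen hc.suppQ k ?_)).mul
      ((automorphic_sGen hc).mul (hgl _ _ ?_))
    · rw [Matrix.IsSymm, Matrix.transpose_single]
    · have hE : (Matrix.single 0 0 1 : Matrix (Fin (n + 1 + 1)) (Fin (n + 1 + 1)) ℤ) *
        Matrix.single 0 0 1 = Matrix.single 0 0 1 := by simp
      have hT : (Matrix.single 0 0 1 : Matrix (Fin (n + 1 + 1)) (Fin (n + 1 + 1)) ℤ)ᵀ =
        Matrix.single 0 0 1 := by simp
      rw [Matrix.transpose_sub, Matrix.transpose_smul, hT, Matrix.transpose_one]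
      generalize (Matrix.single 0 0 1 : Matrix (Fin (n + 1 + 1)) (Fin (n + 1 + 1)) ℤ) = E at hE
      simp only [mul_sub, sub_mul, mul_one, one_mul, smul_mul_assoc, mul_smul_comm, hE]
      module
  have hsw := Matrix.swap_mul_self (R := ℤ) 0 i
  have e : lowGen (Matrix.single i i x) = glGen (Matrix.swap ℤ 0 i) (Matrix.swap ℤ 0 i) *
      lowGen (Matrix.single 0 0 x) * glGen (Matrix.swap ℤ 0 i) (Matrix.swap ℤ 0 i) := by
    have h1 : Matrix.swap ℤ 0 i * Matrix.single 0 0 x * Matrix.swap ℤ 0 i = Matrix.single i i x := by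
      rw [Matrix.swap, Equiv.Perm.permMatrix, PEquiv.toMatrix_toPEquiv_mul,
        PEquiv.mul_toMatrix_toPEquiv, Matrix.submatrix_submatrix]
      ext a b
      have h : ∀ a : Fin (n + 1 + 1), 0 = Equiv.swap 0 i a ↔ i = a := fun a => by
        rw [← Equiv.swap_apply_eq_iff, Equiv.swap_apply_left]
      simp [Matrix.single_apply, h]
    rw [lowGen, lowGen, glGen]
    simp only [fromBlocks_multiply]
    congr 1 <;> simp [hsw, h1]
  rw [e]
  have hg := hgl (Matrix.swap ℤ 0 i) (Matrix.swap ℤ 0 i) (by rw [Matrix.transpose_swap, hsw])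
  exact (hg.mul h0).mul hg

theorem automorphic_of_lower_zero {n : ℕ} {k : ℤ} {c : MatQ (n + 1 + 1) → ℂ}
    (hc : IsSymFM (n + 1) 1 k c)
    {γ : Matrix (Fin (n + 1 + 1) ⊕ Fin (n + 1 + 1)) (Fin (n + 1 + 1) ⊕ Fin (n + 1 + 1)) ℤ}
    (hγ : γ ∈ SpZ (n + 1 + 1)) (h : ∀ p q, γ (Sum.inr p) (Sum.inl q) = 0) :
    Automorphic (fourierSum c) k γ := by
  obtain ⟨A, B, D, rfl⟩ : ∃ A B D : Matrix (Fin (n + 1 + 1)) (Fin (n + 1 + 1)) ℤ,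
      γ = Matrix.fromBlocks A B 0 D := by
    refine ⟨γ.toBlocks₁₁, γ.toBlocks₁₂, γ.toBlocks₂₂, ?_⟩
    have : γ.toBlocks₂₁ = 0 := by
      ext p q; exact h p q
    rw [← this, Matrix.fromBlocks_toBlocks]
  simp only [SpZ, Set.mem_ofPred_eq, sympJ, fromBlocks_transpose, fromBlocks_multiply] at hγ
  rw [Matrix.fromBlocks_inj] at hγ
  obtain ⟨-, h12, -, h22⟩ := hγ
  simp only [Matrix.mul_zero, Matrix.mul_one, Matrix.zero_mul, Matrix.mul_neg,
    zero_add, add_zero, neg_zero, Matrix.transpose_zero, Matrix.neg_mul] at h12 h22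
  have hDA : Dᵀ * A = 1 := by
    have := congrArg Matrix.transpose h12
    rwa [Matrix.transpose_mul, Matrix.transpose_transpose, Matrix.transpose_one] at this
  have hAD : A * Dᵀ = 1 := mul_eq_one_comm.mp hDA
  have hS : (Dᵀ * B).IsSymm := by
    rw [Matrix.IsSymm, Matrix.transpose_mul, Matrix.transpose_transpose]
    have : Bᵀ * D - Dᵀ * B = 0 := by rw [← h22]; abel
    exact sub_eq_zero.mp this
  have e : Matrix.fromBlocks A B 0 D = glGen A D * upGen (Dᵀ * B) := by
    rw [glGen, upGen, fromBlocks_multiply]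
    congr 1 <;> simp [← Matrix.mul_assoc, hAD]
  rw [e]
  exact (automorphic_glGen hc.2.1 hAD).mul (automorphic_upGen hc.suppQ k hS)

theorem automorphic_of_mem_SpZ {n : ℕ} {k : ℤ} {c : MatQ (n + 1 + 1) → ℂ}
    (hc : IsSymFM (n + 1) 1 k c) : ∀ γ ∈ SpZ (n + 1 + 1), Automorphic (fourierSum c) k γ := by
  refine SpZ_induction ?_ ?_ ?_ fun γ hγ h => automorphic_of_lower_zero hc hγ h
  · intro i x γ h
    have e : γ = upGen (Matrix.single i i (-x)) * (upGen (Matrix.single i i x) * γ) := by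
      rw [← Matrix.mul_assoc, upGen, upGen, fromBlocks_multiply]
      simp [← Matrix.single_add]
    rw [e]
    exact (automorphic_upGen hc.suppQ k (by rw [Matrix.IsSymm, Matrix.transpose_single])).mul h
  · intro i x γ h
    have e : γ = lowGen (Matrix.single i i (-x)) * (lowGen (Matrix.single i i x) * γ) := by
      rw [← Matrix.mul_assoc, lowGen, lowGen, fromBlocks_multiply]
      simp [← Matrix.single_add]
    rw [e]
    exact (automorphic_lowGen hc i _).mul h
  · intro i j hij x γ h
    have e : γ = elGen i j (-x) * (elGen i j x * γ) := by
      rw [← Matrix.mul_assoc, elGen, elGen, glGen, glGen, fromBlocks_multiply]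
      simp [Matrix.transvection_mul_transvection_same _ _ hij,
        Matrix.transvection_mul_transvection_same _ _ hij.symm]
    rw [e]
    refine Automorphic.mul (automorphic_glGen hc.2.1 ?_) h
    have : (Matrix.transvection j i (- -x))ᵀ = Matrix.transvection i j x := by
      simp [Matrix.transvection]
    rw [this, Matrix.transvection_mul_transvection_same _ _ hij]
    simp

end Automorphy

end

theorem symFM_root_of_polynomial_is_modular
    {h : ℕ} (hh : 1 ≤ h) (k k0 : ℤ) (d : ℕ) (hd : 0 < d)
    (a : (i : Fin (d + 1)) → SiegelMF (h + 1) (k0 + ((d : ℤ) - ((i : ℕ) : ℤ)) * k))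
    (hQdeg : (a (Fin.last d)).Nonzero)      -- Q is nonzero of degree d
    (c : MatQ (h + 1) → ℂ) (hc : IsSymFM h 1 k c)
    (hrel : ∀ t, (∑ i : Fin (d + 1), convC (a i).coeff (powC c i) t) = 0) :
    ∃ F : SiegelMF (h + 1) k, F.coeff = c := by
  obtain ⟨n, rfl⟩ := Nat.exists_eq_add_of_le' hh
  exact ⟨{ toFun := fourierSum c
           coeff := c
           holo := fun τ hτ =>
             (differentiableAt_fourierSum hc.suppQ hc.growthQ hτ).differentiableWithinAt
           transf := fun γ hγ τ hτ => (automorphic_of_mem_SpZ hc γ hγ τ hτ).2.2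
           supp := hc.1
           expansion := fun τ hτ => hasSum_fourierSum hc.suppQ hc.growthQ hτ }, rfl⟩

end
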